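/- If u ∈ P_∞(0,M) and the complement ℝ^N \ Ω has nonempty interior, then u ≥ 0 everywhere on ℝ^N. -/

import Mathlib

open MeasureTheory Metric Set Filter
open scoped RealInnerProductSpace

noncomputable section

/-- The Laplacian of `φ` at `x`, as the sum of the pure second derivatives. -/
def lap (N : ℕ) (φ : EuclideanSpace ℝ (Fin N) → ℝ) (x : EuclideanSpace ℝ (Fin N)) : ℝ :=
  ∑ i : Fin N,
    fderiv ℝ (fun y => fderiv ℝ φ y (EuclideanSpace.single i 1)) x (EuclideanSpace.single i 1)

/-- Membership in the class `P_r(z, M)`. -/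
def MemP (N : ℕ) (r : ℝ) (z : EuclideanSpace ℝ (Fin N)) (M : ℝ)
    (Ω : Set (EuclideanSpace ℝ (Fin N))) (u : EuclideanSpace ℝ (Fin N) → ℝ) : Prop :=
  IsOpen Ω ∧ ContDiff ℝ 1 u ∧
    (∀ φ : EuclideanSpace ℝ (Fin N) → ℝ, ContDiff ℝ (⊤ : ℕ∞) φ → tsupport φ ⊆ ball z r →
      ∫ x, u x * lap N φ x = ∫ x in Ω, φ x) ∧
    (∀ x ∈ ball z r \ Ω, u x = 0 ∧ gradient u x = 0) ∧
    (∀ x ∈ ball z r, |u x| ≤ M) ∧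
    z ∈ frontier Ω

/-- Membership in the class `P_∞(0, M)` of global solutions with quadratic growth. -/
def MemPinf (N : ℕ) (M : ℝ) (Ω : Set (EuclideanSpace ℝ (Fin N)))
    (u : EuclideanSpace ℝ (Fin N) → ℝ) : Prop :=
  IsOpen Ω ∧ ContDiff ℝ 1 u ∧
    (∀ φ : EuclideanSpace ℝ (Fin N) → ℝ, ContDiff ℝ (⊤ : ℕ∞) φ → HasCompactSupport φ →
      ∫ x, u x * lap N φ x = ∫ x in Ω, φ x) ∧
    (∀ x ∈ Ωᶜ, u x = 0 ∧ gradient u x = 0) ∧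
    (0 : EuclideanSpace ℝ (Fin N)) ∈ frontier Ω ∧
    (∀ x, |u x| ≤ M * (‖x‖ ^ 2 + 1))

/-- The minimum diameter of a set: the smallest width of a slab containing it. -/
def MD (N : ℕ) (D : Set (EuclideanSpace ℝ (Fin N))) : ℝ :=
  ⨅ e : {e : EuclideanSpace ℝ (Fin N) // ‖e‖ = 1},
    ((⨆ x : D, ⟪(x : EuclideanSpace ℝ (Fin N)), (e : EuclideanSpace ℝ (Fin N))⟫) -
      ⨅ x : D, ⟪(x : EuclideanSpace ℝ (Fin N)), (e : EuclideanSpace ℝ (Fin N))⟫)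

/-- The density function `δ_r(u)`. -/
def deltaFn (N : ℕ) (u : EuclideanSpace ℝ (Fin N) → ℝ) (r : ℝ) : ℝ :=
  MD N ({x | u x = 0 ∧ gradient u x = 0} ∩ ball 0 r) / r

/-- Half-space solutions `x ↦ (max(⟪x,e⟫,0))²/2`. -/
def IsHalfSpaceSol (N : ℕ) (u : EuclideanSpace ℝ (Fin N) → ℝ) : Prop :=
  ∃ e : EuclideanSpace ℝ (Fin N), ‖e‖ = 1 ∧ ∀ x, u x = (max ⟪x, e⟫ 0) ^ 2 / 2

/-- `∂Ω ∩ B` is the graph of a `C¹` function. -/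
def IsC1Graph (N : ℕ) (Ω B : Set (EuclideanSpace ℝ (Fin N))) : Prop :=
  ∃ (e : EuclideanSpace ℝ (Fin N)) (f : EuclideanSpace ℝ (Fin N) → ℝ),
    ‖e‖ = 1 ∧ ContDiff ℝ 1 f ∧
    Ω ∩ B = {x ∈ B | f (x - ⟪x, e⟫ • e) < ⟪x, e⟫} ∧
    frontier Ω ∩ B = {x ∈ B | ⟪x, e⟫ = f (x - ⟪x, e⟫ • e)}

/-- `∂Ω ∩ B` is the graph of a real-analytic function. -/
def IsAnalyticGraph (N : ℕ) (Ω B : Set (EuclideanSpace ℝ (Fin N))) : Prop :=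
  ∃ (e : EuclideanSpace ℝ (Fin N)) (f : EuclideanSpace ℝ (Fin N) → ℝ),
    ‖e‖ = 1 ∧ (∀ x, AnalyticAt ℝ f x) ∧
    Ω ∩ B = {x ∈ B | f (x - ⟪x, e⟫ • e) < ⟪x, e⟫} ∧
    frontier Ω ∩ B = {x ∈ B | ⟪x, e⟫ = f (x - ⟪x, e⟫ • e)}

/-- The Alt–Caffarelli–Friedman functional `φ(r, v)` centered at the origin. -/
def acf (N : ℕ) (v : EuclideanSpace ℝ (Fin N) → ℝ) (r : ℝ) : ℝ :=
  r ^ (-4 : ℤ) *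
    (∫ x in ball (0 : EuclideanSpace ℝ (Fin N)) r,
      ‖gradient (fun y => max (v y) 0) x‖ ^ 2 * ‖x‖ ^ ((2 : ℤ) - (N : ℤ))) *
    ∫ x in ball (0 : EuclideanSpace ℝ (Fin N)) r,
      ‖gradient (fun y => max (-v y) 0) x‖ ^ 2 * ‖x‖ ^ ((2 : ℤ) - (N : ℤ))

/-- `S_j(z, u) = sup_{B(z, 2^{-j})} |u|`. -/
def Sj (N : ℕ) (z : EuclideanSpace ℝ (Fin N)) (u : EuclideanSpace ℝ (Fin N) → ℝ) (j : ℕ) : ℝ :=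
  sSup ((fun x => |u x|) '' ball z ((2 : ℝ) ^ (-(j : ℤ))))

section

/-- Euclidean space of dimension `N`. -/
abbrev Eu (N : ℕ) := EuclideanSpace ℝ (Fin N)

variable {N : ℕ}

/-- The derivative of `f` in the direction `a`. -/
def dd (f : Eu N → ℝ) (a : Eu N) : Eu N → ℝ := fun x => fderiv ℝ f x a

/-- Smooth compactly supported functions. -/
def Tst (g : Eu N → ℝ) : Prop := ContDiff ℝ (⊤ : ℕ∞) g ∧ HasCompactSupport g

/-- Convolution of two real functions. -/
def cv (f g : Eu N → ℝ) (x : Eu N) : ℝ := ∫ z, f z * g (x - z)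

theorem Tst.continuous {g : Eu N → ℝ} (hg : Tst g) : Continuous g := hg.1.continuous

theorem contDiff_dd {g : Eu N → ℝ} (hg : ContDiff ℝ (⊤ : ℕ∞) g) (a : Eu N) :
    ContDiff ℝ (⊤ : ℕ∞) (dd g a) :=
  (hg.fderiv_right (m := (⊤ : ℕ∞)) (by simp)).clm_apply contDiff_const

theorem Tst.dd {g : Eu N → ℝ} (hg : Tst g) (a : Eu N) : Tst (_root_.dd g a) :=
  ⟨contDiff_dd hg.1 a, hg.2.fderiv_apply ℝ a⟩

theorem Tst.differentiable {g : Eu N → ℝ} (hg : Tst g) : Differentiable ℝ g :=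
  hg.1.differentiable (by simp)

theorem Tst.add {g h : Eu N → ℝ} (hg : Tst g) (hh : Tst h) : Tst (fun x => g x + h x) :=
  ⟨hg.1.add hh.1, hg.2.add hh.2⟩

theorem Tst.const_mul {g : Eu N → ℝ} (hg : Tst g) (c : ℝ) : Tst (fun x => c * g x) :=
  ⟨contDiff_const.mul hg.1, hg.2.mul_left⟩

theorem tst_sum {ι : Type*} (s : Finset ι) (g : ι → Eu N → ℝ) (hg : ∀ i ∈ s, Tst (g i)) :
    Tst (fun x => ∑ i ∈ s, g i x) := by
  classical
  induction s using Finset.induction_on with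
  | empty =>
    simp only [Finset.sum_empty]
    exact ⟨contDiff_const, HasCompactSupport.zero⟩
  | insert i s hi ih =>
    simp only [Finset.sum_insert hi]
    exact (hg i (by simp)).add (ih fun j hj => hg j (by simp [hj]))

theorem Tst.bound {g : Eu N → ℝ} (hg : Tst g) : ∃ C, 0 ≤ C ∧ ∀ x, |g x| ≤ C := by
  obtain ⟨C, hC⟩ := hg.2.exists_bound_of_continuous hg.continuous
  exact ⟨max C 0, le_max_right _ _, fun x => le_max_of_le_left (by simpa using hC x)⟩

theorem dd_sub {f g : Eu N → ℝ} (hf : Differentiable ℝ f) (hg : Differentiable ℝ g) (a : Eu N) :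
    dd (fun x => f x - g x) a = fun x => dd f a x - dd g a x := by
  funext x
  simp only [dd]
  rw [fderiv_fun_sub (hf x) (hg x)]
  rfl

theorem dd_add {f g : Eu N → ℝ} (hf : Differentiable ℝ f) (hg : Differentiable ℝ g) (a : Eu N) :
    dd (fun x => f x + g x) a = fun x => dd f a x + dd g a x := by
  funext x
  simp only [dd]
  rw [fderiv_fun_add (hf x) (hg x)]
  rfl

theorem dd_const_mul {f : Eu N → ℝ} (hf : Differentiable ℝ f) (c : ℝ) (a : Eu N) :
    dd (fun x => c * f x) a = fun x => c * dd f a x := by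
  funext x
  simp only [dd]
  rw [fderiv_const_mul (hf x)]
  rfl

theorem dd_comp_smul (g : Eu N → ℝ) (c : ℝ) (a : Eu N) :
    dd (fun x => g (c • x)) a = fun x => c * dd g a (c • x) := by
  funext x
  simp only [dd]
  rw [show (fun x => g (c • x)) = fun x => g (c • x) from rfl, fderiv_comp_smul]
  simp

theorem dd_comp_sub_left (g : Eu N → ℝ) (a y : Eu N) :
    dd (fun x => g (y - x)) a = fun x => - dd g a (y - x) := by
  funext x
  have h : (fun x => g (y - x)) = fun x => (fun w => g ((-1 : ℝ) • w)) (x - y) := by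
    funext w; simp
  simp only [dd]
  rw [h, fderiv_comp_sub (f := fun w => g ((-1 : ℝ) • w)), fderiv_comp_smul]
  simp

theorem dd_comp_add (g : Eu N → ℝ) (a y : Eu N) :
    dd (fun x => g (x + y)) a = fun x => dd g a (x + y) := by
  funext x
  simp only [dd]
  rw [fderiv_comp_add_right]

theorem dd_smul_dir (g : Eu N → ℝ) (c : ℝ) (a : Eu N) (x : Eu N) :
    dd g (c • a) x = c * dd g a x := by simp [dd]

theorem dd_dd_apply {g : Eu N → ℝ} (hg : ContDiff ℝ 2 g) (a b x : Eu N) :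
    dd (dd g a) b x = fderiv ℝ (fderiv ℝ g) x b a := by
  have h : DifferentiableAt ℝ (fderiv ℝ g) x :=
    ((hg.fderiv_right (m := 1) (by norm_num)).differentiable (by simp)) x
  have := h.hasFDerivAt.clm_apply (hasFDerivAt_const a x)
  rw [dd, show dd g a = fun y => fderiv ℝ g y a from rfl, this.fderiv]
  simp

theorem dd_dd_comm {g : Eu N → ℝ} (hg : ContDiff ℝ 2 g) (a b x : Eu N) :
    dd (dd g a) b x = dd (dd g b) a x := by
  rw [dd_dd_apply hg, dd_dd_apply hg]
  exact (hg.contDiffAt.isSymmSndFDerivAt (by simp)).eq b a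

theorem lap_eq (g : Eu N → ℝ) (x : Eu N) :
    lap N g x = ∑ i : Fin N, dd (dd g (EuclideanSpace.single i 1)) (EuclideanSpace.single i 1) x :=
  rfl

theorem Tst.lap {g : Eu N → ℝ} (hg : Tst g) : Tst (_root_.lap N g) := by
  have : _root_.lap N g = fun x => ∑ i ∈ (Finset.univ : Finset (Fin N)),
    _root_.dd (_root_.dd g (EuclideanSpace.single i 1)) (EuclideanSpace.single i 1) x := rfl
  rw [this]
  exact tst_sum _ _ fun i _ => (hg.dd _).dd _

theorem lap_comp_sub_left {g : Eu N → ℝ} (hg : ContDiff ℝ (⊤ : ℕ∞) g) (y x : Eu N) :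
    lap N (fun z => g (y - z)) x = lap N g (y - x) := by
  rw [lap_eq, lap_eq]
  refine Finset.sum_congr rfl fun i _ => ?_
  rw [dd_comp_sub_left]
  have h : (fun x => - dd g (EuclideanSpace.single i 1) (y - x)) =
    fun x => (-1 : ℝ) * (fun x => dd g (EuclideanSpace.single i 1) (y - x)) x := by
    funext x; ring
  rw [h, dd_const_mul, dd_comp_sub_left]
  · simp
  · exact ((contDiff_dd hg _).comp (contDiff_const.sub contDiff_id)).differentiable (by simp)

theorem Tst.comp_sub_left {g : Eu N → ℝ} (hg : Tst g) (y : Eu N) : Tst (fun x => g (y - x)) :=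
  ⟨hg.1.comp (contDiff_const.sub contDiff_id),
    hg.2.comp_homeomorph (Homeomorph.subLeft y)⟩

theorem Tst.comp_smul {g : Eu N → ℝ} (hg : Tst g) {c : ℝ} (hc : c ≠ 0) :
    Tst (fun x => g (c • x)) :=
  ⟨hg.1.comp (contDiff_const_smul c), hg.2.comp_homeomorph (Homeomorph.smulOfNeZero c hc)⟩

/-! ### Convolutions -/

theorem cv_eq_convolution (f g : Eu N → ℝ) :
    cv f g = convolution f g (ContinuousLinearMap.mul ℝ ℝ) volume := by
  funext x; rfl

theorem cv_integrable {f g : Eu N → ℝ} (hf : LocallyIntegrable f) (hg : Tst g) (x : Eu N) :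
    Integrable (fun z => f z * g (x - z)) :=
  (hg.2.convolutionExists_right (ContinuousLinearMap.mul ℝ ℝ) hf hg.continuous) x

theorem contDiff_cv {f g : Eu N → ℝ} (hf : LocallyIntegrable f) (hg : Tst g) :
    ContDiff ℝ (⊤ : ℕ∞) (cv f g) := by
  rw [cv_eq_convolution]
  exact hg.2.contDiff_convolution_right _ hf hg.1

theorem dd_cv {f g : Eu N → ℝ} (hf : LocallyIntegrable f) (hg : Tst g) (a : Eu N) :
    dd (cv f g) a = cv f (dd g a) := by
  funext x
  have h := hg.2.hasFDerivAt_convolution_right (ContinuousLinearMap.mul ℝ ℝ) hf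
    (hg.1.of_le (by simp)) x
  rw [dd, cv_eq_convolution, h.fderiv, convolution_precompR_apply _ hf (hg.2.fderiv ℝ)
    (hg.1.continuous_fderiv (by simp)), cv_eq_convolution]
  rfl

theorem cv_sub_right {f g h : Eu N → ℝ} (hf : LocallyIntegrable f) (hg : Tst g) (hh : Tst h)
    (x : Eu N) : cv f (fun z => g z - h z) x = cv f g x - cv f h x := by
  simp only [cv]
  rw [← integral_sub (cv_integrable hf hg x) (cv_integrable hf hh x)]
  simp only [mul_sub]

theorem cv_const_mul_right (f g : Eu N → ℝ) (c : ℝ) (x : Eu N) :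
    cv f (fun z => c * g z) x = c * cv f g x := by
  simp only [cv]
  rw [← integral_const_mul]
  congr 1; funext z; ring

theorem cv_sum_right {ι : Type*} (s : Finset ι) {f : Eu N → ℝ} (hf : LocallyIntegrable f)
    (g : ι → Eu N → ℝ) (hg : ∀ i ∈ s, Tst (g i)) (x : Eu N) :
    cv f (fun z => ∑ i ∈ s, g i z) x = ∑ i ∈ s, cv f (g i) x := by
  simp only [cv, Finset.mul_sum]
  exact integral_finsetSum s fun i hi => cv_integrable hf (hg i hi) x

theorem cv_add_left {f f' g : Eu N → ℝ} (hf : LocallyIntegrable f) (hf' : LocallyIntegrable f')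
    (hg : Tst g) (x : Eu N) : cv (fun z => f z + f' z) g x = cv f g x + cv f' g x := by
  simp only [cv]
  rw [← integral_add (cv_integrable hf hg x) (cv_integrable hf' hg x)]
  simp only [add_mul]

theorem cv_sub_left {f f' g : Eu N → ℝ} (hf : LocallyIntegrable f) (hf' : LocallyIntegrable f')
    (hg : Tst g) (x : Eu N) : cv (fun z => f z - f' z) g x = cv f g x - cv f' g x := by
  simp only [cv]
  rw [← integral_sub (cv_integrable hf hg x) (cv_integrable hf' hg x)]
  simp only [sub_mul]

theorem cv_const_mul_left (f g : Eu N → ℝ) (c : ℝ) (x : Eu N) :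
    cv (fun z => c * f z) g x = c * cv f g x := by
  simp only [cv]
  rw [← integral_const_mul]
  congr 1; funext z; ring

theorem cv_comp_add_left (f g : Eu N → ℝ) (h x : Eu N) :
    cv (fun z => f (z + h)) g x = cv f g (x + h) := by
  simp only [cv]
  rw [← integral_add_right_eq_self _ (-h)]
  congr 1; funext z
  rw [show x - (z + -h) = x + h - z by abel, neg_add_cancel_right]

theorem cv_swap (f g : Eu N → ℝ) (x : Eu N) : cv f g x = ∫ z, f (x - z) * g z := by
  simp only [cv]
  rw [← integral_sub_left_eq_self _ volume x]
  simp

theorem cv_const_left (c : ℝ) (g : Eu N → ℝ) (x : Eu N) :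
    cv (fun _ => c) g x = c * ∫ z, g z := by
  rw [cv_swap, integral_const_mul]

theorem cv_mono_left {f f' g : Eu N → ℝ} (hf : LocallyIntegrable f) (hf' : LocallyIntegrable f')
    (hg : Tst g) (x : Eu N) (h : ∀ z, f z * g (x - z) ≤ f' z * g (x - z)) :
    cv f g x ≤ cv f' g x :=
  integral_mono (cv_integrable hf hg x) (cv_integrable hf' hg x) h

theorem cv_mono_right {f g g' : Eu N → ℝ} (hf : LocallyIntegrable f) (hg : Tst g)
    (hg' : Tst g') (x y : Eu N) (h : ∀ z, f z * g (x - z) ≤ f z * g' (y - z)) :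
    cv f g x ≤ cv f g' y :=
  integral_mono (cv_integrable hf hg x) (cv_integrable hf hg' y) h

theorem cv_by_parts {f g : Eu N → ℝ} (hf : ContDiff ℝ 1 f) (hg : Tst g) (a x : Eu N) :
    cv f (dd g a) x = cv (dd f a) g x := by
  have hf' : Continuous (dd f a) := (hf.continuous_fderiv one_ne_zero).clm_apply continuous_const
  have key := integral_mul_fderiv_eq_neg_fderiv_mul_of_integrable (μ := volume) (f := f)
    (g := fun z => g (x - z)) (v := a) (cv_integrable hf'.locallyIntegrable hg x)
    (?_) (cv_integrable hf.continuous.locallyIntegrable hg x)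
    (fun z _ => hf.differentiable one_ne_zero z)
    (fun z _ => (hg.comp_sub_left x).differentiable z)
  · have h2 : ∀ z, fderiv ℝ (fun z => g (x - z)) z a = - dd g a (x - z) := fun z =>
      congrFun (dd_comp_sub_left g a x) z
    simp only [h2, mul_neg, integral_neg, neg_inj] at key
    exact key
  · have h2 : ∀ z, fderiv ℝ (fun z => g (x - z)) z a = - dd g a (x - z) := fun z =>
      congrFun (dd_comp_sub_left g a x) z
    simp only [h2, mul_neg]
    exact (cv_integrable hf.continuous.locallyIntegrable (hg.dd a) x).neg

/-! ### Second differences -/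

/-- The symmetric second difference of `f` at `x` with step `h`. -/
def secDiff (f : Eu N → ℝ) (h x : Eu N) : ℝ := f (x + h) + f (x - h) - 2 * f x

theorem hasDerivAt_line {f : Eu N → ℝ} (hf : Differentiable ℝ f) (x h : Eu N) (t : ℝ) :
    HasDerivAt (fun s : ℝ => f (x + s • h)) (dd f h (x + t • h)) t := by
  have h1 : HasDerivAt (fun s : ℝ => x + s • h) h t := by
    simpa using ((hasDerivAt_id t).smul_const h).const_add x
  exact (hf (x + t • h)).hasFDerivAt.comp_hasDerivAt t h1

theorem exists_dd_eq {f : Eu N → ℝ} (hf : Differentiable ℝ f) (x h : Eu N) :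
    ∃ s ∈ Ioo (0 : ℝ) 1, f (x + h) - f x = dd f h (x + s • h) := by
  obtain ⟨s, hs, h1⟩ := exists_hasDerivAt_eq_slope (fun s : ℝ => f (x + s • h))
    (fun t => dd f h (x + t • h)) zero_lt_one
    (fun t _ => (hasDerivAt_line hf x h t).continuousAt.continuousWithinAt)
    (fun t _ => hasDerivAt_line hf x h t)
  refine ⟨s, hs, ?_⟩
  simpa using h1.symm

theorem secDiff_ge {F : Eu N → ℝ} (hF : ContDiff ℝ 2 F) {h x : Eu N} {m : ℝ}
    (hm : ∀ s ∈ Icc (-1 : ℝ) 1, m ≤ dd (dd F h) h (x + s • h)) : m ≤ secDiff F h x := by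
  have hd : Differentiable ℝ F := hF.differentiable (by simp)
  have hd2 : Differentiable ℝ (dd F h) :=
    ((hF.fderiv_right (m := 1) (by norm_num)).clm_apply contDiff_const).differentiable (by simp)
  have h1 : ∀ t : ℝ, HasDerivAt (fun s : ℝ => F (x + s • h) - m / 2 * s ^ 2)
      (dd F h (x + t • h) - m * t) t := fun t => by
    refine (hasDerivAt_line hd x h t).sub ?_
    refine ((hasDerivAt_pow 2 t).const_mul (m / 2)).congr_deriv ?_
    push_cast; ring
  have h2 : ∀ t : ℝ, HasDerivAt (fun t : ℝ => dd F h (x + t • h) - m * t)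
      (dd (dd F h) h (x + t • h) - m) t := fun t => by
    refine (hasDerivAt_line hd2 x h t).sub ?_
    simpa using (hasDerivAt_id t).const_mul m
  have hc : ConvexOn ℝ (Icc (-1 : ℝ) 1) (fun s : ℝ => F (x + s • h) - m / 2 * s ^ 2) := by
    refine convexOn_of_hasDerivWithinAt2_nonneg (convex_Icc _ _)
      (fun t _ => (h1 t).continuousAt.continuousWithinAt)
      (fun t _ => (h1 t).hasDerivWithinAt) (fun t _ => (h2 t).hasDerivWithinAt) ?_
    intro t ht
    have := hm t (interior_subset ht)
    linarith
  have := hc.2 (show (-1 : ℝ) ∈ Icc (-1 : ℝ) 1 by simp) (show (1 : ℝ) ∈ Icc (-1 : ℝ) 1 by simp)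
    (show (0 : ℝ) ≤ 1 / 2 by norm_num) (show (0 : ℝ) ≤ 1 / 2 by norm_num) (by norm_num)
  simp only [smul_eq_mul] at this
  norm_num at this
  rw [secDiff, sub_eq_add_neg x h]
  linarith

theorem gradient_ineq {f : Eu N → ℝ} (hf : Differentiable ℝ f)
    (hQ : ∀ h x, 0 ≤ secDiff f h x) (x v : Eu N) : f x + dd f v x ≤ f (x + v) := by
  have hstep : ∀ n : ℕ, (2 : ℝ) ^ n * (f (x + ((1 / 2 : ℝ) ^ n) • v) - f x) ≤ f (x + v) - f x := by
    intro n
    induction n with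
    | zero => simp
    | succ n ih =>
      refine le_trans ?_ ih
      have h := hQ (((1 / 2 : ℝ) ^ (n + 1)) • v) (x + ((1 / 2 : ℝ) ^ (n + 1)) • v)
      simp only [secDiff, add_sub_cancel_right] at h
      rw [add_assoc, ← add_smul, show (1 / 2 : ℝ) ^ (n + 1) + (1 / 2 : ℝ) ^ (n + 1) = (1 / 2) ^ n by
        ring] at h
      have h2 : (0 : ℝ) < 2 ^ n := by positivity
      rw [pow_succ, mul_assoc]
      refine mul_le_mul_of_nonneg_left ?_ h2.le
      linarith
  have hd := hasDerivAt_line hf x v 0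
  rw [hasDerivAt_iff_tendsto_slope] at hd
  have hseq : Tendsto (fun n : ℕ => (1 / 2 : ℝ) ^ n) atTop (nhdsWithin 0 {0}ᶜ) := by
    refine tendsto_nhdsWithin_iff.2 ⟨tendsto_pow_atTop_nhds_zero_of_lt_one (by norm_num)
      (by norm_num), Eventually.of_forall fun n => ?_⟩
    simp
  have hl := hd.comp hseq
  simp only [zero_smul, add_zero] at hl
  have : dd f v x ≤ f (x + v) - f x := by
    refine le_of_tendsto hl (Eventually.of_forall fun n => ?_)
    refine le_trans (le_of_eq ?_) (hstep n)
    simp [slope]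
  linarith

theorem dd_dd_nonneg_of_sdiff {F : Eu N → ℝ} (hF : ContDiff ℝ 2 F)
    (hQ : ∀ h x, 0 ≤ secDiff F h x) (e x : Eu N) : 0 ≤ dd (dd F e) e x := by
  have hd : Differentiable ℝ F := hF.differentiable (by simp)
  have hd2 : Differentiable ℝ (dd F e) :=
    ((hF.fderiv_right (m := 1) (by norm_num)).clm_apply contDiff_const).differentiable (by simp)
  have hmono : Monotone (fun t : ℝ => dd F e (x + t • e)) := by
    intro s t hst
    rcases hst.eq_or_lt with rfl | hlt
    · exact le_rfl
    have h1 := gradient_ineq hd hQ (x + s • e) ((t - s) • e)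
    have h2 := gradient_ineq hd hQ (x + t • e) ((s - t) • e)
    rw [add_assoc, ← add_smul, dd_smul_dir] at h1 h2
    rw [show s + (t - s) = t by ring] at h1
    rw [show t + (s - t) = s by ring] at h2
    have : 0 ≤ (t - s) * (dd F e (x + t • e) - dd F e (x + s • e)) := by linarith
    exact sub_nonneg.1 (nonneg_of_mul_nonneg_right this (sub_pos.2 hlt))
  have h := hasDerivAt_line hd2 x e 0
  simp only [zero_smul, add_zero] at h
  rw [← h.deriv]
  exact hmono.deriv_nonneg

theorem contDiff_normSq : ContDiff ℝ (⊤ : ℕ∞) (fun x : Eu N => ‖x‖ ^ 2) := contDiff_norm_sq ℝ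

theorem dd_normSq (a : Eu N) : dd (fun x : Eu N => ‖x‖ ^ 2) a = fun x => 2 * ⟪x, a⟫ := by
  funext x
  rw [dd, (hasStrictFDerivAt_norm_sq x).hasFDerivAt.fderiv]
  simp [two_smul, two_mul]

theorem dd_inner (a b : Eu N) : dd (fun x : Eu N => ⟪x, a⟫) b = fun _ => ⟪b, a⟫ := by
  funext x
  have : HasFDerivAt (fun x : Eu N => ⟪x, a⟫) ((innerSL ℝ).flip a) x :=
    ((innerSL ℝ).flip a).hasFDerivAt
  rw [dd, this.fderiv]
  rfl

theorem dd_dd_normSq (a b : Eu N) :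
    dd (dd (fun x : Eu N => ‖x‖ ^ 2) a) b = fun _ => 2 * ⟪a, b⟫ := by
  rw [dd_normSq, dd_const_mul, dd_inner]
  · simp only [real_inner_comm]
  · exact ((innerSL ℝ).flip a).differentiable

theorem secDiff_normSq (h x : Eu N) : secDiff (fun x : Eu N => ‖x‖ ^ 2) h x = 2 * ‖h‖ ^ 2 := by
  simp only [secDiff]
  rw [norm_add_sq_real, norm_sub_sq_real]; ring

theorem secDiff_add_const_mul (f g : Eu N → ℝ) (c : ℝ) (h x : Eu N) :
    secDiff (fun x => f x + c * g x) h x = secDiff f h x + c * secDiff g h x := by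
  simp only [secDiff]; ring

theorem dd_dd_ge_of_sdiff {F : Eu N → ℝ} (hF : ContDiff ℝ 2 F) {c : ℝ}
    (hQ : ∀ h x, -c * ‖h‖ ^ 2 ≤ secDiff F h x) (e x : Eu N) :
    -c * ‖e‖ ^ 2 ≤ dd (dd F e) e x := by
  have hn : ContDiff ℝ 2 (fun x : Eu N => ‖x‖ ^ 2) := contDiff_norm_sq ℝ
  have hn1 : Differentiable ℝ (fun x : Eu N => ‖x‖ ^ 2) := hn.differentiable (by simp)
  have hn2 : Differentiable ℝ (dd (fun x : Eu N => ‖x‖ ^ 2) e) := 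
    ((hn.fderiv_right (m := 1) (by norm_num)).clm_apply contDiff_const).differentiable (by simp)
  have hd2 : Differentiable ℝ (dd F e) :=
    ((hF.fderiv_right (m := 1) (by norm_num)).clm_apply contDiff_const).differentiable (by simp)
  have := dd_dd_nonneg_of_sdiff (hF.add (contDiff_const (c := c / 2) |>.mul hn))
    (fun h x => by
      have := hQ h x
      rw [secDiff_add_const_mul, secDiff_normSq]
      linarith) e x
  rw [dd_add (hF.differentiable (by simp)) (hn1.const_mul _), dd_const_mul hn1,
    dd_add hd2 (hn2.const_mul _), dd_const_mul hn2, dd_dd_normSq] at this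
  simp only [real_inner_self_eq_norm_sq] at this
  linarith

/-! ### A radial profile -/

/-- A smooth transition from `0` on `t ≤ 1/2` to `1` on `t ≥ 1`. -/
def cutS (t : ℝ) : ℝ := Real.smoothTransition (2 * t - 1)

/-- A smooth profile equal to `1` on `t ≤ 1/2` and to `t ^ (-N/2)` on `t ≥ 1`. -/
def prof (N : ℕ) (t : ℝ) : ℝ := 1 + cutS t * (t ^ (-((N : ℝ) / 2)) - 1)

theorem cutS_nonneg (t : ℝ) : 0 ≤ cutS t := Real.smoothTransition.nonneg _
theorem cutS_le_one (t : ℝ) : cutS t ≤ 1 := Real.smoothTransition.le_one _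
theorem cutS_of_le {t : ℝ} (h : t ≤ 1 / 2) : cutS t = 0 :=
  Real.smoothTransition.zero_of_nonpos (by linarith)
theorem cutS_of_ge {t : ℝ} (h : 1 ≤ t) : cutS t = 1 :=
  Real.smoothTransition.one_of_one_le (by linarith)
theorem cutS_monotone : Monotone cutS := fun _ _ h =>
  Real.smoothTransition.monotone (by linarith)
theorem contDiff_cutS : ContDiff ℝ (⊤ : ℕ∞) cutS :=
  Real.smoothTransition.contDiff.comp ((contDiff_const.mul contDiff_id).sub contDiff_const)

theorem prof_of_le (N : ℕ) {t : ℝ} (h : t ≤ 1 / 2) : prof N t = 1 := by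
  simp [prof, cutS_of_le h]

theorem prof_of_ge (N : ℕ) {t : ℝ} (h : 1 ≤ t) : prof N t = t ^ (-((N : ℝ) / 2)) := by
  simp [prof, cutS_of_ge h]

theorem contDiff_prof (N : ℕ) : ContDiff ℝ (⊤ : ℕ∞) (prof N) := by
  rw [contDiff_iff_contDiffAt]
  intro t
  rcases lt_or_ge t (1 / 2) with h | h
  · refine (contDiffAt_const (c := (1 : ℝ))).congr_of_eventuallyEq ?_
    filter_upwards [Iio_mem_nhds h] with s hs using prof_of_le N (le_of_lt hs)
  · have ht : t ≠ 0 := by linarith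
    exact contDiffAt_const.add (contDiff_cutS.contDiffAt.mul
      ((Real.contDiffAt_rpow_const_of_ne ht).sub contDiffAt_const))

theorem deriv_prof_of_lt (N : ℕ) {t : ℝ} (h : t < 1 / 2) : deriv (prof N) t = 0 := by
  have : prof N =ᶠ[nhds t] fun _ => (1 : ℝ) := by
    filter_upwards [Iio_mem_nhds h] with s hs using prof_of_le N (le_of_lt hs)
  rw [this.deriv_eq]; simp

theorem hasDerivAt_prof (N : ℕ) {t : ℝ} (h : 0 < t) : HasDerivAt (prof N)
    (deriv cutS t * (t ^ (-((N : ℝ) / 2)) - 1) +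
      cutS t * (-((N : ℝ) / 2) * t ^ (-((N : ℝ) / 2) - 1))) t := by
  have h1 := (contDiff_cutS.differentiable (by simp) t).hasDerivAt
  have h2 := Real.hasDerivAt_rpow_const (p := -((N : ℝ) / 2)) (Or.inl h.ne')
  exact (h1.mul (h2.sub_const 1)).const_add 1

theorem deriv_cutS_nonneg (t : ℝ) : 0 ≤ deriv cutS t := cutS_monotone.deriv_nonneg

theorem deriv_cutS_of_gt {t : ℝ} (h : 1 < t) : deriv cutS t = 0 := by
  have : cutS =ᶠ[nhds t] fun _ => (1 : ℝ) := by
    filter_upwards [Ioi_mem_nhds h] with s hs using cutS_of_ge (le_of_lt hs)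
  rw [this.deriv_eq]; simp

theorem mul_rpow_neg_sub_one (N : ℕ) {t : ℝ} (h : 0 < t) :
    t * t ^ (-((N : ℝ) / 2) - 1) = t ^ (-((N : ℝ) / 2)) := by
  rw [Real.rpow_sub_one h.ne']
  field_simp

theorem one_le_rpow_neg (N : ℕ) {t : ℝ} (h : 0 < t) (h1 : t ≤ 1) :
    1 ≤ t ^ (-((N : ℝ) / 2)) :=
  Real.one_le_rpow_of_pos_of_le_one_of_nonpos h h1 (by simp; positivity)

theorem one_le_prof (N : ℕ) {t : ℝ} (h1 : t ≤ 1) : 1 ≤ prof N t := by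
  rcases le_or_gt t (1 / 2) with h | h
  · rw [prof_of_le N h]
  · have := one_le_rpow_neg N (t := t) (by linarith) h1
    have := mul_nonneg (cutS_nonneg t) (sub_nonneg.2 this)
    rw [prof]; linarith

theorem prof_pos (N : ℕ) (t : ℝ) : 0 < prof N t := by
  rcases le_or_gt t 1 with h | h
  · linarith [one_le_prof N h]
  · rw [prof_of_ge N h.le]; positivity

/-- The radial Laplacian of the profile. -/
def lapProf (N : ℕ) (t : ℝ) : ℝ := 2 * N * prof N t + 4 * t * deriv (prof N) t

theorem lapProf_of_lt (N : ℕ) {t : ℝ} (h : t < 1 / 2) : lapProf N t = 2 * N := by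
  rw [lapProf, deriv_prof_of_lt N h, prof_of_le N h.le]; ring

theorem lapProf_eq (N : ℕ) {t : ℝ} (h : 0 < t) : lapProf N t =
    2 * N * (1 - cutS t) + 4 * t * deriv cutS t * (t ^ (-((N : ℝ) / 2)) - 1) := by
  rw [lapProf, (hasDerivAt_prof N h).deriv, prof]
  linear_combination (-2 * N * cutS t) * mul_rpow_neg_sub_one N h

theorem lapProf_of_gt (N : ℕ) {t : ℝ} (h : 1 < t) : lapProf N t = 0 := by
  rw [lapProf_eq N (by linarith), cutS_of_ge h.le, deriv_cutS_of_gt h]; ring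

theorem lapProf_nonneg (N : ℕ) (t : ℝ) : 0 ≤ lapProf N t := by
  rcases lt_or_ge t (1 / 2) with h | h
  · rw [lapProf_of_lt N h]; positivity
  have ht : 0 < t := by linarith
  rcases le_or_gt t 1 with h1 | h1
  · rw [lapProf_eq N ht]
    have h2 := one_le_rpow_neg N ht h1
    have h3 := mul_nonneg (mul_nonneg ht.le (deriv_cutS_nonneg t)) (sub_nonneg.2 h2)
    have h4 := mul_nonneg (Nat.cast_nonneg (α := ℝ) N) (sub_nonneg.2 (cutS_le_one t))
    nlinarith
  · rw [lapProf_of_gt N h1]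

theorem exists_deriv_prof_bound (N : ℕ) :
    ∃ C, 0 < C ∧ ∀ t, 0 ≤ t → t * |deriv (prof N) t| ≤ C * prof N t := by
  have hc : Continuous (deriv (prof N)) := (contDiff_prof N).continuous_deriv (by simp)
  obtain ⟨C, hC⟩ := isCompact_Icc.exists_bound_of_continuousOn (s := Icc (0 : ℝ) 1)
    hc.continuousOn
  refine ⟨max C 0 + N / 2 + 1, by positivity, fun t ht => ?_⟩
  rcases le_or_gt t 1 with h | h
  · have h1 := hC t ⟨ht, h⟩
    rw [Real.norm_eq_abs] at h1
    have h2 := one_le_prof N h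
    have h3 : t * |deriv (prof N) t| ≤ max C 0 := by
      calc t * |deriv (prof N) t| ≤ 1 * |deriv (prof N) t| := by gcongr
        _ ≤ max C 0 := by rw [one_mul]; exact h1.trans (le_max_left _ _)
    have h4 : 0 ≤ max C 0 := le_max_right _ _
    have h5 : (0 : ℝ) ≤ N := Nat.cast_nonneg N
    nlinarith
  · have h0 : 0 < t := by linarith
    rw [(hasDerivAt_prof N h0).deriv, deriv_cutS_of_gt h, cutS_of_ge h.le, prof_of_ge N h.le]
    have h1 := mul_rpow_neg_sub_one N h0
    have hp : 0 < t ^ (-((N : ℝ) / 2) - 1) := by positivity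
    have hq : 0 < t ^ (-((N : ℝ) / 2)) := by positivity
    have h5 : (0 : ℝ) ≤ N := Nat.cast_nonneg N
    rw [zero_mul, zero_add, one_mul, abs_mul, abs_neg, abs_of_nonneg (by positivity : 
      (0 : ℝ) ≤ N / 2), abs_of_pos hp]
    calc t * (N / 2 * t ^ (-((N : ℝ) / 2) - 1)) = N / 2 * t ^ (-((N : ℝ) / 2)) := by
          rw [← h1]; ring
      _ ≤ _ := by
        have : 0 ≤ max C 0 := le_max_right _ _
        gcongr
        linarith

/-- The profile at scale `r`. -/
def profR (N : ℕ) (r t : ℝ) : ℝ := (r ^ N)⁻¹ * prof N (t / r ^ 2)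

theorem sq_rpow_neg (N : ℕ) {r : ℝ} (hr : 0 < r) : (r ^ 2) ^ (-((N : ℝ) / 2)) = (r ^ N)⁻¹ := by
  rw [Real.rpow_neg (by positivity), ← Real.rpow_natCast r 2, ← Real.rpow_mul hr.le,
    ← Real.rpow_natCast r N]
  congr 2
  push_cast; ring

theorem profR_eq (N : ℕ) {r t : ℝ} (hr : 0 < r) (ht : 0 < t) : profR N r t =
    t ^ (-((N : ℝ) / 2)) *
      (1 - (1 - cutS (t / r ^ 2)) * (1 - (t / r ^ 2) ^ ((N : ℝ) / 2))) := by
  have h1 : (t / r ^ 2) ^ (-((N : ℝ) / 2)) * (t / r ^ 2) ^ ((N : ℝ) / 2) = 1 := by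
    rw [← Real.rpow_add (by positivity)]; simp
  have h2 : (r ^ N)⁻¹ = t ^ (-((N : ℝ) / 2)) * (t / r ^ 2) ^ ((N : ℝ) / 2) := by
    rw [Real.div_rpow ht.le (by positivity), ← mul_div_assoc, ← Real.rpow_add ht, ← sq_rpow_neg N hr,
      Real.rpow_neg (by positivity)]
    simp
  rw [profR, h2, prof]
  linear_combination (t ^ (-((N : ℝ) / 2)) * cutS (t / r ^ 2)) * h1

theorem profR_of_ge (N : ℕ) {r t : ℝ} (hr : 0 < r) (ht : r ^ 2 ≤ t) :
    profR N r t = t ^ (-((N : ℝ) / 2)) := by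
  have h0 : 0 < t := lt_of_lt_of_le (by positivity) ht
  rw [profR_eq N hr h0, cutS_of_ge]
  · ring
  · rwa [le_div_iff₀ (by positivity), one_mul]

theorem profR_of_le (N : ℕ) {r t : ℝ} (hr : 0 < r) (ht : t ≤ r ^ 2 / 2) :
    profR N r t = (r ^ N)⁻¹ := by
  rw [profR, prof_of_le, mul_one]
  rw [div_le_iff₀ (by positivity)]; linarith

theorem profR_pos (N : ℕ) {r : ℝ} (hr : 0 < r) (t : ℝ) : 0 < profR N r t :=
  mul_pos (by positivity) (prof_pos N _)

theorem profR_ge (N : ℕ) {r t : ℝ} (hr : 0 < r) (ht : t ≤ r ^ 2) :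
    (r ^ N)⁻¹ ≤ profR N r t := by
  have := one_le_prof N (t := t / r ^ 2) (by rw [div_le_iff₀ (by positivity)]; linarith)
  rw [profR]
  exact le_mul_of_one_le_right (by positivity) this

theorem profR_antitone (N : ℕ) {r s t : ℝ} (hr : 0 < r) (hrs : r ≤ s) (ht : 0 ≤ t) :
    profR N s t ≤ profR N r t := by
  have hs : 0 < s := hr.trans_le hrs
  rcases ht.eq_or_lt with rfl | ht
  · rw [profR_of_le N hr (by positivity), profR_of_le N hs (by positivity)]
    gcongr
  rcases le_or_gt (r ^ 2) t with h | h
  · rw [profR_of_ge N hr h, profR_eq N hs ht]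
    refine mul_le_of_le_one_right (by positivity) ?_
    rcases le_or_gt (s ^ 2) t with h' | h'
    · rw [cutS_of_ge]
      · simp
      · rwa [le_div_iff₀ (by positivity), one_mul]
    · have h1 : (t / s ^ 2) ^ ((N : ℝ) / 2) ≤ 1 :=
        Real.rpow_le_one (by positivity) (by rw [div_le_iff₀ (by positivity)]; linarith)
          (by positivity)
      have h2 := cutS_le_one (t / s ^ 2)
      nlinarith [mul_nonneg (sub_nonneg.2 h1) (sub_nonneg.2 h2)]
  · rw [profR_eq N hr ht, profR_eq N hs ht]
    have h0 : t / s ^ 2 ≤ t / r ^ 2 := by gcongr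
    have h1 : (t / r ^ 2) ^ ((N : ℝ) / 2) ≤ 1 :=
        Real.rpow_le_one (by positivity) (by rw [div_le_iff₀ (by positivity)]; linarith)
          (by positivity)
    have h2 : (t / s ^ 2) ^ ((N : ℝ) / 2) ≤ (t / r ^ 2) ^ ((N : ℝ) / 2) := by gcongr
    have h3 := cutS_monotone h0
    have h4 := cutS_le_one (t / r ^ 2)
    gcongr
    linarith

theorem contDiff_profR (N : ℕ) (r : ℝ) : ContDiff ℝ (⊤ : ℕ∞) (profR N r) :=
  contDiff_const.mul ((contDiff_prof N).comp (contDiff_id.div_const _))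

theorem deriv_profR (N : ℕ) (r t : ℝ) :
    deriv (profR N r) t = (r ^ N)⁻¹ * (deriv (prof N) (t / r ^ 2) / r ^ 2) := by
  have h : HasDerivAt (prof N) (deriv (prof N) (t / r ^ 2)) (t / r ^ 2) :=
    ((contDiff_prof N).differentiable (by simp) _).hasDerivAt
  have h2 := (h.comp t ((hasDerivAt_id t).div_const (r ^ 2))).const_mul (r ^ N)⁻¹
  have := h2.deriv
  rw [mul_one_div] at this
  exact this

theorem deriv_profR_of_lt (N : ℕ) {r t : ℝ} (hr : 0 < r) (ht : t < r ^ 2 / 2) :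
    deriv (profR N r) t = 0 := by
  rw [deriv_profR, deriv_prof_of_lt]
  · simp
  · rw [div_lt_iff₀ (by positivity)]; linarith

theorem mul_deriv_profR_le {N : ℕ} {C : ℝ}
    (hC : ∀ t, 0 ≤ t → t * |deriv (prof N) t| ≤ C * prof N t) {r t : ℝ} (hr : 0 < r)
    (ht : 0 ≤ t) : t * |deriv (profR N r) t| ≤ C * profR N r t := by
  have := hC (t / r ^ 2) (by positivity)
  rw [deriv_profR, abs_mul, abs_div, abs_of_pos (by positivity : 0 < (r ^ N)⁻¹),
    abs_of_pos (by positivity : 0 < r ^ 2), profR]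
  calc t * ((r ^ N)⁻¹ * (|deriv (prof N) (t / r ^ 2)| / r ^ 2)) =
      (r ^ N)⁻¹ * (t / r ^ 2 * |deriv (prof N) (t / r ^ 2)|) := by ring
    _ ≤ (r ^ N)⁻¹ * (C * prof N (t / r ^ 2)) := by gcongr
    _ = _ := by ring

/-! ### Radial kernels -/

theorem ContDiff.two_of_top {E F : Type*} [NormedAddCommGroup E] [NormedSpace ℝ E]
    [NormedAddCommGroup F] [NormedSpace ℝ F] {f : E → F} (h : ContDiff ℝ (⊤ : ℕ∞) f) :
    ContDiff ℝ 2 f := h.of_le (WithTop.coe_le_coe.2 le_top)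

theorem contDiff_deriv_top {q : ℝ → ℝ} (hq : ContDiff ℝ (⊤ : ℕ∞) q) :
    ContDiff ℝ (⊤ : ℕ∞) (deriv q) := (contDiff_infty_iff_deriv.1 hq).2

theorem contDiff_radial {q : ℝ → ℝ} (hq : ContDiff ℝ (⊤ : ℕ∞) q) :
    ContDiff ℝ (⊤ : ℕ∞) (fun x : Eu N => q (‖x‖ ^ 2)) := hq.comp contDiff_normSq

theorem dd_radial {q : ℝ → ℝ} (hq : ContDiff ℝ (⊤ : ℕ∞) q) (a : Eu N) :
    dd (fun x : Eu N => q (‖x‖ ^ 2)) a = fun x => 2 * ⟪x, a⟫ * deriv q (‖x‖ ^ 2) := by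
  funext x
  have h1 := (hq.differentiable (by simp) (‖x‖ ^ 2)).hasDerivAt
  have h2 : HasFDerivAt (fun x : Eu N => ‖x‖ ^ 2) (fderiv ℝ (fun x : Eu N => ‖x‖ ^ 2) x) x :=
    (contDiff_normSq.differentiable (by simp) x).hasFDerivAt
  have h3 := h1.comp_hasFDerivAt x h2
  rw [dd, show (fun x : Eu N => q (‖x‖ ^ 2)) = q ∘ fun x : Eu N => ‖x‖ ^ 2 from rfl, h3.fderiv]
  have := congrFun (dd_normSq a) x
  simp only [dd] at this
  simp
  ring

theorem dd_mul {f g : Eu N → ℝ} (hf : Differentiable ℝ f) (hg : Differentiable ℝ g) (a : Eu N) :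
    dd (fun x => f x * g x) a = fun x => f x * dd g a x + g x * dd f a x := by
  funext x
  simp only [dd]
  rw [fderiv_fun_mul (hf x) (hg x)]
  simp

theorem differentiable_inner_left (a : Eu N) : Differentiable ℝ (fun x : Eu N => ⟪x, a⟫) :=
  ((innerSL ℝ).flip a).differentiable

theorem dd_dd_radial {q : ℝ → ℝ} (hq : ContDiff ℝ (⊤ : ℕ∞) q) (a b : Eu N) (x : Eu N) :
    dd (dd (fun x : Eu N => q (‖x‖ ^ 2)) a) b x =
      2 * ⟪a, b⟫ * deriv q (‖x‖ ^ 2) + 4 * ⟪x, a⟫ * ⟪x, b⟫ * deriv (deriv q) (‖x‖ ^ 2) := by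
  have hq' := contDiff_deriv_top hq
  rw [dd_radial hq, dd_mul ((differentiable_inner_left a).const_mul 2)
    ((contDiff_radial hq').differentiable (by simp)), dd_radial hq',
    dd_const_mul (differentiable_inner_left a), dd_inner, real_inner_comm]
  ring

theorem sum_inner_single_sq (x : Eu N) :
    ∑ i : Fin N, ⟪x, EuclideanSpace.single i (1 : ℝ)⟫ * ⟪x, EuclideanSpace.single i (1 : ℝ)⟫ =
      ‖x‖ ^ 2 := by
  rw [EuclideanSpace.norm_sq_eq]
  refine Finset.sum_congr rfl fun i _ => ?_
  rw [EuclideanSpace.inner_single_right]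
  simp [sq]

theorem lap_radial {q : ℝ → ℝ} (hq : ContDiff ℝ (⊤ : ℕ∞) q) (x : Eu N) :
    lap N (fun x : Eu N => q (‖x‖ ^ 2)) x =
      2 * N * deriv q (‖x‖ ^ 2) + 4 * ‖x‖ ^ 2 * deriv (deriv q) (‖x‖ ^ 2) := by
  rw [lap_eq]
  simp only [dd_dd_radial hq, real_inner_self_eq_norm_sq, PiLp.norm_single]
  rw [← sum_inner_single_sq x, Finset.sum_add_distrib, Finset.mul_sum, Finset.sum_mul]
  congr 1
  · simp
    ring
  · exact Finset.sum_congr rfl fun i _ => by ring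

/-- The averaging kernel at scale `r`. -/
def mker (N : ℕ) (r : ℝ) (x : Eu N) : ℝ := (r ^ N)⁻¹ * lapProf N (‖x‖ ^ 2 / r ^ 2)

/-- The total mass of the averaging kernels. -/
def mass (N : ℕ) : ℝ := ∫ x : Eu N, mker N 1 x

/-- The radial potential whose derivative is a difference of profiles. -/
def pot (N : ℕ) (r s t : ℝ) : ℝ := ∫ τ in (s ^ 2)..t, (profR N s τ - profR N r τ)

/-- The potential kernel, with Laplacian `mker N s - mker N r`. -/
def phi (N : ℕ) (r s : ℝ) (x : Eu N) : ℝ := pot N r s (‖x‖ ^ 2)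

theorem contDiff_lapProf (N : ℕ) : ContDiff ℝ (⊤ : ℕ∞) (lapProf N) :=
  (contDiff_const.mul (contDiff_prof N)).add
    ((contDiff_const.mul contDiff_id).mul (contDiff_deriv_top (contDiff_prof N)))

theorem mker_of_gt {r : ℝ} (hr : 0 < r) {x : Eu N} (hx : r < ‖x‖) : mker N r x = 0 := by
  rw [mker, lapProf_of_gt, mul_zero]
  rw [lt_div_iff₀ (by positivity)]
  nlinarith

theorem mker_of_lt {r : ℝ} (hr : 0 < r) {x : Eu N} (hx : ‖x‖ ^ 2 < r ^ 2 / 2) :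
    mker N r x = (r ^ N)⁻¹ * (2 * N) := by
  rw [mker, lapProf_of_lt]
  rw [div_lt_iff₀ (by positivity)]
  linarith

theorem mker_nonneg {r : ℝ} (hr : 0 < r) (x : Eu N) : 0 ≤ mker N r x :=
  mul_nonneg (by positivity) (lapProf_nonneg N _)

theorem hasCompactSupport_of_gt {g : Eu N → ℝ} {R : ℝ} (h : ∀ x, R < ‖x‖ → g x = 0) :
    HasCompactSupport g :=
  HasCompactSupport.intro (isCompact_closedBall 0 R) fun x hx => h x (by simpa using hx)

theorem tst_mker {r : ℝ} (hr : 0 < r) : Tst (mker N r) :=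
  ⟨contDiff_const.mul ((contDiff_lapProf N).comp (contDiff_normSq.div_const _)),
    hasCompactSupport_of_gt fun _ => mker_of_gt hr⟩

theorem mker_scale {r : ℝ} (hr : 0 < r) (x : Eu N) : mker N r x = (r ^ N)⁻¹ * mker N 1 (r⁻¹ • x) := by
  rw [mker, mker, norm_smul, mul_pow, norm_inv, Real.norm_of_nonneg hr.le]
  simp [div_eq_inv_mul]

theorem integral_mker {r : ℝ} (hr : 0 < r) : ∫ x : Eu N, mker N r x = mass N := by
  simp only [mker_scale hr]
  rw [integral_const_mul, Measure.integral_comp_inv_smul_of_nonneg _ _ hr.le]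
  simp only [finrank_euclideanSpace, Fintype.card_fin, smul_eq_mul]
  rw [mass]
  field_simp

theorem mass_pos (hN : 2 ≤ N) : 0 < mass N := by
  rw [mass]
  have hc : Continuous (mker N 1) := (tst_mker one_pos).continuous
  refine hc.integral_pos_of_hasCompactSupport_nonneg_nonzero (tst_mker one_pos).2
    (fun x => mker_nonneg one_pos x) (x := 0) ?_
  rw [mker_of_lt one_pos (by norm_num)]
  have : (0 : ℝ) < N := by exact_mod_cast (by omega : 0 < N)
  positivity

theorem hasDerivAt_pot (N : ℕ) (r s t : ℝ) :
    HasDerivAt (pot N r s) (profR N s t - profR N r t) t := by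
  have hc : Continuous (fun τ => profR N s τ - profR N r τ) :=
    ((contDiff_profR N s).sub (contDiff_profR N r)).continuous
  exact intervalIntegral.integral_hasDerivAt_right (hc.intervalIntegrable _ _)
    (hc.stronglyMeasurableAtFilter _ _) hc.continuousAt

theorem deriv_pot (N : ℕ) (r s : ℝ) :
    deriv (pot N r s) = fun t => profR N s t - profR N r t :=
  funext fun t => (hasDerivAt_pot N r s t).deriv

theorem deriv_deriv_pot (N : ℕ) (r s t : ℝ) :
    deriv (deriv (pot N r s)) t = deriv (profR N s) t - deriv (profR N r) t := by
  rw [deriv_pot]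
  exact deriv_fun_sub ((contDiff_profR N s).differentiable (by simp) t)
    ((contDiff_profR N r).differentiable (by simp) t)

theorem contDiff_pot (N : ℕ) (r s : ℝ) : ContDiff ℝ (⊤ : ℕ∞) (pot N r s) := by
  rw [contDiff_infty_iff_deriv]
  refine ⟨fun t => (hasDerivAt_pot N r s t).differentiableAt, ?_⟩
  rw [deriv_pot]
  exact (contDiff_profR N s).sub (contDiff_profR N r)

theorem pot_of_ge (N : ℕ) {r s t : ℝ} (hr : 0 < r) (hrs : r ≤ s) (ht : s ^ 2 ≤ t) :
    pot N r s t = 0 := by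
  rw [pot, intervalIntegral.integral_congr (g := fun _ => 0)]
  · simp
  · intro τ hτ
    rw [uIcc_of_le ht] at hτ
    have : r ^ 2 ≤ s ^ 2 := by gcongr
    simp only
    rw [profR_of_ge N (hr.trans_le hrs) hτ.1, profR_of_ge N hr (this.trans hτ.1), sub_self]

theorem pot_nonneg (N : ℕ) {r s t : ℝ} (hr : 0 < r) (hrs : r ≤ s) (h0 : 0 ≤ t) :
    0 ≤ pot N r s t := by
  rcases le_or_gt (s ^ 2) t with ht | ht
  · rw [pot_of_ge N hr hrs ht]
  · rw [pot, intervalIntegral.integral_symm, ← intervalIntegral.integral_neg]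
    refine intervalIntegral.integral_nonneg ht.le fun τ hτ => ?_
    have := profR_antitone N hr hrs (h0.trans hτ.1)
    linarith

theorem phi_of_ge {r s : ℝ} (hr : 0 < r) (hrs : r ≤ s) {x : Eu N} (hx : s ≤ ‖x‖) :
    phi N r s x = 0 := by
  have := hr.trans_le hrs
  exact pot_of_ge N hr hrs (by gcongr)

theorem phi_nonneg {r s : ℝ} (hr : 0 < r) (hrs : r ≤ s) (x : Eu N) : 0 ≤ phi N r s x :=
  pot_nonneg N hr hrs (by positivity)

theorem tst_phi {r s : ℝ} (hr : 0 < r) (hrs : r ≤ s) : Tst (phi N r s) :=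
  ⟨contDiff_radial (contDiff_pot N r s), hasCompactSupport_of_gt fun _ hx => phi_of_ge hr hrs hx.le⟩

theorem dd_dd_phi (r s : ℝ) (a b x : Eu N) : dd (dd (phi N r s) a) b x =
    2 * ⟪a, b⟫ * (profR N s (‖x‖ ^ 2) - profR N r (‖x‖ ^ 2)) +
      4 * ⟪x, a⟫ * ⟪x, b⟫ * (deriv (profR N s) (‖x‖ ^ 2) - deriv (profR N r) (‖x‖ ^ 2)) := by
  have := dd_dd_radial (contDiff_pot N r s) a b x
  rw [deriv_deriv_pot, deriv_pot] at this
  exact this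

theorem mker_eq {r : ℝ} (hr : 0 < r) (x : Eu N) : mker N r x =
    2 * N * profR N r (‖x‖ ^ 2) + 4 * ‖x‖ ^ 2 * deriv (profR N r) (‖x‖ ^ 2) := by
  rw [deriv_profR, profR, mker, lapProf]
  field_simp

theorem lap_phi {r s : ℝ} (hr : 0 < r) (hrs : r ≤ s) :
    lap N (phi N r s) = fun x => mker N s x - mker N r x := by
  funext x
  have := lap_radial (contDiff_pot N r s) x
  rw [deriv_deriv_pot, deriv_pot] at this
  rw [mker_eq hr, mker_eq (hr.trans_le hrs)]
  refine Eq.trans this ?_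
  ring

theorem profR_scale (N : ℕ) (ρ s τ : ℝ) :
    profR N (ρ * s) τ = (ρ ^ N)⁻¹ * profR N s (τ / ρ ^ 2) := by
  rw [profR, profR, mul_pow, mul_pow, mul_inv, div_div, mul_assoc]

theorem phi_scale {ρ : ℝ} (hρ : 0 < ρ) (x : Eu N) :
    phi N ρ (2 * ρ) x = ρ ^ 2 * (ρ ^ N)⁻¹ * phi N 1 2 (ρ⁻¹ • x) := by
  have h1 : ∀ τ, profR N (2 * ρ) τ - profR N ρ τ =
      (ρ ^ N)⁻¹ * (profR N 2 (τ / ρ ^ 2) - profR N 1 (τ / ρ ^ 2)) := fun τ => by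
    have h2 := profR_scale N ρ 1 τ
    rw [mul_one] at h2
    rw [mul_comm 2 ρ, profR_scale N ρ, h2]; ring
  rw [phi, phi, pot, pot, norm_smul, norm_inv, Real.norm_of_nonneg hρ.le]
  simp only [h1]
  rw [intervalIntegral.integral_const_mul,
    intervalIntegral.integral_comp_div (fun τ => profR N 2 τ - profR N 1 τ) (by positivity)]
  rw [smul_eq_mul, mul_pow, mul_pow, mul_div_assoc, div_self (by positivity), mul_one, inv_pow,
    div_eq_inv_mul]
  ring

/-! ### Scaled kernels and bounds for convolutions -/

/-- The function `g` rescaled in space by `ρ` and multiplied by `c`. -/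
def scal (ρ c : ℝ) (g : Eu N → ℝ) (x : Eu N) : ℝ := c * g (ρ⁻¹ • x)

theorem dd_scal {g : Eu N → ℝ} (hg : Tst g) {ρ : ℝ} (hρ : 0 < ρ) (c : ℝ) (a : Eu N) :
    dd (scal ρ c g) a = scal ρ (c * ρ⁻¹) (dd g a) := by
  have h := dd_const_mul (hg.comp_smul (inv_ne_zero hρ.ne')).differentiable c a
  rw [dd_comp_smul] at h
  refine h.trans ?_
  funext x
  simp only [scal]; ring

theorem dd_eq_zero_of_gt {g : Eu N → ℝ} {R : ℝ} (h : ∀ x, R < ‖x‖ → g x = 0) (a : Eu N) :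
    ∀ x, R < ‖x‖ → dd g a x = 0 := by
  intro x hx
  have : g =ᶠ[nhds x] fun _ => (0 : ℝ) := by
    filter_upwards [(isOpen_lt continuous_const continuous_norm).mem_nhds hx] with y hy using h y hy
  rw [dd, this.fderiv_eq]; simp

theorem dd_eq_sum (g : Eu N → ℝ) (a x : Eu N) :
    dd g a x = ∑ i, a i * dd g (EuclideanSpace.single i 1) x := by
  have h : a = ∑ i, a i • (EuclideanSpace.single i (1 : ℝ) : Eu N) := by
    have := (EuclideanSpace.basisFun (Fin N) ℝ).sum_repr a
    simpa using this.symm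
  conv_lhs => rw [h]
  simp [dd, map_sum]

theorem abs_dd_le_of_basis {g : Eu N → ℝ} {x : Eu N} {K : Fin N → ℝ}
    (h : ∀ i, |dd g (EuclideanSpace.single i 1) x| ≤ K i) (a : Eu N) :
    |dd g a x| ≤ (∑ i, K i) * ‖a‖ := by
  rw [dd_eq_sum, Finset.sum_mul]
  refine (Finset.abs_sum_le_sum_abs _ _).trans (Finset.sum_le_sum fun i _ => ?_)
  rw [abs_mul, mul_comm]
  have := PiLp.norm_apply_le a i
  exact mul_le_mul (h i) this (abs_nonneg _) ((abs_nonneg _).trans (h i))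

theorem Tst.linear_bound {g : Eu N → ℝ} (hg : Tst g) :
    ∃ C, 0 ≤ C ∧ ∀ a x, |_root_.dd g a x| ≤ C * ‖a‖ := by
  choose K hK h using fun i : Fin N => (hg.dd (EuclideanSpace.single i (1 : ℝ))).bound
  exact ⟨∑ i, K i, Finset.sum_nonneg fun i _ => hK i, fun a x => abs_dd_le_of_basis (h · x) a⟩

theorem Tst.bilinear_bound {g : Eu N → ℝ} (hg : Tst g) :
    ∃ C, 0 ≤ C ∧ ∀ a b x, |_root_.dd (_root_.dd g a) b x| ≤ C * ‖a‖ * ‖b‖ := by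
  choose K hK h using fun i : Fin N => (hg.dd (EuclideanSpace.single i (1 : ℝ))).linear_bound
  refine ⟨∑ i, K i, Finset.sum_nonneg fun i _ => hK i, fun a b x => ?_⟩
  have := abs_dd_le_of_basis (g := _root_.dd g b) (x := x) (K := fun i => K i * ‖b‖)
    (fun i => by rw [dd_dd_comm hg.1.two_of_top]; exact h i b x) a
  rw [dd_dd_comm hg.1.two_of_top]
  refine this.trans (le_of_eq ?_)
  rw [← Finset.sum_mul]; ring

theorem dd_dd_dd_rot {g : Eu N → ℝ} (hg : Tst g) (a b c x : Eu N) :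
    dd (dd (dd g a) b) c x = dd (dd (dd g b) c) a x := by
  rw [show dd (dd g a) b = dd (dd g b) a from funext fun y => dd_dd_comm hg.1.two_of_top a b y,
    dd_dd_comm (hg.dd b).1.two_of_top]

theorem Tst.trilinear_bound {g : Eu N → ℝ} (hg : Tst g) : ∃ C, 0 ≤ C ∧
    ∀ a b c x, |_root_.dd (_root_.dd (_root_.dd g a) b) c x| ≤ C * ‖a‖ * ‖b‖ * ‖c‖ := by
  choose K hK h using fun i : Fin N => (hg.dd (EuclideanSpace.single i (1 : ℝ))).bilinear_bound
  refine ⟨∑ i, K i, Finset.sum_nonneg fun i _ => hK i, fun a b c x => ?_⟩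
  have := abs_dd_le_of_basis (g := _root_.dd (_root_.dd g b) c) (x := x)
    (K := fun i => K i * ‖b‖ * ‖c‖) (fun i => by rw [← dd_dd_dd_rot hg]; exact h i b c x) a
  rw [dd_dd_dd_rot hg]
  refine this.trans (le_of_eq ?_)
  rw [← Finset.sum_mul, ← Finset.sum_mul]; ring

theorem Tst.multilinear_bound {g : Eu N → ℝ} (hg : Tst g) : ∃ C, 0 < C ∧ (∀ x, |g x| ≤ C) ∧
    (∀ a x, |_root_.dd g a x| ≤ C * ‖a‖) ∧
    (∀ a b x, |_root_.dd (_root_.dd g a) b x| ≤ C * ‖a‖ * ‖b‖) ∧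
    (∀ a b c x, |_root_.dd (_root_.dd (_root_.dd g a) b) c x| ≤ C * ‖a‖ * ‖b‖ * ‖c‖) := by
  obtain ⟨C0, p0, h0⟩ := hg.bound
  obtain ⟨C1, p1, h1⟩ := hg.linear_bound
  obtain ⟨C2, p2, h2⟩ := hg.bilinear_bound
  obtain ⟨C3, p3, h3⟩ := hg.trilinear_bound
  refine ⟨C0 + C1 + C2 + C3 + 1, by positivity, fun x => (h0 x).trans (by linarith),
    fun a x => (h1 a x).trans ?_, fun a b x => (h2 a b x).trans ?_,
    fun a b c x => (h3 a b c x).trans ?_⟩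
  all_goals gcongr; linarith

theorem volume_real_closedBall (x : Eu N) {R : ℝ} (hR : 0 ≤ R) :
    volume.real (closedBall x R) = R ^ N * volume.real (ball (0 : Eu N) 1) := by
  rw [measureReal_def, Measure.addHaar_closedBall _ _ hR, ENNReal.toReal_mul,
    ENNReal.toReal_ofReal (by positivity)]
  simp [measureReal_def]

theorem abs_cv_le {f g : Eu N → ℝ} {R B G : ℝ} (hR : 0 ≤ R) (x : Eu N)
    (hg : ∀ z, R < ‖z‖ → g z = 0) (hG : ∀ z, |g z| ≤ G)
    (hB : ∀ z, ‖z - x‖ ≤ R → |f z| ≤ B) :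
    |cv f g x| ≤ B * G * (R ^ N * volume.real (ball (0 : Eu N) 1)) := by
  have h1 : cv f g x = ∫ z in closedBall x R, f z * g (x - z) := by
    refine (setIntegral_eq_integral_of_forall_compl_eq_zero (μ := volume)
      (f := fun z => f z * g (x - z)) fun z hz => ?_).symm
    rw [hg, mul_zero]
    rw [mem_closedBall, not_le, dist_eq_norm, norm_sub_rev] at hz
    exact hz
  rw [h1, ← volume_real_closedBall x hR]
  refine norm_setIntegral_le_of_norm_le_const (μ := volume) (s := closedBall x R)
    (f := fun z => f z * g (x - z)) (C := B * G) measure_closedBall_lt_top fun z hz => ?_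
  rw [mem_closedBall, dist_eq_norm] at hz
  rw [norm_mul]
  have := hB z hz
  exact mul_le_mul this (hG _) (norm_nonneg _) ((abs_nonneg _).trans this)

theorem abs_cv_scal_le {f g : Eu N → ℝ} {R ρ B G c : ℝ} (hR : 0 ≤ R) (hρ : 0 < ρ) (x : Eu N)
    (hg : ∀ z, R < ‖z‖ → g z = 0) (hG : ∀ z, |g z| ≤ G)
    (hB : ∀ z, ‖z - x‖ ≤ ρ * R → |f z| ≤ B) :
    |cv f (scal ρ c g) x| ≤ |c| * ρ ^ N * B * (G * (R ^ N * volume.real (ball (0 : Eu N) 1))) := by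
  have := abs_cv_le (f := f) (g := scal ρ c g) (R := ρ * R) (B := B) (G := |c| * G)
    (by positivity) x (fun z hz => ?_) (fun z => ?_) hB
  · refine this.trans (le_of_eq ?_)
    rw [mul_pow]; ring
  · rw [scal, hg, mul_zero]
    rw [norm_smul, norm_inv, Real.norm_of_nonneg hρ.le, ← div_eq_inv_mul, lt_div_iff₀ hρ, mul_comm]
    exact hz
  · rw [scal, abs_mul]
    gcongr
    exact hG _

theorem Tst.cv_bounds {g : Eu N → ℝ} (hg : Tst g) {R : ℝ} (hR : 0 ≤ R)
    (hgR : ∀ z, R < ‖z‖ → g z = 0) :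
    ∃ C, 0 < C ∧ ∀ (f : Eu N → ℝ) (ρ c B : ℝ) (x : Eu N), 0 < ρ →
      (∀ z, ‖z - x‖ ≤ ρ * R → |f z| ≤ B) →
      |cv f (_root_.scal ρ c g) x| ≤ |c| * ρ ^ N * B * C ∧
      (∀ a, |cv f (_root_.dd (_root_.scal ρ c g) a) x| ≤ |c| * ρ ^ N * B * C * ρ⁻¹ * ‖a‖) ∧
      (∀ a b, |cv f (_root_.dd (_root_.dd (_root_.scal ρ c g) a) b) x| ≤
        |c| * ρ ^ N * B * C * (ρ ^ 2)⁻¹ * ‖a‖ * ‖b‖) ∧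
      (∀ a b d, |cv f (_root_.dd (_root_.dd (_root_.dd (_root_.scal ρ c g) a) b) d) x| ≤
        |c| * ρ ^ N * B * C * (ρ ^ 3)⁻¹ * ‖a‖ * ‖b‖ * ‖d‖) := by
  obtain ⟨C, hC, h0, h1, h2, h3⟩ := hg.multilinear_bound
  set V := R ^ N * volume.real (ball (0 : Eu N) 1) with hV
  have hV0 : 0 ≤ V := by positivity
  refine ⟨C * V + 1, by positivity, fun f ρ c B x hρ hB => ?_⟩
  have hle : C * V ≤ C * V + 1 := by linarith
  have hB0 : 0 ≤ B := (abs_nonneg _).trans (hB x (by simp; positivity))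
  have hp : 0 ≤ |c| * ρ ^ N * B := by positivity
  have h1R := dd_eq_zero_of_gt hgR
  have h2R := fun a => dd_eq_zero_of_gt (h1R a)
  have h3R := fun a b => dd_eq_zero_of_gt (h2R a b)
  have e1 := dd_scal hg hρ c
  have e2 := fun a => dd_scal (hg.dd a) hρ (c * ρ⁻¹)
  have e3 := fun a b => dd_scal ((hg.dd a).dd b) hρ (c * ρ⁻¹ * ρ⁻¹)
  have aρ : |ρ⁻¹| = ρ⁻¹ := abs_of_pos (by positivity)
  refine ⟨?_, fun a => ?_, fun a b => ?_, fun a b d => ?_⟩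
  · refine (abs_cv_scal_le hR hρ x hgR h0 hB).trans ?_
    rw [← hV]
    gcongr
  · rw [e1]
    refine (abs_cv_scal_le hR hρ x (h1R a) (h1 a) hB).trans ?_
    rw [abs_mul, aρ]
    calc _ = |c| * ρ ^ N * B * (C * V) * ρ⁻¹ * ‖a‖ := by rw [← hV]; ring
      _ ≤ _ := by gcongr
  · rw [e1, e2]
    refine (abs_cv_scal_le hR hρ x (h2R a b) (h2 a b) hB).trans ?_
    rw [abs_mul, abs_mul, aρ]
    calc _ = |c| * ρ ^ N * B * (C * V) * (ρ ^ 2)⁻¹ * ‖a‖ * ‖b‖ := by rw [← hV]; clear_value V; field_simp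
      _ ≤ _ := by gcongr
  · rw [e1, e2, e3]
    refine (abs_cv_scal_le hR hρ x (h3R a b d) (h3 a b d) hB).trans ?_
    rw [abs_mul, abs_mul, abs_mul, aρ]
    calc _ = |c| * ρ ^ N * B * (C * V) * (ρ ^ 3)⁻¹ * ‖a‖ * ‖b‖ * ‖d‖ := by rw [← hV]; clear_value V; field_simp
      _ ≤ _ := by gcongr

theorem mker_eq_scal {r : ℝ} (hr : 0 < r) : mker N r = scal r (r ^ N)⁻¹ (mker N 1) :=
  funext fun x => mker_scale hr x

theorem phi_eq_scal {r : ℝ} (hr : 0 < r) :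
    phi N r (2 * r) = scal r (r ^ 2 * (r ^ N)⁻¹) (phi N 1 2) :=
  funext fun x => phi_scale hr x

theorem exists_mker_bounds (N : ℕ) : ∃ C, 0 < C ∧ ∀ (f : Eu N → ℝ) (r B : ℝ) (x : Eu N), 0 < r →
      (∀ z, ‖z - x‖ ≤ r → |f z| ≤ B) →
      |cv f (mker N r) x| ≤ C * B ∧
      (∀ a, |cv f (dd (mker N r) a) x| ≤ C * B * r⁻¹ * ‖a‖) ∧
      (∀ a b, |cv f (dd (dd (mker N r) a) b) x| ≤ C * B * (r ^ 2)⁻¹ * ‖a‖ * ‖b‖) ∧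
      (∀ a b d, |cv f (dd (dd (dd (mker N r) a) b) d) x| ≤
        C * B * (r ^ 3)⁻¹ * ‖a‖ * ‖b‖ * ‖d‖) := by
  obtain ⟨C, hC, h⟩ := (tst_mker (N := N) one_pos).cv_bounds zero_le_one
    fun z => mker_of_gt one_pos
  refine ⟨C, hC, fun f r B x hr hB => ?_⟩
  have := h f r (r ^ N)⁻¹ B x hr (by simpa using hB)
  have e : |(r ^ N)⁻¹| * r ^ N * B * C = C * B := by
    rw [abs_of_pos (by positivity), inv_mul_cancel₀ (by positivity)]; ring
  rwa [e, ← mker_eq_scal hr] at this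

theorem exists_phi_bounds (N : ℕ) : ∃ C, 0 < C ∧ ∀ (f : Eu N → ℝ) (r : ℝ) (x : Eu N), 0 < r →
      (∀ z, |f z| ≤ 1) →
      |cv f (phi N r (2 * r)) x| ≤ C * r ^ 2 ∧
      (∀ a, |cv f (dd (phi N r (2 * r)) a) x| ≤ C * r * ‖a‖) ∧
      (∀ a b, |cv f (dd (dd (phi N r (2 * r)) a) b) x| ≤ C * ‖a‖ * ‖b‖) ∧
      (∀ a b d, |cv f (dd (dd (dd (phi N r (2 * r)) a) b) d) x| ≤
        C * r⁻¹ * ‖a‖ * ‖b‖ * ‖d‖) := by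
  obtain ⟨C, hC, h⟩ := (tst_phi (N := N) one_pos one_le_two).cv_bounds zero_le_two
    fun z hz => phi_of_ge one_pos one_le_two hz.le
  refine ⟨C, hC, fun f r x hr hB => ?_⟩
  have := h f r (r ^ 2 * (r ^ N)⁻¹) 1 x hr (fun z _ => hB z)
  have e : |r ^ 2 * (r ^ N)⁻¹| * r ^ N * 1 * C = C * r ^ 2 := by
    rw [abs_of_pos (by positivity)]; field_simp
  have e1 : C * r ^ 2 * r⁻¹ = C * r := by field_simp
  have e2 : C * r ^ 2 * (r ^ 2)⁻¹ = C := by field_simp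
  have e3 : C * r ^ 2 * (r ^ 3)⁻¹ = C * r⁻¹ := by field_simp
  rwa [e, e1, e2, e3, ← phi_eq_scal hr] at this

/-! ### Solutions of the obstacle-type equation: mollified derivatives -/

theorem abs_sub_le_of_dyadic_down {f : ℝ → ℝ} {L C : ℝ} {k : ℕ} (hk : 1 ≤ k) (hC : 0 ≤ C)
    (h : ∀ ρ, 0 < ρ → |f (2 * ρ) - f ρ| ≤ C * ρ ^ k)
    (hL : Tendsto f (nhdsWithin 0 (Ioi 0)) (nhds L)) {r : ℝ} (hr : 0 < r) :
    |f r - L| ≤ C * r ^ k := by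
  have key : ∀ n : ℕ, |f r - f (r / 2 ^ n)| ≤ C * (r ^ k - (r / 2 ^ n) ^ k) := by
    intro n
    induction n with
    | zero => simp
    | succ n ih =>
      have hρ : 0 < r / 2 ^ (n + 1) := by positivity
      have h1 := h _ hρ
      have e : 2 * (r / 2 ^ (n + 1)) = r / 2 ^ n := by field_simp; ring
      rw [← e] at ih
      have h2 := abs_sub_le (f r) (f (2 * (r / 2 ^ (n + 1)))) (f (r / 2 ^ (n + 1)))
      have h3 : (2 * (r / 2 ^ (n + 1))) ^ k ≥ 2 * (r / 2 ^ (n + 1)) ^ k := by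
        rw [mul_pow]
        gcongr
        exact le_self_pow₀ one_le_two (by omega)
      have h4 := mul_le_mul_of_nonneg_left h3 hC
      nlinarith
  have hlim : Tendsto (fun n : ℕ => r / 2 ^ n) atTop (nhdsWithin 0 (Ioi 0)) := by
    refine tendsto_nhdsWithin_iff.2 ⟨?_, Eventually.of_forall fun n => by
      show 0 < r / 2 ^ n
      positivity⟩
    have := (tendsto_pow_atTop_nhds_zero_of_lt_one (r := (1 / 2 : ℝ)) (by norm_num)
      (by norm_num)).const_mul r
    simp only [mul_zero] at this
    refine this.congr fun n => ?_
    rw [one_div, inv_pow]; rfl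
  have h5 : Tendsto (fun n : ℕ => |f r - f (r / 2 ^ n)|) atTop (nhds |f r - L|) :=
    ((hL.comp hlim).const_sub _).abs
  refine le_of_tendsto h5 (Eventually.of_forall fun n => (key n).trans ?_)
  have : 0 ≤ (r / 2 ^ n) ^ k := by positivity
  gcongr
  linarith

theorem abs_le_of_dyadic_up {f : ℝ → ℝ} {C : ℝ} (hC : 0 ≤ C)
    (h : ∀ ρ, 0 < ρ → |f (2 * ρ) - f ρ| ≤ C * ρ⁻¹)
    (hL : Tendsto f atTop (nhds 0)) {r : ℝ} (hr : 0 < r) :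
    |f r| ≤ 2 * C * r⁻¹ := by
  have key : ∀ n : ℕ, |f r - f (2 ^ n * r)| ≤ 2 * C * (r⁻¹ - (2 ^ n * r)⁻¹) := by
    intro n
    induction n with
    | zero => simp
    | succ n ih =>
      have h1 := h (2 ^ n * r) (by positivity)
      have e : 2 * (2 ^ n * r) = 2 ^ (n + 1) * r := by ring
      have e2 : (2 ^ (n + 1) * r)⁻¹ = (2 ^ n * r)⁻¹ / 2 := by field_simp; ring
      rw [e] at h1
      rw [abs_sub_comm] at h1
      have h2 := abs_sub_le (f r) (f (2 ^ n * r)) (f (2 ^ (n + 1) * r))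
      rw [e2]
      linarith
  have hlim : Tendsto (fun n : ℕ => 2 ^ n * r) atTop atTop :=
    (tendsto_pow_atTop_atTop_of_one_lt one_lt_two).atTop_mul_const hr
  have h5 : Tendsto (fun n : ℕ => |f r - f (2 ^ n * r)|) atTop (nhds |f r - 0|) :=
    ((hL.comp hlim).const_sub _).abs
  rw [sub_zero] at h5
  refine le_of_tendsto h5 (Eventually.of_forall fun n => (key n).trans ?_)
  have : 0 ≤ (2 ^ n * r)⁻¹ := by positivity
  gcongr
  linarith

/-- The indicator function of a set. -/
def chi (s : Set (Eu N)) : Eu N → ℝ := s.indicator fun _ => 1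

theorem chi_of_mem {s : Set (Eu N)} {x : Eu N} (h : x ∈ s) : chi s x = 1 := indicator_of_mem h _

theorem chi_of_notMem {s : Set (Eu N)} {x : Eu N} (h : x ∉ s) : chi s x = 0 :=
  indicator_of_notMem h _

theorem chi_nonneg (s : Set (Eu N)) (x : Eu N) : 0 ≤ chi s x :=
  indicator_nonneg (fun _ _ => zero_le_one) x

theorem chi_le_one (s : Set (Eu N)) (x : Eu N) : chi s x ≤ 1 :=
  indicator_le_self' (fun _ _ => zero_le_one) x

theorem abs_chi_le (s : Set (Eu N)) (x : Eu N) : |chi s x| ≤ 1 := by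
  rw [abs_of_nonneg (chi_nonneg s x)]; exact chi_le_one s x

theorem locallyIntegrable_chi {s : Set (Eu N)} (hs : MeasurableSet s) :
    LocallyIntegrable (chi s) :=
  (locallyIntegrable_const (1 : ℝ)).indicator hs

section Estimates

variable {M : ℝ} {Ω : Set (Eu N)} {u : Eu N → ℝ}

theorem MemPinf.meas (hu : MemPinf N M Ω u) : MeasurableSet Ω := hu.1.measurableSet

theorem MemPinf.li (hu : MemPinf N M Ω u) : LocallyIntegrable u :=
  hu.2.1.continuous.locallyIntegrable

theorem MemPinf.li_chi (hu : MemPinf N M Ω u) : LocallyIntegrable (chi Ω) :=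
  locallyIntegrable_chi hu.meas

theorem MemPinf.differentiable (hu : MemPinf N M Ω u) : Differentiable ℝ u :=
  hu.2.1.differentiable one_ne_zero

theorem MemPinf.eq_zero (hu : MemPinf N M Ω u) {x : Eu N} (hx : x ∈ Ωᶜ) : u x = 0 :=
  (hu.2.2.2.1 x hx).1

theorem MemPinf.dd_eq_zero (hu : MemPinf N M Ω u) {x : Eu N} (hx : x ∈ Ωᶜ) (a : Eu N) :
    dd u a x = 0 := by
  have h := (hu.2.2.2.1 x hx).2
  rw [gradient, LinearIsometryEquiv.map_eq_zero_iff] at h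
  rw [dd, h]; rfl

theorem MemPinf.cv_lap (hu : MemPinf N M Ω u) {g : Eu N → ℝ} (hg : Tst g) (x : Eu N) :
    cv u (lap N g) x = cv (chi Ω) g x := by
  have h := hu.2.2.1 (fun z => g (x - z)) (hg.comp_sub_left x).1 (hg.comp_sub_left x).2
  simp only [lap_comp_sub_left hg.1] at h
  rw [cv, h, cv, ← integral_indicator hu.meas]
  congr 1; funext z
  by_cases hz : z ∈ Ω
  · rw [indicator_of_mem hz, chi_of_mem hz, one_mul]
  · rw [indicator_of_notMem hz, chi_of_notMem hz, zero_mul]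

theorem MemPinf.cv_mker_sub (hu : MemPinf N M Ω u) {r s : ℝ} (hr : 0 < r) (hrs : r ≤ s)
    (x : Eu N) :
    cv u (mker N s) x - cv u (mker N r) x = cv (chi Ω) (phi N r s) x := by
  rw [← hu.cv_lap (tst_phi hr hrs), lap_phi hr hrs,
    cv_sub_right hu.li (tst_mker (hr.trans_le hrs)) (tst_mker hr)]

theorem MemPinf.cv_dd_sub (hu : MemPinf N M Ω u) {g h p : Eu N → ℝ} (hg : Tst g) (hh : Tst h)
    (hp : Tst p) (H : ∀ x, cv u g x - cv u h x = cv (chi Ω) p x) (a x : Eu N) :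
    cv u (dd g a) x - cv u (dd h a) x = cv (chi Ω) (dd p a) x := by
  have h1 : (fun x => cv u g x - cv u h x) = cv (chi Ω) p := funext H
  have h2 := dd_sub ((contDiff_cv hu.li hg).differentiable (by simp))
    ((contDiff_cv hu.li hh).differentiable (by simp)) a
  rw [h1, dd_cv hu.li_chi hp, dd_cv hu.li hg, dd_cv hu.li hh] at h2
  exact (congrFun h2 x).symm

theorem MemPinf.cv_dd_mker_sub (hu : MemPinf N M Ω u) {r s : ℝ} (hr : 0 < r) (hrs : r ≤ s)
    (a x : Eu N) :
    cv u (dd (mker N s) a) x - cv u (dd (mker N r) a) x = cv (chi Ω) (dd (phi N r s) a) x :=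
  hu.cv_dd_sub (tst_mker (hr.trans_le hrs)) (tst_mker hr) (tst_phi hr hrs)
    (hu.cv_mker_sub hr hrs) a x

/-- The averaged second derivative of `u` at scale `r`. -/
def HH (u : Eu N → ℝ) (r : ℝ) (x a b : Eu N) : ℝ := cv u (dd (dd (mker N r) a) b) x

theorem MemPinf.HH_sub (hu : MemPinf N M Ω u) {r s : ℝ} (hr : 0 < r) (hrs : r ≤ s)
    (a b x : Eu N) :
    HH u s x a b - HH u r x a b = cv (chi Ω) (dd (dd (phi N r s) a) b) x :=
  hu.cv_dd_sub ((tst_mker (hr.trans_le hrs)).dd a) ((tst_mker hr).dd a) ((tst_phi hr hrs).dd a)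
    (hu.cv_dd_mker_sub hr hrs a) b x

theorem MemPinf.cv_dd3_mker_sub (hu : MemPinf N M Ω u) {r s : ℝ} (hr : 0 < r) (hrs : r ≤ s)
    (a b c x : Eu N) :
    cv u (dd (dd (dd (mker N s) a) b) c) x - cv u (dd (dd (dd (mker N r) a) b) c) x =
      cv (chi Ω) (dd (dd (dd (phi N r s) a) b) c) x :=
  hu.cv_dd_sub (((tst_mker (hr.trans_le hrs)).dd a).dd b) (((tst_mker hr).dd a).dd b)
    (((tst_phi hr hrs).dd a).dd b) (hu.HH_sub hr hrs a b) c x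

theorem tendsto_cv_mker {f : Eu N → ℝ} (hf : Continuous f) (x : Eu N) :
    Tendsto (fun r => cv f (mker N r) x) (nhdsWithin 0 (Ioi 0)) (nhds (mass N * f x)) := by
  obtain ⟨C, hC, hb⟩ := exists_mker_bounds N
  rw [Metric.tendsto_nhdsWithin_nhds]
  intro ε hε
  obtain ⟨δ, hδ, h⟩ := Metric.continuous_iff.1 hf x (ε / (2 * C)) (by positivity)
  refine ⟨δ, hδ, fun r hr hrδ => ?_⟩
  have hr : 0 < r := hr
  rw [Real.dist_eq, sub_zero, abs_of_pos hr] at hrδ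
  have h1 := (hb (fun z => f z - f x) r (ε / (2 * C)) x hr fun z hz =>
    (h z (by rw [dist_eq_norm]; linarith)).le).1
  rw [cv_sub_left hf.locallyIntegrable (locallyIntegrable_const _) (tst_mker hr), cv_const_left,
    integral_mker hr] at h1
  rw [Real.dist_eq, mul_comm (mass N)]
  refine h1.trans_lt ?_
  field_simp
  linarith

theorem sq_le_of_norm_sub_le {x z : Eu N} {r : ℝ} (h : ‖z - x‖ ≤ r) :
    ‖z‖ ^ 2 ≤ (‖x‖ + r) ^ 2 := by
  have : ‖z‖ ≤ ‖x‖ + r := by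
    have := norm_add_le x (z - x)
    rw [add_sub_cancel] at this
    linarith
  gcongr

theorem MemPinf.growth (hu : MemPinf N M Ω u) (hM : 0 < M) {x z : Eu N} {r : ℝ}
    (h : ‖z - x‖ ≤ r) : |u z| ≤ M * ((‖x‖ + r) ^ 2 + 1) := by
  refine (hu.2.2.2.2.2 z).trans ?_
  have := sq_le_of_norm_sub_le h
  gcongr

theorem HH_bound (hM : 0 < M) (hu : MemPinf N M Ω u) (x : Eu N) {ρ : ℝ} (hρ : 0 < ρ) :
    ∃ B, 0 < B ∧ ∀ r, ρ ≤ r → ∀ a b, |HH u r x a b| ≤ B * ‖a‖ * ‖b‖ := by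
  obtain ⟨C, hC, hb⟩ := exists_mker_bounds N
  refine ⟨C * (M * ((‖x‖ / ρ + 1) ^ 2 + (ρ⁻¹) ^ 2)), by positivity, fun r hr a b => ?_⟩
  have hr0 := hρ.trans_le hr
  have h1 := (hb u r _ x hr0 fun z hz => hu.growth hM hz).2.2.1 a b
  refine h1.trans ?_
  have h2 : ‖x‖ + r ≤ (‖x‖ / ρ + 1) * r := by
    have : ‖x‖ ≤ ‖x‖ / ρ * r := by
      rw [div_mul_eq_mul_div, le_div_iff₀ hρ]
      gcongr
    linarith
  have h3 : 1 ≤ ρ⁻¹ * r := by rwa [← div_eq_inv_mul, one_le_div hρ]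
  have h4 : (‖x‖ + r) ^ 2 + 1 ≤ ((‖x‖ / ρ + 1) ^ 2 + (ρ⁻¹) ^ 2) * r ^ 2 := by
    have h5 : (‖x‖ + r) ^ 2 ≤ ((‖x‖ / ρ + 1) * r) ^ 2 := by gcongr
    nlinarith
  have h6 : ((‖x‖ + r) ^ 2 + 1) * (r ^ 2)⁻¹ ≤ (‖x‖ / ρ + 1) ^ 2 + (ρ⁻¹) ^ 2 := by
    rw [← div_eq_mul_inv, div_le_iff₀ (by positivity)]
    exact h4
  calc C * (M * ((‖x‖ + r) ^ 2 + 1)) * (r ^ 2)⁻¹ * ‖a‖ * ‖b‖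
      = C * (M * (((‖x‖ + r) ^ 2 + 1) * (r ^ 2)⁻¹)) * ‖a‖ * ‖b‖ := by ring
    _ ≤ _ := by gcongr

theorem tendsto_cv_dd3 (hM : 0 < M) (hu : MemPinf N M Ω u) (x a b c : Eu N) :
    Tendsto (fun r => cv u (dd (dd (dd (mker N r) a) b) c) x) atTop (nhds 0) := by
  obtain ⟨C, hC, hb⟩ := exists_mker_bounds N
  have key : ∀ᶠ r : ℝ in atTop, ‖cv u (dd (dd (dd (mker N r) a) b) c) x‖ ≤
      C * (M * ((‖x‖ + 1) ^ 2 + 1)) * ‖a‖ * ‖b‖ * ‖c‖ * r⁻¹ := by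
    filter_upwards [eventually_ge_atTop 1] with r hr
    have hr0 : 0 < r := by linarith
    refine ((hb u r _ x hr0 fun z hz => hu.growth hM hz).2.2.2 a b c).trans ?_
    have h2 : ‖x‖ + r ≤ (‖x‖ + 1) * r := by nlinarith [norm_nonneg x]
    have h4 : (‖x‖ + r) ^ 2 + 1 ≤ ((‖x‖ + 1) ^ 2 + 1) * r ^ 2 := by
      have h5 : (‖x‖ + r) ^ 2 ≤ ((‖x‖ + 1) * r) ^ 2 := by gcongr
      nlinarith
    have h6 : ((‖x‖ + r) ^ 2 + 1) * (r ^ 3)⁻¹ ≤ ((‖x‖ + 1) ^ 2 + 1) * r⁻¹ := by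
      rw [← div_eq_mul_inv, div_le_iff₀ (by positivity)]
      refine h4.trans (le_of_eq ?_)
      field_simp
    calc _ = C * (M * (((‖x‖ + r) ^ 2 + 1) * (r ^ 3)⁻¹)) * ‖a‖ * ‖b‖ * ‖c‖ := by ring
      _ ≤ C * (M * (((‖x‖ + 1) ^ 2 + 1) * r⁻¹)) * ‖a‖ * ‖b‖ * ‖c‖ := by gcongr
      _ = _ := by ring
  refine squeeze_zero_norm' key ?_
  have := tendsto_inv_atTop_zero (𝕜 := ℝ).const_mul
    (C * (M * ((‖x‖ + 1) ^ 2 + 1)) * ‖a‖ * ‖b‖ * ‖c‖)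
  simpa using this

theorem exists_estimates (N : ℕ) : ∃ C, 0 < C ∧ ∀ (M : ℝ) (Ω : Set (Eu N)) (u : Eu N → ℝ), 0 < M →
    MemPinf N M Ω u →
    (∀ r x, 0 < r → |cv u (mker N r) x - mass N * u x| ≤ C * r ^ 2) ∧
    (∀ r x a, 0 < r → |cv u (dd (mker N r) a) x - mass N * dd u a x| ≤ C * r * ‖a‖) ∧
    (∀ r x a b, 0 < r → |HH u (2 * r) x a b - HH u r x a b| ≤ C * ‖a‖ * ‖b‖) ∧
    (∀ r x y a b, 0 < r → |HH u r x a b - HH u r y a b| ≤ C * (‖x - y‖ / r) * ‖a‖ * ‖b‖) := by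
  obtain ⟨C, hC, hb⟩ := exists_phi_bounds N
  refine ⟨2 * C, by positivity, fun M Ω u hM hu => ⟨fun r x hr => ?_, fun r x a hr => ?_,
    fun r x a b hr => ?_, fun r x y a b hr => ?_⟩⟩
  · refine (abs_sub_le_of_dyadic_down (f := fun r => cv u (mker N r) x) (C := C) (k := 2)
      (by norm_num) hC.le (fun ρ hρ => ?_) (tendsto_cv_mker hu.2.1.continuous x) hr).trans ?_
    · rw [hu.cv_mker_sub hρ (by linarith)]
      exact (hb _ ρ x hρ (abs_chi_le Ω)).1
    · nlinarith [sq_nonneg r]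
  · have hl : Tendsto (fun r => cv u (dd (mker N r) a) x) (nhdsWithin 0 (Ioi 0))
        (nhds (mass N * dd u a x)) := by
      have hc : Continuous (dd u a) :=
        (hu.2.1.continuous_fderiv one_ne_zero).clm_apply continuous_const
      refine (tendsto_cv_mker hc x).congr' ?_
      filter_upwards [self_mem_nhdsWithin] with r hr
      exact (cv_by_parts hu.2.1 (tst_mker hr) a x).symm
    refine (abs_sub_le_of_dyadic_down (f := fun r => cv u (dd (mker N r) a) x) (C := C * ‖a‖)
      (k := 1) le_rfl (by positivity) (fun ρ hρ => ?_) hl hr).trans ?_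
    · rw [hu.cv_dd_mker_sub hρ (by linarith)]
      refine ((hb _ ρ x hρ (abs_chi_le Ω)).2.1 a).trans (le_of_eq (by ring))
    · rw [pow_one]
      have : 0 ≤ C * ‖a‖ * r := by positivity
      linarith
  · rw [hu.HH_sub hr (by linarith)]
    refine ((hb _ r x hr (abs_chi_le Ω)).2.2.1 a b).trans ?_
    gcongr; linarith
  · have h3 : ∀ z d, |cv u (dd (dd (dd (mker N r) a) b) d) z| ≤
        2 * (C * ‖a‖ * ‖b‖ * ‖d‖) * r⁻¹ := fun z d => by
      refine abs_le_of_dyadic_up (f := fun r => cv u (dd (dd (dd (mker N r) a) b) d) z)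
        (by positivity) (fun ρ hρ => ?_) (tendsto_cv_dd3 hM hu z a b d) hr
      rw [hu.cv_dd3_mker_sub hρ (by linarith)]
      exact ((hb _ ρ z hρ (abs_chi_le Ω)).2.2.2 a b d).trans (le_of_eq (by ring))
    have ht := ((tst_mker (N := N) hr).dd a).dd b
    obtain ⟨s, -, hs⟩ := exists_dd_eq ((contDiff_cv hu.li ht).differentiable (by simp)) y (x - y)
    rw [dd_cv hu.li ht, add_sub_cancel] at hs
    rw [HH, HH, hs]
    refine (h3 _ _).trans (le_of_eq ?_)
    ring

theorem HH_eq_dd (hu : MemPinf N M Ω u) {r : ℝ} (hr : 0 < r) (a b : Eu N) :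
    dd (dd (cv u (mker N r)) a) b = fun x => HH u r x a b := by
  rw [dd_cv hu.li (tst_mker hr), dd_cv hu.li ((tst_mker hr).dd a)]
  rfl

theorem contDiff_U (hu : MemPinf N M Ω u) {r : ℝ} (hr : 0 < r) :
    ContDiff ℝ 2 (cv u (mker N r)) := (contDiff_cv hu.li (tst_mker hr)).two_of_top

theorem HH_eq_fderiv (hu : MemPinf N M Ω u) {r : ℝ} (hr : 0 < r) (x a b : Eu N) :
    HH u r x a b = fderiv ℝ (fderiv ℝ (cv u (mker N r))) x b a := by
  rw [← dd_dd_apply (contDiff_U hu hr), HH_eq_dd hu hr]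

/-- The averaged Hessian plus a multiple of the inner product, as a bilinear form. -/
def HB (u : Eu N → ℝ) (r c : ℝ) (x : Eu N) : LinearMap.BilinForm ℝ (Eu N) :=
  LinearMap.mk₂ ℝ (fun b a => fderiv ℝ (fderiv ℝ (cv u (mker N r))) x b a + c * ⟪b, a⟫)
    (fun a b e => by simp [inner_add_left]; ring) (fun t a b => by simp [inner_smul_left]; ring)
    (fun a b e => by simp [inner_add_right]; ring) (fun t a b => by simp [inner_smul_right]; ring)

theorem HH_comm (hu : MemPinf N M Ω u) {r : ℝ} (hr : 0 < r) (x a b : Eu N) :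
    HH u r x a b = HH u r x b a := by
  have h := dd_dd_comm (contDiff_U hu hr) a b x
  rwa [HH_eq_dd hu hr, HH_eq_dd hu hr] at h

theorem HB_apply (hu : MemPinf N M Ω u) {r : ℝ} (hr : 0 < r) (c : ℝ) (x a b : Eu N) :
    HB u r c x a b = HH u r x a b + c * ⟪a, b⟫ := by
  rw [HH_comm hu hr, HH_eq_fderiv hu hr]; rfl

theorem HB_symm (hu : MemPinf N M Ω u) {r : ℝ} (hr : 0 < r) (c : ℝ) (x : Eu N) :
    LinearMap.IsSymm (HB u r c x) :=
  ⟨fun a b => by simp only [HB_apply hu hr, HH_comm hu hr x a b, real_inner_comm a b]; rfl⟩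

theorem HH_smul (hu : MemPinf N M Ω u) {r : ℝ} (hr : 0 < r) (t : ℝ) (x a : Eu N) :
    HH u r x (t • a) (t • a) = t ^ 2 * HH u r x a a := by
  simp only [HH_eq_fderiv hu hr, map_smul, smul_apply, smul_eq_mul]; ring

theorem MemPinf.sum_HH (hu : MemPinf N M Ω u) {r : ℝ} (hr : 0 < r) (x : Eu N) :
    ∑ i, HH u r x (EuclideanSpace.single i 1) (EuclideanSpace.single i 1) =
      cv (chi Ω) (mker N r) x := by
  rw [← hu.cv_lap (tst_mker hr)]
  have := cv_sum_right Finset.univ hu.li (fun i : Fin N => dd (dd (mker N r)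
    (EuclideanSpace.single i 1)) (EuclideanSpace.single i 1))
    (fun i _ => ((tst_mker hr).dd _).dd _) x
  exact this.symm

theorem MemPinf.cv_chi_le (hu : MemPinf N M Ω u) {r : ℝ} (hr : 0 < r) (x : Eu N) :
    cv (chi Ω) (mker N r) x ≤ mass N := by
  have h := cv_mono_left hu.li_chi (locallyIntegrable_const (1 : ℝ)) (tst_mker hr) x
    (fun z => mul_le_mul_of_nonneg_right (chi_le_one Ω z) (mker_nonneg hr _))
  rwa [cv_const_left, integral_mker hr, one_mul] at h

theorem BilinForm.apply_le_trace {B : LinearMap.BilinForm ℝ (Eu N)} (hB : ∀ v, 0 ≤ B v v)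
    (hs : LinearMap.IsSymm B) (v : Eu N) :
    B v v ≤ (∑ i, B (EuclideanSpace.single i 1) (EuclideanSpace.single i 1)) * ‖v‖ ^ 2 := by
  set T := ∑ i, B (EuclideanSpace.single i 1) (EuclideanSpace.single i 1) with hT
  have hv : v = ∑ i, v i • (EuclideanSpace.single i (1 : ℝ) : Eu N) := by
    have := (EuclideanSpace.basisFun (Fin N) ℝ).sum_repr v
    simpa using this.symm
  have h1 : B v v = ∑ i, v i * B (EuclideanSpace.single i 1) v := by
    exact (congrArg (fun w => B w v) hv).trans (by simp [map_sum, LinearMap.sum_apply])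
  have h2 : (B v v) ^ 2 ≤ ‖v‖ ^ 2 * (T * B v v) := by
    calc (B v v) ^ 2 ≤ (∑ i : Fin N, v i ^ 2) * (∑ i, (B (EuclideanSpace.single i 1) v) ^ 2) := by
          rw [h1]; exact Finset.sum_mul_sq_le_sq_mul_sq _ _ _
      _ ≤ (∑ i : Fin N, v i ^ 2) * (∑ i, (B (EuclideanSpace.single i 1) (EuclideanSpace.single i 1) *
            B v v)) := by
          gcongr with i
          exact B.apply_sq_le_of_symm hB hs _ _
      _ = ‖v‖ ^ 2 * (T * B v v) := by
          rw [EuclideanSpace.real_norm_sq_eq, hT, ← Finset.sum_mul]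
  have hT0 : 0 ≤ T := Finset.sum_nonneg fun i _ => hB _
  rcases (hB v).eq_or_lt with h | h
  · rw [← h]; positivity
  · nlinarith

theorem MemPinf.HH_le (hu : MemPinf N M Ω u) {r : ℝ} (hr : 0 < r) {K : ℝ} {x : Eu N}
    (h : ∀ e, -K * ‖e‖ ^ 2 ≤ HH u r x e e) (e : Eu N) :
    HH u r x e e + K * ‖e‖ ^ 2 ≤ (mass N + N * K) * ‖e‖ ^ 2 := by
  have hB : ∀ v, 0 ≤ HB u r K x v v := fun v => by
    rw [HB_apply hu hr, real_inner_self_eq_norm_sq]; linarith [h v]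
  have := BilinForm.apply_le_trace hB (HB_symm hu hr K x) e
  simp only [HB_apply hu hr, real_inner_self_eq_norm_sq, Finset.sum_add_distrib, hu.sum_HH hr,
    PiLp.norm_single] at this
  refine this.trans ?_
  gcongr
  · exact hu.cv_chi_le hr x
  · simp

theorem MemPinf.HH_cauchy (hu : MemPinf N M Ω u) {r : ℝ} (hr : 0 < r) {K : ℝ} {x : Eu N}
    (h : ∀ e, -K * ‖e‖ ^ 2 ≤ HH u r x e e) (e v : Eu N) :
    (HH u r x e v + K * ⟪e, v⟫) ^ 2 ≤ (HH u r x e e + K * ‖e‖ ^ 2) *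
      ((mass N + N * K) * ‖v‖ ^ 2) := by
  have hB : ∀ v, 0 ≤ HB u r K x v v := fun v => by
    rw [HB_apply hu hr, real_inner_self_eq_norm_sq]; linarith [h v]
  have := (HB u r K x).apply_sq_le_of_symm hB (HB_symm hu hr K x) e v
  simp only [HB_apply hu hr, real_inner_self_eq_norm_sq] at this
  refine this.trans ?_
  gcongr
  · linarith [h e]
  · exact hu.HH_le hr h v

end Estimates

/-! ### Monotonicity of the averaged second derivatives -/

theorem half_sq_rpow (N : ℕ) {r : ℝ} (hr : 0 < r) :
    (r ^ 2 / 2) ^ (-((N : ℝ) / 2)) = 2 ^ ((N : ℝ) / 2) * (r ^ N)⁻¹ := by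
  rw [Real.div_rpow (by positivity) (by norm_num), sq_rpow_neg N hr, Real.rpow_neg (by norm_num)]
  field_simp

theorem two_le_rpow {N : ℕ} (hN : 2 ≤ N) : (2 : ℝ) ≤ 2 ^ ((N : ℝ) / 2) := by
  have h : (1 : ℝ) ≤ (N : ℝ) / 2 := by
    rw [le_div_iff₀ (by norm_num)]
    exact_mod_cast (by omega : 1 * 2 ≤ N)
  calc (2 : ℝ) = 2 ^ (1 : ℝ) := (Real.rpow_one 2).symm
    _ ≤ _ := Real.rpow_le_rpow_of_exponent_le one_le_two h

theorem two_mul_profR_le {N : ℕ} (hN : 2 ≤ N) {r s t : ℝ} (hr : 0 < r) (hrs : 2 * r ≤ s)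
    (ht : t < s ^ 2 / 2) : 2 * profR N s t ≤ profR N r t := by
  have hs : 0 < s := by linarith
  rw [profR_of_le N hs ht.le]
  rcases le_total (r ^ 2) t with h | h
  · rw [profR_of_ge N hr h]
    have ht0 : 0 < t := lt_of_lt_of_le (by positivity) h
    calc 2 * (s ^ N)⁻¹ ≤ 2 ^ ((N : ℝ) / 2) * (s ^ N)⁻¹ := by
          gcongr; exact two_le_rpow hN
      _ = (s ^ 2 / 2) ^ (-((N : ℝ) / 2)) := (half_sq_rpow N hs).symm
      _ ≤ _ := by
          apply Real.rpow_le_rpow_of_nonpos ht0 ht.le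
          simp only [Left.neg_nonpos_iff]; positivity
  · refine le_trans ?_ (profR_ge N hr h)
    have h1 : 2 * r ^ N ≤ s ^ N := by
      calc 2 * r ^ N ≤ 2 ^ N * r ^ N := by
            gcongr; exact le_self_pow₀ one_le_two (by omega)
        _ = (2 * r) ^ N := (mul_pow _ _ _).symm
        _ ≤ _ := by gcongr
    rw [← div_eq_mul_inv, ← one_div, div_le_div_iff₀ (by positivity) (by positivity)]
    linarith

/-- A constant for the derivative of the profile. -/
def profC (N : ℕ) : ℝ := (exists_deriv_prof_bound N).choose

theorem profC_pos (N : ℕ) : 0 < profC N := (exists_deriv_prof_bound N).choose_spec.1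

theorem profC_spec (N : ℕ) {r t : ℝ} (hr : 0 < r) (ht : 0 ≤ t) :
    t * |deriv (profR N r) t| ≤ profC N * profR N r t :=
  mul_deriv_profR_le (exists_deriv_prof_bound N).choose_spec.2 hr ht

theorem drift_pointwise {N : ℕ} (hN : 2 ≤ N) {r s t q θ θ' : ℝ} (hr : 0 < r) (hrs : 2 * r ≤ s)
    (ht : 0 ≤ t) (hθ : 4 * profC N * θ ^ 2 ≤ 1)
    (hq0 : 0 ≤ q) (h1 : r ^ 2 / 2 ≤ t → q ≤ θ ^ 2 * t) (h2 : s ^ 2 / 2 ≤ t → q ≤ θ' ^ 2 * t) :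
    -(8 * profC N * 2 ^ ((N : ℝ) / 2) * (s ^ N)⁻¹ * θ' ^ 2) ≤
      2 * (profR N r t - profR N s t) + 4 * q * (deriv (profR N r) t - deriv (profR N s) t) := by
  have hC := profC_pos N
  have hs : 0 < s := by linarith
  have hK : 0 ≤ 8 * profC N * 2 ^ ((N : ℝ) / 2) * (s ^ N)⁻¹ * θ' ^ 2 := by positivity
  have hp := profR_antitone N hr (by linarith : r ≤ s) ht
  have hp0 := profR_pos N hr t
  have hp1 := profR_pos N hs t
  have d0 := profC_spec N hr ht
  have d1 := profC_spec N hs ht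
  rcases lt_or_ge t (s ^ 2 / 2) with h | h
  · rw [deriv_profR_of_lt N hs h]
    rcases lt_or_ge t (r ^ 2 / 2) with h' | h'
    · rw [deriv_profR_of_lt N hr h']; linarith
    · have := two_mul_profR_le hN hr hrs h
      have h3 : q * |deriv (profR N r) t| ≤ θ ^ 2 * (profC N * profR N r t) := by
        calc q * |deriv (profR N r) t| ≤ θ ^ 2 * t * |deriv (profR N r) t| := by
              gcongr; exact h1 h'
          _ = θ ^ 2 * (t * |deriv (profR N r) t|) := by ring
          _ ≤ _ := by gcongr
      have h4 := mul_le_mul_of_nonneg_left (neg_abs_le (deriv (profR N r) t)) hq0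
      nlinarith
  · have h3 : q * |deriv (profR N r) t| ≤ θ' ^ 2 * (profC N * profR N r t) := by
      calc q * |deriv (profR N r) t| ≤ θ' ^ 2 * t * |deriv (profR N r) t| := by
            gcongr; exact h2 h
        _ = θ' ^ 2 * (t * |deriv (profR N r) t|) := by ring
        _ ≤ _ := by gcongr
    have h3' : q * |deriv (profR N s) t| ≤ θ' ^ 2 * (profC N * profR N r t) := by
      calc q * |deriv (profR N s) t| ≤ θ' ^ 2 * t * |deriv (profR N s) t| := by
            gcongr; exact h2 h
        _ = θ' ^ 2 * (t * |deriv (profR N s) t|) := by ring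
        _ ≤ θ' ^ 2 * (profC N * profR N s t) := by gcongr
        _ ≤ _ := by gcongr
    have h4 := mul_le_mul_of_nonneg_left (neg_abs_le (deriv (profR N r) t)) hq0
    have h4' := mul_le_mul_of_nonneg_left (le_abs_self (deriv (profR N s) t)) hq0
    have h5 : profR N r t ≤ 2 ^ ((N : ℝ) / 2) * (s ^ N)⁻¹ := by
      rw [profR_of_ge N hr (by nlinarith), ← half_sq_rpow N hs]
      apply Real.rpow_le_rpow_of_nonpos (by positivity) h
      simp only [Left.neg_nonpos_iff]; positivity
    have h6 : θ' ^ 2 * (profC N * profR N r t) ≤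
        θ' ^ 2 * (profC N * (2 ^ ((N : ℝ) / 2) * (s ^ N)⁻¹)) := by gcongr
    nlinarith

section Estimates

variable {M : ℝ} {Ω : Set (Eu N)} {u : Eu N → ℝ}

theorem locallyIntegrable_one : LocallyIntegrable (fun _ : Eu N => (1 : ℝ)) :=
  locallyIntegrable_const _

theorem cv_one_dd {g : Eu N → ℝ} (hg : Tst g) (a x : Eu N) : cv (fun _ => 1) (dd g a) x = 0 := by
  rw [← dd_cv locallyIntegrable_one hg, dd,
    show cv (fun _ => 1) g = fun _ => ∫ z, g z from funext fun x => by rw [cv_const_left, one_mul]]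
  simp

/-- The constant in the almost monotonicity of averaged second derivatives. -/
def driftC (N : ℕ) : ℝ :=
  8 * profC N * 2 ^ ((N : ℝ) / 2) * volume.real (ball (0 : Eu N) 1) + 1

theorem driftC_pos (N : ℕ) : 0 < driftC N := by
  have := profC_pos N
  unfold driftC
  positivity

theorem HH_drift (hN : 2 ≤ N) (hu : MemPinf N M Ω u) {r s θ θ' : ℝ} (hr : 0 < r)
    (hrs : 2 * r ≤ s) (hθ : 4 * profC N * θ ^ 2 ≤ 1) {y e : Eu N} (he : ‖e‖ = 1)
    (h1 : ∀ w, y + w ∈ Ωᶜ → r ^ 2 / 2 ≤ ‖w‖ ^ 2 → ‖w‖ ≤ s → |⟪w, e⟫| ≤ θ * ‖w‖)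
    (h2 : ∀ w, y + w ∈ Ωᶜ → s ^ 2 / 2 ≤ ‖w‖ ^ 2 → ‖w‖ ≤ s → |⟪w, e⟫| ≤ θ' * ‖w‖) :
    HH u r y e e ≤ HH u s y e e + driftC N * θ' ^ 2 := by
  have hs : 0 < s := by linarith
  set K := 8 * profC N * 2 ^ ((N : ℝ) / 2) * (s ^ N)⁻¹ * θ' ^ 2 with hK
  have hK0 : 0 ≤ K := by have := profC_pos N; positivity
  have ht := ((tst_phi (N := N) hr (by linarith : r ≤ s)).dd e).dd e
  have hsub := hu.HH_sub hr (by linarith : r ≤ s) e e y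
  have hb : LocallyIntegrable (fun z : Eu N => chi Ω z - 1) :=
    hu.li_chi.sub locallyIntegrable_one
  have h3 : cv (chi Ω) (dd (dd (phi N r s) e) e) y =
      cv (fun z => chi Ω z - 1) (dd (dd (phi N r s) e) e) y := by
    rw [cv_sub_left hu.li_chi locallyIntegrable_one ht,
      cv_one_dd ((tst_phi hr (by linarith : r ≤ s)).dd e), sub_zero]
  have h4 : -(K * volume.real (closedBall y s)) ≤
      cv (fun z => chi Ω z - 1) (dd (dd (phi N r s) e) e) y := by
    have hi : Integrable ((closedBall y s).indicator fun _ => -K) :=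
      (integrableOn_const (μ := volume) (measure_closedBall_lt_top).ne).integrable_indicator
        measurableSet_closedBall
    have h5 : ∫ z, (closedBall y s).indicator (fun _ => -K) z =
        -(K * volume.real (closedBall y s)) := by
      rw [integral_indicator measurableSet_closedBall, setIntegral_const, smul_eq_mul]
      ring
    rw [← h5]
    refine integral_mono hi (cv_integrable hb ht y) fun z => ?_
    simp only
    by_cases hz : z ∈ closedBall y s
    · rw [indicator_of_mem hz]
      by_cases hzΩ : z ∈ Ω
      · rw [chi_of_mem hzΩ]; simpa using hK0
      · rw [chi_of_notMem hzΩ, dd_dd_phi, norm_sub_rev]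
        have hzD : y + (z - y) ∈ Ωᶜ := by simpa using hzΩ
        have hzn : ‖z - y‖ ≤ s := by simpa [dist_eq_norm] using hz
        have hq : ⟪y - z, e⟫ ^ 2 = |⟪z - y, e⟫| ^ 2 := by
          rw [sq_abs, ← neg_sub z y, inner_neg_left, neg_sq]
        have key := drift_pointwise hN (t := ‖z - y‖ ^ 2) (q := ⟪y - z, e⟫ ^ 2) (θ' := θ') hr hrs
          (by positivity) hθ (by positivity)
          (fun h => by rw [hq, ← mul_pow]; gcongr; exact h1 _ hzD h hzn)
          (fun h => by rw [hq, ← mul_pow]; gcongr; exact h2 _ hzD h hzn)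
        rw [← hK] at key
        rw [real_inner_self_eq_norm_sq, he]
        linarith
    · rw [indicator_of_notMem hz]
      have h0 : ∀ x : Eu N, s < ‖x‖ → phi N r s x = 0 := fun x hx =>
        phi_of_ge hr (by linarith) hx.le
      rw [dd_eq_zero_of_gt (dd_eq_zero_of_gt h0 e) e, mul_zero]
      rw [mem_closedBall, not_le, dist_eq_norm, norm_sub_rev] at hz
      exact hz
  rw [volume_real_closedBall _ hs.le] at h4
  rw [h3] at hsub
  have h6 : K * (s ^ N * volume.real (ball (0 : Eu N) 1)) =
      8 * profC N * 2 ^ ((N : ℝ) / 2) * volume.real (ball (0 : Eu N) 1) * θ' ^ 2 := by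
    rw [hK]; field_simp
  rw [driftC]
  nlinarith [sq_nonneg θ']

end Estimates

/-! ### Points of the coincidence set without holes nearby -/

/-- The set `s` meets all balls `ball (y + (r / 2) • e) (r / 4)` for small `r`. -/
def NoHole (s : Set (Eu N)) (y : Eu N) : Prop :=
  ∃ ρ, 0 < ρ ∧ ∀ r, 0 < r → r < ρ → ∀ e : Eu N, ‖e‖ = 1 →
    (ball (y + (r / 2) • e) (r / 4) ∩ s).Nonempty

/-- The points of `s` without holes nearby. -/
def core (s : Set (Eu N)) : Set (Eu N) := {y ∈ s | NoHole s y}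

theorem interior_subset_core (s : Set (Eu N)) : interior s ⊆ core s := by
  intro y hy
  refine ⟨interior_subset hy, ?_⟩
  obtain ⟨ρ, hρ, h⟩ := Metric.isOpen_iff.1 isOpen_interior y hy
  refine ⟨ρ, hρ, fun r hr hrρ e he => ⟨y + (r / 2) • e, mem_ball_self (by positivity), ?_⟩⟩
  refine interior_subset (h ?_)
  rw [mem_ball, dist_eq_norm, add_sub_cancel_left, norm_smul, he, Real.norm_of_nonneg (by positivity)]
  linarith

theorem ball_hole_subset {y e : Eu N} (he : ‖e‖ = 1) {r : ℝ} (hr : 0 < r) :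
    ball (y + (r / 2) • e) (r / 4) ⊆ closedBall y r := by
  intro z hz
  rw [mem_ball] at hz
  rw [mem_closedBall]
  have h := dist_triangle z (y + (r / 2) • e) y
  rw [dist_eq_norm (y + _) y, add_sub_cancel_left, norm_smul, he,
    Real.norm_of_nonneg (by positivity)] at h
  linarith

theorem measure_diff_core {s : Set (Eu N)} (hs : MeasurableSet s) : volume (s \ core s) = 0 := by
  have h := Besicovitch.ae_tendsto_measure_inter_div (volume : Measure (Eu N)) s
  rw [ae_restrict_iff' hs] at h
  refine measure_mono_null ?_ (ae_iff.1 h)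
  rintro y ⟨hys, hy⟩
  rw [Set.mem_ofPred_eq, Classical.not_imp]
  refine ⟨hys, fun hlim => hy ⟨hys, ?_⟩⟩
  set δ : ENNReal := ENNReal.ofReal ((1 / 4) ^ N) with hδ
  have hδ0 : δ ≠ 0 := by simp [hδ]
  have hlt : 1 - δ < 1 := ENNReal.sub_lt_self (by simp) (by simp) hδ0
  have hev := hlim.eventually (lt_mem_nhds hlt)
  rw [eventually_nhdsWithin_iff, Metric.eventually_nhds_iff] at hev
  obtain ⟨ρ, hρ, hev⟩ := hev
  refine ⟨ρ, hρ, fun r hr hrρ e he => ?_⟩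
  by_contra hemp
  rw [not_nonempty_iff_eq_empty] at hemp
  have h1 := hev (y := r) (by rw [Real.dist_eq, sub_zero, abs_of_pos hr]; exact hrρ) hr
  have hV0 : volume (closedBall y r) ≠ 0 := (measure_closedBall_pos _ _ hr).ne'
  have hVt : volume (closedBall y r) ≠ ⊤ := measure_closedBall_lt_top.ne
  have h2 : s ∩ closedBall y r ⊆ closedBall y r \ ball (y + (r / 2) • e) (r / 4) := by
    rintro z ⟨hz, hz'⟩
    exact ⟨hz', fun hz2 => by
      have : z ∈ ball (y + (r / 2) • e) (r / 4) ∩ s := ⟨hz2, hz⟩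
      rw [hemp] at this
      exact this⟩
  have h3 : volume (ball (y + (r / 2) • e) (r / 4)) = δ * volume (closedBall y r) := by
    rw [Measure.addHaar_closedBall _ _ hr.le, Measure.addHaar_ball_of_pos _ _ (by positivity), ← mul_assoc,
      hδ, ← ENNReal.ofReal_mul (by positivity)]
    congr 2
    simp only [finrank_euclideanSpace, Fintype.card_fin]
    rw [← mul_pow]; ring
  have h4 : volume (s ∩ closedBall y r) ≤ (1 - δ) * volume (closedBall y r) := by
    refine (measure_mono h2).trans ?_
    rw [measure_sdiff (ball_hole_subset he hr) measurableSet_ball.nullMeasurableSet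
      measure_ball_lt_top.ne, h3, ENNReal.sub_mul (fun _ _ => hVt), one_mul]
  have h5 : volume (s ∩ closedBall y r) / volume (closedBall y r) ≤ 1 - δ :=
    ENNReal.div_le_of_le_mul h4
  exact absurd h1 (not_lt.2 h5)

theorem exists_dyadic_shell {R t : ℝ} (ht : t ≤ 2 * R) (n : ℕ) (h : R / 2 ^ n ≤ t) :
    ∃ i ≤ n, R / 2 ^ i ≤ t ∧ t ≤ 2 * R / 2 ^ i := by
  induction n with
  | zero => exact ⟨0, le_rfl, h, by simpa using ht⟩
  | succ n ih =>
    rcases le_or_gt (R / 2 ^ n) t with h1 | h1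
    · obtain ⟨i, hi, h2⟩ := ih h1
      exact ⟨i, by omega, h2⟩
    · refine ⟨n + 1, le_rfl, h, h1.le.trans (le_of_eq ?_)⟩
      rw [pow_succ]; field_simp

section Estimates

variable {M : ℝ} {Ω : Set (Eu N)} {u : Eu N → ℝ}

theorem not_flat_at_core (hN : 2 ≤ N) (hu : MemPinf N M Ω u) {y e : Eu N} (hy : NoHole Ωᶜ y)
    (he : ‖e‖ = 1) {R h θ θ' : ℝ} (hR : 0 < R) (hθ : 4 * profC N * θ ^ 2 ≤ 1) (hθ4 : θ ≤ 1 / 4)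
    (hcone : ∀ r, 0 < r → HH u r y e e ≤ h → ∀ w, y + w ∈ Ωᶜ → r / 8 ≤ ‖w‖ → ‖w‖ ≤ r / 4 →
      |⟪w, e⟫| ≤ θ * ‖w‖)
    (hk : ∀ k ∈ ({1, 2, 3} : Finset ℕ), HH u (2 ^ k * R) y e e ≤ h)
    (hR' : HH u R y e e ≤ h - driftC N * θ' ^ 2)
    (hshell : ∀ w, y + w ∈ Ωᶜ → R ^ 2 / 2 ≤ ‖w‖ ^ 2 → ‖w‖ ≤ R → |⟪w, e⟫| ≤ θ' * ‖w‖) : False := by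
  have hC := driftC_pos N
  have hcas : ∀ n : ℕ, HH u (8 * R / 2 ^ n) y e e ≤ h := by
    intro n
    induction n using Nat.strong_induction_on with
    | _ n ih =>
      rcases lt_or_ge n 4 with hn | hn
      · interval_cases n
        · have := hk 3 (by simp); norm_num at this ⊢; exact this
        · have := hk 2 (by simp)
          rwa [show (8 : ℝ) * R / 2 ^ 1 = 2 ^ 2 * R by ring]
        · have := hk 1 (by simp)
          rwa [show (8 : ℝ) * R / 2 ^ 2 = 2 ^ 1 * R by ring]
        · rw [show (8 : ℝ) * R / 2 ^ 3 = R by ring]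
          have : 0 ≤ driftC N * θ' ^ 2 := by positivity
          linarith
      · have hr : 0 < 8 * R / 2 ^ n := by positivity
        have hrs : 2 * (8 * R / 2 ^ n) ≤ R := by
          rw [mul_div_assoc', div_le_iff₀ (by positivity)]
          have : (2 : ℝ) ^ 4 ≤ 2 ^ n := pow_le_pow_right₀ one_le_two hn
          nlinarith
        refine (HH_drift hN hu hr hrs hθ he (θ' := θ') (fun w hw h1 h2 => ?_) hshell).trans
          (by linarith)
        have h3 : R / 2 ^ (n - 1) ≤ ‖w‖ := by
          obtain ⟨m, rfl⟩ : ∃ m, n = m + 1 := ⟨n - 1, by omega⟩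
          rw [Nat.add_sub_cancel]
          have e1 : 8 * R / 2 ^ (m + 1) = 4 * (R / 2 ^ m) := by rw [pow_succ]; field_simp; ring
          rw [e1] at h1
          have : 0 < R / 2 ^ m := by positivity
          nlinarith [norm_nonneg w]
        obtain ⟨i, hi, h4, h5⟩ := exists_dyadic_shell (by linarith) _ h3
        refine hcone _ (by positivity) (ih i (by omega)) w hw ?_ ?_
        · rw [show 8 * R / 2 ^ i / 8 = R / 2 ^ i by ring]; exact h4
        · rw [show 8 * R / 2 ^ i / 4 = 2 * R / 2 ^ i by ring]; exact h5
  obtain ⟨ρ, hρ, hhole⟩ := hy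
  set r := min ρ R / 2 with hr
  have hm : 0 < min ρ R := lt_min hρ hR
  have hr0 : 0 < r := by positivity
  have hm1 := min_le_left ρ R
  have hm2 := min_le_right ρ R
  obtain ⟨p, hp, hpD⟩ := hhole r hr0 (by linarith) e he
  rw [mem_ball, dist_eq_norm] at hp
  set v := p - (y + (r / 2) • e) with hv
  have hw : p - y = (r / 2) • e + v := by rw [hv]; abel
  have hn2 : ‖(r / 2) • e‖ = r / 2 := by
    rw [norm_smul, he, Real.norm_of_nonneg (by positivity), mul_one]
  have hup : ‖p - y‖ ≤ r / 2 + ‖v‖ := by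
    rw [hw]; exact (norm_add_le _ _).trans (by rw [hn2])
  have hin : r / 4 < ⟪p - y, e⟫ := by
    rw [hw, inner_add_left, inner_smul_left, real_inner_self_eq_norm_sq, he]
    have := neg_le_of_abs_le (abs_real_inner_le_norm v e)
    rw [he] at this
    simp
    linarith
  have hlow : 0 < ‖p - y‖ := by
    rw [norm_pos_iff]
    rintro h0
    rw [h0, inner_zero_left] at hin
    linarith
  obtain ⟨n, hn⟩ := exists_pow_lt_of_lt_one (div_pos hlow hR) (by norm_num : (1 / 2 : ℝ) < 1)
  have hn' : R / 2 ^ n ≤ ‖p - y‖ := by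
    rw [lt_div_iff₀ hR, one_div, inv_pow] at hn
    rw [div_eq_inv_mul]; exact hn.le
  obtain ⟨i, -, h4, h5⟩ := exists_dyadic_shell (R := R) (by linarith) _ hn'
  have := hcone _ (by positivity) (hcas i) (p - y) (by simpa using hpD)
    (by rw [show 8 * R / 2 ^ i / 8 = R / 2 ^ i by ring]; exact h4)
    (by rw [show 8 * R / 2 ^ i / 4 = 2 * R / 2 ^ i by ring]; exact h5)
  have h6 : θ * ‖p - y‖ ≤ 1 / 4 * ‖p - y‖ := by gcongr
  linarith [le_abs_self ⟪p - y, e⟫]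

end Estimates

/-! ### Lower bounds for the averaged second derivatives -/

theorem exists_near_sup {ι : Type*} {f : ι → ℝ} (hf : BddAbove (Set.range f)) {i₀ : ι} {a δ : ℝ}
    (ha : 0 < a) (hi : a < f i₀) (hδ : 0 < δ) :
    ∃ K i, a < K ∧ (∀ j, f j ≤ K) ∧ K * (1 - δ) ≤ f i := by
  have hK : a < ⨆ j, f j := hi.trans_le (le_ciSup hf i₀)
  have : Nonempty ι := ⟨i₀⟩
  obtain ⟨i, hi'⟩ := exists_lt_of_lt_ciSup (f := f) (b := (⨆ j, f j) * (1 - δ))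
    (by have : 0 < (⨆ j, f j) * δ := mul_pos (ha.trans hK) hδ
        linarith)
  exact ⟨_, i, hK, le_ciSup hf, hi'.le⟩

theorem hom_ge_of_unit {f : Eu N → ℝ} (h2 : ∀ (t : ℝ) a, f (t • a) = t ^ 2 * f a) {K : ℝ}
    (h : ∀ e, ‖e‖ = 1 → K ≤ f e) (e : Eu N) : K * ‖e‖ ^ 2 ≤ f e := by
  rcases eq_or_ne e 0 with rfl | he
  · have := h2 0 0
    simp at this
    simp [this]
  · have hn : ‖e‖ ≠ 0 := norm_ne_zero_iff.2 he
    have h1 := h (‖e‖⁻¹ • e) (by rw [norm_smul, norm_inv, norm_norm, inv_mul_cancel₀ hn])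
    have h3 : f e = ‖e‖ ^ 2 * f (‖e‖⁻¹ • e) := by
      rw [← h2, smul_smul, mul_inv_cancel₀ hn, one_smul]
    rw [h3, mul_comm]
    gcongr

theorem ContDiff.differentiable_dd {F : Eu N → ℝ} (hF : ContDiff ℝ 2 F) (a : Eu N) :
    Differentiable ℝ (dd F a) :=
  ((hF.fderiv_right (m := 1) (by norm_num)).clm_apply contDiff_const).differentiable (by simp)

theorem secDiff_le {F : Eu N → ℝ} (hF : ContDiff ℝ 2 F) {h x : Eu N} {m : ℝ}
    (hm : ∀ s ∈ Icc (-1 : ℝ) 1, dd (dd F h) h (x + s • h) ≤ m) : secDiff F h x ≤ m := by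
  have hd : Differentiable ℝ F := hF.differentiable (by norm_num)
  have hd1 : Differentiable ℝ (dd F h) := hF.differentiable_dd h
  have hF' : ContDiff ℝ 2 fun z => -1 * F z := contDiff_const.mul hF
  have := secDiff_ge hF' (h := h) (x := x) (m := -m) fun s hs => by
    rw [dd_const_mul hd, dd_const_mul hd1]
    simpa using hm s hs
  simp only [secDiff] at this ⊢
  linarith

theorem exists_cone_of_extremal {N : ℕ} (hN : 2 ≤ N) : ∃ C, 0 < C ∧ ∀ (M : ℝ) (Ω : Set (Eu N)) (u : Eu N → ℝ),
    0 < M → MemPinf N M Ω u → ∀ (y : Eu N) (r K δ : ℝ) (e : Eu N), y ∈ Ωᶜ → 0 < r → 1 ≤ K →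
    ‖e‖ = 1 → (∀ a, -K * ‖a‖ ^ 2 ≤ HH u r y a a) → HH u r y e e ≤ -(K * (1 - δ)) →
    ∀ w, y + w ∈ Ωᶜ → r / 16 ≤ ‖w‖ → ‖w‖ ≤ r →
      K * |⟪w, e⟫| ≤ (C + K * √(δ * (mass N + N))) * ‖w‖ := by
  obtain ⟨C, hC, hest⟩ := exists_estimates N
  refine ⟨33 * C, by positivity, fun M Ω u hM hu y r K δ e hy hr hK he hpsd hext w hw h1 h2 => ?_⟩
  obtain ⟨-, hE1, -, hE2⟩ := hest M Ω u hM hu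
  have hd : Differentiable ℝ (dd (cv u (mker N r)) e) := (contDiff_U hu hr).differentiable_dd e
  obtain ⟨s, hs, hmv⟩ := exists_dd_eq hd y w
  rw [HH_eq_dd hu hr, dd_cv hu.li (tst_mker hr)] at hmv
  beta_reduce at hmv
  have e1 := hE1 r y e hr
  have e2 := hE1 r (y + w) e hr
  rw [hu.dd_eq_zero hy, he] at e1
  rw [hu.dd_eq_zero hw, he] at e2
  have e3 := hE2 r (y + s • w) y e w hr
  rw [add_sub_cancel_left, norm_smul, he, Real.norm_of_nonneg hs.1.le] at e3
  have hw0 := norm_nonneg w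
  have e4 : C * (s * ‖w‖ / r) * 1 * ‖w‖ ≤ C * ‖w‖ := by
    have : s * ‖w‖ / r ≤ 1 := by
      rw [div_le_one hr]; nlinarith [hs.1, hs.2]
    rw [mul_one]
    have := mul_le_mul_of_nonneg_left this hC.le
    nlinarith
  have e5 : |HH u r y e w| ≤ 33 * C * ‖w‖ := by
    have e6 : |HH u r (y + s • w) e w| ≤ 2 * C * r := by
      rw [← hmv]
      rw [mul_zero, sub_zero] at e1 e2
      refine (abs_sub _ _).trans ?_
      linarith
    have e7 : 2 * C * r ≤ 32 * C * ‖w‖ := by nlinarith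
    have := abs_sub_abs_le_abs_sub (HH u r y e w) (HH u r (y + s • w) e w)
    rw [abs_sub_comm (HH u r y e w)] at this
    linarith
  have hc := hu.HH_cauchy hr hpsd e w
  rw [he] at hc
  have hm : 0 ≤ mass N := (mass_pos hN).le
  have hgap : HH u r y e e + K * 1 ^ 2 ≤ K * δ := by linarith
  have hg0 := hpsd e
  rw [he] at hg0
  have hδ : 0 ≤ K * δ := by linarith
  have hδ' : 0 ≤ δ := nonneg_of_mul_nonneg_right hδ (by linarith)
  have e8 : (HH u r y e w + K * ⟪e, w⟫) ^ 2 ≤ (K * √(δ * (mass N + N)) * ‖w‖) ^ 2 := by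
    refine hc.trans ?_
    rw [mul_pow, mul_pow, Real.sq_sqrt (by positivity)]
    have : mass N + N * K ≤ K * (mass N + N) := by nlinarith
    calc _ ≤ K * δ * (K * (mass N + N) * ‖w‖ ^ 2) := by gcongr
      _ = _ := by ring
  have e9 := abs_le_of_sq_le_sq e8 (by positivity)
  have e10 : K * |⟪w, e⟫| = |K * ⟪e, w⟫| := by
    rw [abs_mul, abs_of_nonneg (by linarith : 0 ≤ K), real_inner_comm]
  rw [e10]
  have := abs_sub_abs_le_abs_sub (K * ⟪e, w⟫) (-HH u r y e w)
  rw [abs_neg, sub_neg_eq_add, add_comm (K * ⟪e, w⟫)] at this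
  linarith

theorem exists_aperture (N : ℕ) : ∃ θ : ℝ, 0 < θ ∧ 4 * profC N * θ ^ 2 ≤ 1 ∧ θ ≤ 1 / 4 := by
  have hP := profC_pos N
  refine ⟨min (1 / 4) (1 / (4 * profC N)), by positivity, ?_, min_le_left _ _⟩
  set θ := min (1 / 4) (1 / (4 * profC N)) with hθ
  have h0 : 0 < θ := by positivity
  have h1 : θ ≤ 1 / 4 := min_le_left _ _
  have h2 : θ * (4 * profC N) ≤ 1 := by
    rw [← le_div_iff₀ (by positivity)]; exact min_le_right _ _
  nlinarith

theorem exists_lower_core {N : ℕ} (hN : 2 ≤ N) : ∃ K, 0 < K ∧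
    ∀ (M : ℝ) (Ω : Set (Eu N)) (u : Eu N → ℝ), 0 < M → MemPinf N M Ω u →
    ∀ y ∈ core Ωᶜ, ∀ (r : ℝ) (e : Eu N), 0 < r → ‖e‖ = 1 → -K ≤ HH u r y e e := by
  obtain ⟨C₀, hC₀, hest⟩ := exists_estimates N
  obtain ⟨C, hC, hcone⟩ := exists_cone_of_extremal hN
  obtain ⟨θ, hθ0, hθ1, hθ4⟩ := exists_aperture N
  have hm : 0 < mass N := mass_pos hN
  obtain ⟨δ, hδ, hδθ⟩ : ∃ δ : ℝ, 0 < δ ∧ √(δ * (mass N + N)) ≤ θ / 2 := by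
    refine ⟨(θ / 2) ^ 2 / (mass N + N), by positivity, ?_⟩
    rw [div_mul_cancel₀ _ (by positivity), Real.sqrt_sq (by positivity)]
  have hdr := driftC_pos N
  set K₁ := 1 + 2 * C / θ + 4 * C₀ / δ + 2 * driftC N * θ ^ 2 / δ with hK₁
  have hK1 : 1 ≤ K₁ := by
    have : 0 ≤ 2 * C / θ + 4 * C₀ / δ + 2 * driftC N * θ ^ 2 / δ := by positivity
    linarith
  have hK2 : 2 * C / θ ≤ K₁ := by
    have : 0 ≤ 4 * C₀ / δ + 2 * driftC N * θ ^ 2 / δ := by positivity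
    linarith
  have hK3 : 4 * C₀ / δ ≤ K₁ := by
    have : 0 ≤ 2 * C / θ + 2 * driftC N * θ ^ 2 / δ := by positivity
    linarith
  have hK4 : 2 * driftC N * θ ^ 2 / δ ≤ K₁ := by
    have : 0 ≤ 2 * C / θ + 4 * C₀ / δ := by positivity
    linarith
  rw [div_le_iff₀ (by positivity)] at hK2 hK3 hK4
  clear_value K₁
  refine ⟨K₁, by linarith, fun M Ω u hM hu y hy => ?_⟩
  obtain ⟨-, -, hL3, -⟩ := hest M Ω u hM hu
  have hcone' : ∀ (r K δ' : ℝ) (e : Eu N), 0 < r → K₁ < K → δ' ≤ δ → ‖e‖ = 1 →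
      (∀ a, ‖a‖ = 1 → -K ≤ HH u r y a a) → HH u r y e e ≤ -(K * (1 - δ')) →
      ∀ w, y + w ∈ Ωᶜ → r / 16 ≤ ‖w‖ → ‖w‖ ≤ r → |⟪w, e⟫| ≤ θ * ‖w‖ := by
    intro r K δ' e hr hK hδ' he hpsd hext w hw h1 h2
    have h := hcone M Ω u hM hu y r K δ e hy.1 hr (by linarith) he
      (hom_ge_of_unit (HH_smul hu hr · y ·) hpsd) (hext.trans (by nlinarith)) w hw h1 h2
    have h3 : C + K * √(δ * (mass N + N)) ≤ K * θ := by nlinarith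
    have h4 : K * |⟪w, e⟫| ≤ K * (θ * ‖w‖) := by
      rw [← mul_assoc]
      exact h.trans (mul_le_mul_of_nonneg_right h3 (norm_nonneg w))
    exact le_of_mul_le_mul_left h4 (by linarith)
  obtain ⟨ρ, hρ, hhole⟩ := hy.2
  -- no hole, small scales
  have hsmall : ∀ r e, 0 < r → r < ρ → ‖e‖ = 1 → -K₁ ≤ HH u r y e e := by
    intro r e hr hrρ he
    by_contra! hlt
    obtain ⟨B, hB, hbd⟩ := HH_bound hM hu y hr
    let S := {a : Eu N // ‖a‖ = 1}
    obtain ⟨K, ⟨a, ha⟩, hK, hsup, hnear⟩ := exists_near_sup (ι := S)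
      (f := fun a => -HH u r y a.1 a.1) ⟨B, by
        rintro _ ⟨⟨a, ha⟩, rfl⟩
        have := hbd r le_rfl a a
        rw [ha] at this
        linarith [neg_le_abs (HH u r y a a)]⟩ (i₀ := ⟨e, he⟩) (a := K₁) (by linarith)
      (by simpa using by linarith) hδ
    obtain ⟨p, hp, hpD⟩ := hhole (r / 4) (by positivity) (by linarith) a ha
    rw [mem_ball, dist_eq_norm] at hp
    set v := p - (y + (r / 4 / 2) • a) with hv
    have hw : p - y = (r / 4 / 2) • a + v := by rw [hv]; abel
    have hn2 : ‖(r / 4 / 2) • a‖ = r / 8 := by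
      rw [norm_smul, ha, Real.norm_of_nonneg (by positivity)]; ring
    have hup : ‖p - y‖ ≤ r / 8 + ‖v‖ := by
      rw [hw]; exact (norm_add_le _ _).trans (by rw [hn2])
    have hin : r / 16 < ⟪p - y, a⟫ := by
      rw [hw, inner_add_left, inner_smul_left, real_inner_self_eq_norm_sq, ha]
      have := neg_le_of_abs_le (abs_real_inner_le_norm v a)
      rw [ha] at this
      simp
      linarith
    have hlow : r / 16 ≤ ‖p - y‖ := by
      have := (le_abs_self _).trans (abs_real_inner_le_norm (p - y) a)
      rw [ha] at this
      linarith
    have := hcone' r K δ a hr hK le_rfl ha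
      (fun b hb => by have := hsup ⟨b, hb⟩; simp only at this; linarith)
      (by simp only at hnear; linarith) (p - y) (by simpa using hpD) hlow (by linarith)
    have h6 : θ * ‖p - y‖ ≤ 1 / 4 * ‖p - y‖ := by gcongr
    linarith [le_abs_self ⟪p - y, a⟫]
  intro r e hr he
  by_contra! hlt
  obtain ⟨B, hB, hbd⟩ := HH_bound hM hu y hρ
  let S := {a : ℝ × Eu N // 0 < a.1 ∧ ‖a.2‖ = 1}
  obtain ⟨K, ⟨⟨R, a⟩, hR, ha⟩, hK, hsup, hnear⟩ := exists_near_sup (ι := S)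
    (f := fun a => -HH u a.1.1 y a.1.2 a.1.2) ⟨max K₁ B, by
      rintro _ ⟨⟨⟨s, a⟩, hs, ha⟩, rfl⟩
      simp only at hs ha ⊢
      rcases lt_or_ge s ρ with h | h
      · exact le_max_of_le_left (by linarith [hsmall s a hs h ha])
      · have := hbd s h a a
        rw [ha] at this
        exact le_max_of_le_right (by linarith [neg_le_abs (HH u s y a a)])⟩
    (i₀ := ⟨(r, e), hr, he⟩) (a := K₁) (by linarith) (by simpa using by linarith)
    (show 0 < δ / 4 by positivity)
  simp only at hR ha hnear
  have hsup' : ∀ s, 0 < s → ∀ b, ‖b‖ = 1 → -K ≤ HH u s y b b := fun s hs b hb => by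
    have := hsup ⟨(s, b), hs, hb⟩
    simp only at this
    linarith
  have hKδ : K₁ * δ < K * δ := by gcongr
  have h1 := hL3 R y a a hR
  have h2 := hL3 (2 * R) y a a (by positivity)
  have h3 := hL3 (2 * (2 * R)) y a a (by positivity)
  rw [ha, abs_le] at h1 h2 h3
  refine not_flat_at_core hN hu hy.2 ha hR hθ1 hθ4 (h := -(K * (1 - δ))) (θ' := θ) ?_ ?_ ?_ ?_
  · intro s hs hle w hw hw1 hw2
    exact hcone' s K δ a hs hK le_rfl ha (hsup' s hs) hle w hw (by linarith) (by linarith)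
  · intro k hk
    simp only [Finset.mem_insert, Finset.mem_singleton] at hk
    rcases hk with rfl | rfl | rfl
    · rw [pow_one]; linarith
    · rw [show (2 : ℝ) ^ 2 * R = 2 * (2 * R) by ring]; linarith
    · rw [show (2 : ℝ) ^ 3 * R = 2 * (2 * (2 * R)) by ring]; linarith
  · linarith
  · intro w hw hw1 hw2
    refine hcone' R K (δ / 4) a hR hK (by linarith) ha (hsup' R hR) (by linarith) w hw ?_ hw2
    nlinarith [norm_nonneg w]

/-! ### Global bounds for second differences -/

theorem MemPinf.cv_chi_eq {M : ℝ} {Ω : Set (Eu N)} {u : Eu N → ℝ} (hu : MemPinf N M Ω u)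
    {g : Eu N → ℝ} {R : ℝ} (hg : ∀ z, R < ‖z‖ → g z = 0) {x : Eu N}
    (hx : R < infDist x (core Ωᶜ)) : cv (chi Ω) g x = cv (fun _ => 1) g x := by
  refine integral_congr_ae ?_
  have hnull : ∀ᵐ z, z ∉ Ωᶜ \ core Ωᶜ := measure_eq_zero_iff_ae_notMem.1
    (measure_diff_core hu.meas.compl)
  filter_upwards [hnull] with z hz
  rcases le_or_gt ‖x - z‖ R with hzd | hzd
  · have hzΩ : z ∈ Ω := by
      by_contra hzΩ
      have hzc : z ∈ core Ωᶜ := by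
        by_contra h; exact hz ⟨hzΩ, h⟩
      have h3 : infDist x (core Ωᶜ) ≤ dist x z := infDist_le_dist_of_mem hzc
      rw [dist_eq_norm] at h3
      linarith
    rw [chi_of_mem hzΩ]
  · rw [hg _ hzd, mul_zero, mul_zero]

theorem exists_lower {N : ℕ} (hN : 2 ≤ N) : ∃ K, 0 < K ∧
    ∀ (M : ℝ) (Ω : Set (Eu N)) (u : Eu N → ℝ), 0 < M → MemPinf N M Ω u → (core Ωᶜ).Nonempty →
    ∀ (r : ℝ) (x e : Eu N), 0 < r → -K * ‖e‖ ^ 2 ≤ HH u r x e e := by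
  obtain ⟨C, hC, hest⟩ := exists_estimates N
  obtain ⟨K, hK, hlow⟩ := exists_lower_core hN
  refine ⟨K + 3 * C, by positivity, fun M Ω u hM hu hne r x e hr => ?_⟩
  refine hom_ge_of_unit (f := fun e => HH u r x e e) (HH_smul hu hr · x ·) (fun e he => ?_) e
  obtain ⟨-, -, -, hE2⟩ := hest M Ω u hM hu
  have key : ∀ s, 0 < s → infDist x (core Ωᶜ) ≤ 2 * s → -(K + 3 * C) ≤ HH u s x e e := by
    intro s hs hd
    obtain ⟨y, hy, hxy⟩ := (infDist_lt_iff hne).1 (hd.trans_lt (by linarith : 2 * s < 3 * s))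
    have h1 := hlow M Ω u hM hu y hy s e hs he
    have h2 := hE2 s x y e e hs
    rw [he, ← dist_eq_norm, mul_one, mul_one, abs_le] at h2
    have h3 : C * (dist x y / s) ≤ C * 3 := by
      gcongr; rw [div_le_iff₀ hs]; exact hxy.le
    linarith
  rcases le_or_gt (infDist x (core Ωᶜ)) (2 * r) with hd | hd
  · exact key r hr hd
  · set d := infDist x (core Ωᶜ) with hdd
    have hrd : r ≤ d / 2 := by linarith
    have hd0 : 0 < d := by linarith
    have h1 := hu.HH_sub hr hrd e e x
    have hφ := (tst_phi (N := N) hr hrd)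
    have h2 : cv (chi Ω) (dd (dd (phi N r (d / 2)) e) e) x
        = cv (fun _ => 1) (dd (dd (phi N r (d / 2)) e) e) x :=
      hu.cv_chi_eq (R := d / 2)
        (dd_eq_zero_of_gt (dd_eq_zero_of_gt (fun w hw => phi_of_ge hr hrd hw.le) e) e) (by linarith)
    rw [h2, cv_one_dd (hφ.dd e)] at h1
    linarith [key (d / 2) (by linarith) (by linarith)]

theorem tendsto_cv_secDiff {f : Eu N → ℝ} (hf : Continuous f) (h x : Eu N) :
    Tendsto (fun r => secDiff (cv f (mker N r)) h x) (nhdsWithin 0 (Ioi 0))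
      (nhds (mass N * secDiff f h x)) := by
  have h1 := ((tendsto_cv_mker hf (x + h)).add (tendsto_cv_mker hf (x - h))).sub
    ((tendsto_cv_mker hf x).const_mul 2)
  refine h1.congr' ?_ |>.trans (le_of_eq ?_)
  · exact Eventually.of_forall fun r => rfl
  · congr 1; simp only [secDiff]; ring

theorem exists_secDiff_bound {N : ℕ} (hN : 2 ≤ N) {M : ℝ} {Ω : Set (Eu N)} {u : Eu N → ℝ}
    (hM : 0 < M) (hu : MemPinf N M Ω u) (hne : (core Ωᶜ).Nonempty) :
    ∃ L, 0 < L ∧ ∀ h x, |secDiff u h x| ≤ L * ‖h‖ ^ 2 := by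
  obtain ⟨K, hK, hlow⟩ := exists_lower hN
  have hm : 0 < mass N := mass_pos hN
  have hl := hlow M Ω u hM hu hne
  refine ⟨(mass N + N * K + K) / mass N, by positivity, fun h x => ?_⟩
  have hev : ∀ᶠ r in nhdsWithin (0 : ℝ) (Ioi 0), 0 < r := eventually_mem_nhdsWithin
  have ht := tendsto_cv_secDiff hu.2.1.continuous h x
  have hlo : -(K * ‖h‖ ^ 2) ≤ mass N * secDiff u h x := by
    refine ge_of_tendsto ht (hev.mono fun r hr => secDiff_ge (contDiff_U hu hr) fun s _ => ?_)
    rw [HH_eq_dd hu hr]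
    simpa using hl r (x + s • h) h hr
  have hup : mass N * secDiff u h x ≤ (mass N + N * K) * ‖h‖ ^ 2 := by
    refine le_of_tendsto ht (hev.mono fun r hr => secDiff_le (contDiff_U hu hr) fun s _ => ?_)
    rw [HH_eq_dd hu hr]
    have h1 := hu.HH_le hr (fun e => hl r (x + s • h) e hr) h
    have : 0 ≤ K * ‖h‖ ^ 2 := by positivity
    simp only
    linarith
  have h1 : 0 ≤ K * ‖h‖ ^ 2 := by positivity
  have h2 : 0 ≤ (mass N + N * K) * ‖h‖ ^ 2 := by positivity
  rw [div_mul_eq_mul_div, le_div_iff₀ hm, mul_comm, ← abs_of_pos hm, ← abs_mul, abs_of_pos hm, abs_le]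
  constructor <;> linarith

/-! ### The shifted second differences -/

/-- The second difference of `u + κ * ‖·‖ ^ 2`. -/
def shiftDiff (u : Eu N → ℝ) (κ : ℝ) (h x : Eu N) : ℝ := secDiff u h x + 2 * κ * ‖h‖ ^ 2

/-- The averaged second derivative of `u + κ * ‖·‖ ^ 2` in direction `e`. -/
def shiftHH (u : Eu N → ℝ) (κ r : ℝ) (x e : Eu N) : ℝ :=
  HH u r x e e + 2 * κ * mass N * ‖e‖ ^ 2

theorem continuous_secDiff {f : Eu N → ℝ} (hf : Continuous f) (h : Eu N) :
    Continuous (secDiff f h) := by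
  unfold secDiff; fun_prop

theorem continuous_shiftDiff {f : Eu N → ℝ} (hf : Continuous f) (κ : ℝ) (h : Eu N) :
    Continuous (shiftDiff f κ h) :=
  (continuous_secDiff hf h).add continuous_const

theorem secDiff_cv {f g : Eu N → ℝ} (hf : Continuous f) (hg : Tst g) (h x : Eu N) :
    secDiff (cv f g) h x = cv (secDiff f h) g x := by
  have h1 : LocallyIntegrable (fun z => f (z + h)) := (by fun_prop : Continuous _).locallyIntegrable
  have h2 : LocallyIntegrable (fun z => f (z + -h)) :=
    (by fun_prop : Continuous _).locallyIntegrable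
  have h3 : LocallyIntegrable (fun z => 2 * f z) := (by fun_prop : Continuous _).locallyIntegrable
  have h4 : LocallyIntegrable (fun z => f (z + h) + f (z + -h)) :=
    (by fun_prop : Continuous _).locallyIntegrable
  have e1 : secDiff f h = fun z => (f (z + h) + f (z + -h)) - 2 * f z := by
    funext z; simp only [secDiff, sub_eq_add_neg]
  rw [e1, cv_sub_left h4 h3 hg, cv_add_left h1 h2 hg, cv_comp_add_left, cv_comp_add_left,
    cv_const_mul_left, secDiff, sub_eq_add_neg x h]

theorem cv_shiftDiff {f : Eu N → ℝ} (hf : Continuous f) (κ : ℝ) {r : ℝ} (hr : 0 < r) (h x : Eu N) :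
    cv (shiftDiff f κ h) (mker N r) x
      = secDiff (cv f (mker N r)) h x + 2 * κ * mass N * ‖h‖ ^ 2 := by
  have e1 : shiftDiff f κ h = fun z => secDiff f h z + (fun _ => 2 * κ * ‖h‖ ^ 2) z := rfl
  rw [e1, cv_add_left (continuous_secDiff hf h).locallyIntegrable
    continuous_const.locallyIntegrable (tst_mker hr), secDiff_cv hf (tst_mker hr), cv_const_left,
    integral_mker hr]
  ring

theorem cv_mker_nonneg {f : Eu N → ℝ} (hf : ∀ z, 0 ≤ f z) {r : ℝ} (hr : 0 < r) (x : Eu N) :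
    0 ≤ cv f (mker N r) x :=
  integral_nonneg fun z => mul_nonneg (hf z) (mker_nonneg hr _)

theorem exists_mker_comparison {N : ℕ} (hN : 2 ≤ N) : ∃ C, 1 ≤ C ∧ ∀ (r R : ℝ) (z w : Eu N), 0 < r →
    0 < R → ‖w - z‖ + r ≤ R / 2 → mker N r z ≤ C * (R / r) ^ N * mker N R w := by
  obtain ⟨C, hC, hb⟩ := (tst_mker (N := N) one_pos).bound
  have hN0 : (0 : ℝ) < N := by positivity
  refine ⟨C / (2 * N) + 1, le_add_of_nonneg_left (by positivity), fun r R z w hr hR h => ?_⟩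
  rcases lt_or_ge r ‖z‖ with hz | hz
  · rw [mker_of_gt hr hz]
    have := mker_nonneg (N := N) hR w
    positivity
  · have hw : ‖w‖ ≤ R / 2 := by
      have : ‖w‖ ≤ ‖w - z‖ + ‖z‖ := by simpa using norm_add_le (w - z) z
      linarith
    rw [mker_of_lt hR (by nlinarith [norm_nonneg w]), mker_scale hr]
    have h1 := (le_abs_self _).trans (hb (r⁻¹ • z))
    calc (r ^ N)⁻¹ * mker N 1 (r⁻¹ • z) ≤ (r ^ N)⁻¹ * C := by gcongr
      _ ≤ (r ^ N)⁻¹ * (C + 2 * N) := by gcongr; linarith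
      _ = _ := by rw [div_pow]; field_simp

section Shift

variable {M : ℝ} {Ω : Set (Eu N)} {u : Eu N → ℝ}

theorem shiftHH_smul (hu : MemPinf N M Ω u) (κ : ℝ) {r : ℝ} (hr : 0 < r) (t : ℝ) (x a : Eu N) :
    shiftHH u κ r x (t • a) = t ^ 2 * shiftHH u κ r x a := by
  rw [shiftHH, shiftHH, HH_smul hu hr, norm_smul, Real.norm_eq_abs, mul_pow, sq_abs]
  ring

theorem le_HH_of_shiftDiff (hu : MemPinf N M Ω u) {κ : ℝ} (h0 : ∀ h x, 0 ≤ shiftDiff u κ h x)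
    {r : ℝ} (hr : 0 < r) (x e : Eu N) : -(2 * κ * mass N) * ‖e‖ ^ 2 ≤ HH u r x e e := by
  have h1 := dd_dd_ge_of_sdiff (contDiff_U hu hr) (c := 2 * κ * mass N) (fun h x => by
    have := cv_mker_nonneg (h0 h) hr x
    rw [cv_shiftDiff hu.2.1.continuous κ hr] at this
    linarith) e x
  rwa [HH_eq_dd hu hr] at h1

theorem shiftHH_nonneg (hu : MemPinf N M Ω u) {κ : ℝ} (h0 : ∀ h x, 0 ≤ shiftDiff u κ h x)
    {r : ℝ} (hr : 0 < r) (x e : Eu N) : 0 ≤ shiftHH u κ r x e := by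
  have := le_HH_of_shiftDiff hu h0 hr x e
  unfold shiftHH; linarith

end Shift

theorem exists_shiftHH_comparison {N : ℕ} (hN : 2 ≤ N) : ∃ C, 1 ≤ C ∧
    ∀ (M : ℝ) (Ω : Set (Eu N)) (u : Eu N → ℝ) (κ : ℝ), MemPinf N M Ω u →
    (∀ h x, 0 ≤ shiftDiff u κ h x) → ∀ (r R : ℝ) (a b e : Eu N), 0 < r → 0 < R →
    ‖b - a‖ + r ≤ R / 2 → shiftHH u κ r a e ≤ C * (R / r) ^ N * shiftHH u κ R b e := by
  obtain ⟨C, hC, hcmp⟩ := exists_mker_comparison hN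
  refine ⟨C, hC, fun M Ω u κ hu h0 r R a b e hr hR hab => ?_⟩
  set Λ := C * (R / r) ^ N with hΛ
  have hUR := contDiff_U hu hR
  have hUr := contDiff_U hu hr
  have hc := hu.2.1.continuous
  set F1 : Eu N → ℝ := fun x => cv u (mker N R) (x + (b - a)) with hF1
  have hF1c : ContDiff ℝ 2 F1 := hUR.comp (contDiff_id.add contDiff_const)
  set F2 : Eu N → ℝ := fun x => (-1) * cv u (mker N r) x with hF2
  have hF2c : ContDiff ℝ 2 F2 := contDiff_const.mul hUr
  set F3 : Eu N → ℝ := fun x => (Λ - 1) * κ * mass N * ‖x‖ ^ 2 with hF3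
  have hn : ContDiff ℝ 2 fun x : Eu N => ‖x‖ ^ 2 := contDiff_normSq.two_of_top
  have hF3c : ContDiff ℝ 2 F3 := contDiff_const.mul hn
  set F : Eu N → ℝ := fun x => Λ * F1 x + (F2 x + F3 x) with hF
  have hΛF1 : ContDiff ℝ 2 fun x => Λ * F1 x := contDiff_const.mul hF1c
  have hF23 : ContDiff ℝ 2 fun x => F2 x + F3 x := hF2c.add hF3c
  have hFc : ContDiff ℝ 2 F := hΛF1.add hF23
  have two : (2 : WithTop ℕ∞) ≠ 0 := by norm_num
  have hsd : ∀ h x, 0 ≤ secDiff F h x := by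
    intro h x
    have e1 : secDiff F h x = Λ * secDiff (cv u (mker N R)) h (x + (b - a))
        - secDiff (cv u (mker N r)) h x + (Λ - 1) * κ * mass N * (2 * ‖h‖ ^ 2) := by
      rw [← secDiff_normSq h x]
      simp only [secDiff, hF, hF1, hF2, hF3]
      rw [add_right_comm x h, add_sub_right_comm x (b - a) h]
      ring
    have e2 : cv (shiftDiff u κ h) (mker N r) x
        ≤ cv (shiftDiff u κ h) (fun z => Λ * mker N R z) (x + (b - a)) := by
      refine cv_mono_right (continuous_shiftDiff hc κ h).locallyIntegrable (tst_mker hr)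
        ((tst_mker hR).const_mul _) _ _ fun z => ?_
      refine mul_le_mul_of_nonneg_left (hcmp r R _ _ hr hR ?_) (h0 h z)
      rwa [show x + (b - a) - z - (x - z) = b - a by abel]
    rw [cv_const_mul_right, cv_shiftDiff hc κ hr, cv_shiftDiff hc κ hR] at e2
    rw [e1]
    linarith
  have key := dd_dd_nonneg_of_sdiff hFc hsd e a
  rw [hF, dd_add (hΛF1.differentiable two) (hF23.differentiable two),
    dd_add (hΛF1.differentiable_dd e) (hF23.differentiable_dd e),
    dd_const_mul (hF1c.differentiable two), dd_const_mul (hF1c.differentiable_dd e),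
    dd_add (hF2c.differentiable two) (hF3c.differentiable two),
    dd_add (hF2c.differentiable_dd e) (hF3c.differentiable_dd e), hF1, dd_comp_add, dd_comp_add,
    hF2, dd_const_mul (hUr.differentiable two), dd_const_mul (hUr.differentiable_dd e), hF3,
    dd_const_mul (hn.differentiable two), dd_const_mul (hn.differentiable_dd e), dd_dd_normSq,
    HH_eq_dd hu hR, HH_eq_dd hu hr] at key
  simp only [add_sub_cancel, real_inner_self_eq_norm_sq] at key
  unfold shiftHH
  linarith

theorem exists_cone_of_shiftHH {N : ℕ} (hN : 2 ≤ N) {M : ℝ} {Ω : Set (Eu N)} {u : Eu N → ℝ} {κ : ℝ}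
    (hM : 0 < M) (hu : MemPinf N M Ω u) (hκ : 0 < κ) (h0 : ∀ h x, 0 ≤ shiftDiff u κ h x) {θ : ℝ}
    (hθ : 0 < θ) : ∃ ε, 0 < ε ∧ ∀ (y w e : Eu N) (r : ℝ), y ∈ Ωᶜ → y + w ∈ Ωᶜ → 0 < r →
    r / 8 ≤ ‖w‖ → ‖w‖ ≤ r / 4 → ‖e‖ = 1 → shiftHH u κ r y e ≤ ε → |⟪w, e⟫| ≤ θ * ‖w‖ := by
  obtain ⟨C₀, hC₀, hest⟩ := exists_estimates N
  obtain ⟨-, hE1, -, -⟩ := hest M Ω u hM hu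
  obtain ⟨C, hC, hcmp⟩ := exists_shiftHH_comparison hN
  have hm := mass_pos hN
  set c := 2 * κ * mass N with hc
  have hc0 : 0 < c := by positivity
  set δ := min 1 (c * θ / (4 * C₀)) with hδ
  have hδ0 : 0 < δ := by positivity
  have hδ1 : δ ≤ 1 := min_le_left _ _
  have hδ2 : 4 * C₀ * δ ≤ c * θ := by
    rw [mul_comm, ← le_div_iff₀ (by positivity)]; exact min_le_right _ _
  clear_value δ
  set A := C * (8 / δ) ^ N * (mass N + N * c) with hA
  have hA0 : 0 < A := by positivity
  refine ⟨(c * θ / 2) ^ 2 / A, by positivity, fun y w e r hy hw hr h1 h2 he hα => ?_⟩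
  have hw0 : 0 < ‖w‖ := by linarith
  have hρ : 0 < δ * ‖w‖ := by positivity
  obtain ⟨s, hs, hmv⟩ := exists_dd_eq ((contDiff_U hu hρ).differentiable_dd e) y w
  rw [HH_eq_dd hu hρ, dd_cv hu.li (tst_mker hρ)] at hmv
  beta_reduce at hmv
  have e1 := hE1 _ y e hρ
  have e2 := hE1 _ (y + w) e hρ
  rw [hu.dd_eq_zero hy, he, mul_zero, sub_zero] at e1
  rw [hu.dd_eq_zero hw, he, mul_zero, sub_zero] at e2
  have e3 : |HH u (δ * ‖w‖) (y + s • w) e w| ≤ c * θ / 2 * ‖w‖ := by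
    rw [← hmv]
    refine (abs_sub _ _).trans ?_
    nlinarith
  have e4 := hcmp M Ω u κ hu h0 (δ * ‖w‖) r (y + s • w) y e hρ hr (by
    rw [sub_add_cancel_left, norm_neg, norm_smul, Real.norm_of_nonneg hs.1.le]
    nlinarith [hs.2])
  have e5 : shiftHH u κ (δ * ‖w‖) (y + s • w) e * (mass N + N * c) ≤ (c * θ / 2) ^ 2 := by
    have h3 : r / (δ * ‖w‖) ≤ 8 / δ := by
      rw [div_le_div_iff₀ hρ hδ0]; nlinarith
    have h4 := shiftHH_nonneg hu h0 hr y e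
    have h5 : shiftHH u κ (δ * ‖w‖) (y + s • w) e
        ≤ C * (8 / δ) ^ N * ((c * θ / 2) ^ 2 / A) := by
      refine e4.trans ?_
      gcongr
    calc _ ≤ C * (8 / δ) ^ N * ((c * θ / 2) ^ 2 / A) * (mass N + N * c) := by gcongr
      _ = (c * θ / 2) ^ 2 / A * A := by rw [hA]; ring
      _ = _ := div_mul_cancel₀ _ hA0.ne'
  have e6 := hu.HH_cauchy hρ (fun e => le_HH_of_shiftDiff hu h0 hρ (y + s • w) e) e w
  have e7 : (HH u (δ * ‖w‖) (y + s • w) e w + c * ⟪e, w⟫) ^ 2 ≤ (c * θ / 2 * ‖w‖) ^ 2 := by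
    refine e6.trans ?_
    rw [mul_pow, ← mul_assoc]
    exact mul_le_mul_of_nonneg_right e5 (by positivity)
  have e8 := abs_le_of_sq_le_sq e7 (by positivity)
  have e9 : c * |⟪w, e⟫| = |c * ⟪e, w⟫| := by rw [abs_mul, abs_of_pos hc0, real_inner_comm]
  have e10 := abs_sub_abs_le_abs_sub (c * ⟪e, w⟫) (-HH u (δ * ‖w‖) (y + s • w) e w)
  rw [abs_neg, sub_neg_eq_add, add_comm (c * ⟪e, w⟫)] at e10
  have e11 : c * |⟪w, e⟫| ≤ c * (θ * ‖w‖) := by rw [e9]; linarith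
  exact le_of_mul_le_mul_left e11 hc0

/-! ### Degenerate directions are impossible -/

theorem not_forall_exists_shiftHH_le {N : ℕ} (hN : 2 ≤ N) {M : ℝ} {Ω : Set (Eu N)} {u : Eu N → ℝ}
    {κ : ℝ} (hM : 0 < M) (hu : MemPinf N M Ω u) (hκ : 0 < κ) (h0 : ∀ h x, 0 ≤ shiftDiff u κ h x)
    (hsmall : ∀ ε, 0 < ε → ∃ y ∈ core Ωᶜ, ∃ r e, 0 < r ∧ ‖e‖ = 1 ∧ shiftHH u κ r y e ≤ ε) :
    False := by
  obtain ⟨C, hC, hcmp⟩ := exists_shiftHH_comparison hN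
  obtain ⟨θ, hθ0, hθ1, hθ4⟩ := exists_aperture N
  obtain ⟨ε₀, hε₀, hcone⟩ := exists_cone_of_shiftHH hN hM hu hκ h0 hθ0
  have hdr := driftC_pos N
  obtain ⟨θ', hθ', hθd⟩ : ∃ θ' : ℝ, 0 < θ' ∧ driftC N * θ' ^ 2 ≤ ε₀ / 2 := by
    refine ⟨√(ε₀ / 2 / driftC N), by positivity, ?_⟩
    rw [Real.sq_sqrt (by positivity), mul_div_cancel₀ _ hdr.ne']
  obtain ⟨ε₁, hε₁, hcone'⟩ := exists_cone_of_shiftHH hN hM hu hκ h0 hθ'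
  have hA : 0 < C * 16 ^ N := by positivity
  obtain ⟨y, hy, r, e, hr, he, hα⟩ := hsmall (min (ε₀ / 2) ε₁ / (C * 16 ^ N)) (by positivity)
  have hle : ∀ s, r / 16 ≤ s → s ≤ r / 2 → shiftHH u κ s y e ≤ min (ε₀ / 2) ε₁ := by
    intro s h1 h2
    have hs : 0 < s := by linarith
    have h3 := hcmp M Ω u κ hu h0 s r y y e hs hr (by simpa using h2)
    have h4 : r / s ≤ 16 := by rw [div_le_iff₀ hs]; linarith
    refine h3.trans ?_
    calc _ ≤ C * 16 ^ N * (min (ε₀ / 2) ε₁ / (C * 16 ^ N)) := by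
          have := shiftHH_nonneg hu h0 hr y e
          gcongr
      _ = _ := mul_div_cancel₀ _ hA.ne'
  have hHH : ∀ s, shiftHH u κ s y e = HH u s y e e + 2 * κ * mass N := fun s => by
    rw [shiftHH, he]; ring
  refine not_flat_at_core hN hu hy.2 he (R := r / 16) (by positivity) hθ1 hθ4
    (h := ε₀ - 2 * κ * mass N) (θ' := θ') ?_ ?_ ?_ ?_
  · intro s hs hle w hw h1 h2
    exact hcone y w e s hy.1 hw hs h1 h2 he (by rw [hHH]; linarith)
  · intro k hk
    have : r / 16 ≤ 2 ^ k * (r / 16) ∧ 2 ^ k * (r / 16) ≤ r / 2 := by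
      simp only [Finset.mem_insert, Finset.mem_singleton] at hk
      rcases hk with rfl | rfl | rfl <;> constructor <;> linarith
    have h1 := (hle _ this.1 this.2).trans (min_le_left _ _)
    rw [hHH] at h1
    linarith
  · have h1 := (hle _ le_rfl (by linarith)).trans (min_le_left _ _)
    rw [hHH] at h1
    linarith
  · intro w hw h1 h2
    refine hcone' y w e (r / 4) hy.1 hw (by positivity) ?_ (by linarith) he
      ((hle _ (by linarith) (by linarith)).trans (min_le_right _ _))
    nlinarith [norm_nonneg w]

/-! ### A degenerate second difference at a point of the coincidence set -/

theorem shiftHH_eq_cv_dd {N : ℕ} {M : ℝ} {Ω : Set (Eu N)} {u : Eu N → ℝ} (hu : MemPinf N M Ω u)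
    (κ : ℝ) {r : ℝ} (hr : 0 < r) (y x e : Eu N) : shiftHH u κ r x e
      = cv (dd (fun z => u z + κ * ‖z - y‖ ^ 2) e) (dd (mker N r) e) x := by
  have hk := tst_mker (N := N) hr
  have hq : ContDiff ℝ (⊤ : ℕ∞) fun z : Eu N => ‖z + -y‖ ^ 2 :=
    contDiff_normSq.comp (contDiff_id.add contDiff_const)
  have hκq : ContDiff ℝ (⊤ : ℕ∞) fun z : Eu N => κ * ‖z + -y‖ ^ 2 := contDiff_const.mul hq
  have one : (1 : WithTop ℕ∞) ≤ ((⊤ : ℕ∞) : WithTop ℕ∞) := by exact_mod_cast le_top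
  have h1 : ContDiff ℝ 1 fun z : Eu N => u z + κ * ‖z + -y‖ ^ 2 := hu.2.1.add (hκq.of_le one)
  simp only [sub_eq_add_neg]
  rw [← cv_by_parts h1 (hk.dd e), cv_add_left hu.li hκq.continuous.locallyIntegrable
    ((hk.dd e).dd e), cv_const_mul_left, cv_by_parts (hq.of_le one) (hk.dd e),
    cv_by_parts ((contDiff_dd hq e).of_le one) hk, dd_comp_add (fun z => ‖z‖ ^ 2), dd_comp_add,
    dd_dd_normSq, cv_const_left, integral_mker hr, shiftHH, HH, real_inner_self_eq_norm_sq]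
  ring

theorem abs_dd_le_of_shiftDiff_le {N : ℕ} {k : Eu N → ℝ} (hk : Differentiable ℝ k) {L : ℝ}
    (h0 : ∀ h x, 0 ≤ secDiff k h x) (hL : ∀ h x, secDiff k h x ≤ L * ‖h‖ ^ 2)
    (hk0 : ∀ x, 0 ≤ k x) {y e : Eu N} (he : ‖e‖ = 1) {l δ η : ℝ} (hl : 0 < l)
    (h1 : k (y + l • e) ≤ η * l ^ 2) (h2 : k (y - l • e) ≤ η * l ^ 2) {x : Eu N}
    (hx : ‖x - y‖ ≤ δ * l) : |dd k e x| ≤ (2 * η + L * δ ^ 2) * l := by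
  have hL0 : 0 ≤ L := by
    have := (h0 e y).trans (hL e y)
    rw [he] at this
    linarith
  have key : ∀ h : Eu N, k (y + h) ≤ η * l ^ 2 → k (x + h) ≤ (2 * η + L * δ ^ 2) * l ^ 2 := by
    intro h hh
    have h3 := hL (x - y) (y + h)
    have h4 := hk0 (y + h - (x - y))
    have h5 : ‖x - y‖ ^ 2 ≤ (δ * l) ^ 2 := by gcongr
    have h6 := mul_le_mul_of_nonneg_left h5 hL0
    rw [secDiff, show y + h + (x - y) = x + h by abel] at h3
    nlinarith
  have g1 := (gradient_ineq hk h0 x (l • e)).trans (key _ h1)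
  have g2 := (gradient_ineq hk h0 x ((-l) • e)).trans
    (key _ (by rwa [neg_smul, ← sub_eq_add_neg]))
  rw [dd_smul_dir] at g1 g2
  have := hk0 x
  rw [abs_le]
  constructor <;> nlinarith

theorem exists_small_shiftHH_of_degenerate {N : ℕ} {M : ℝ} {Ω : Set (Eu N)}
    {u : Eu N → ℝ} {κ L : ℝ} (hM : 0 < M) (hu : MemPinf N M Ω u) (hL0 : 0 < L)
    (h0 : ∀ h x, 0 ≤ shiftDiff u κ h x) (hL : ∀ h x, shiftDiff u κ h x ≤ L * ‖h‖ ^ 2)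
    (hdeg : ∀ η, 0 < η → ∃ y ∈ closure (core Ωᶜ), ∃ h, h ≠ 0 ∧ shiftDiff u κ h y ≤ η * ‖h‖ ^ 2)
    {ε : ℝ} (hε : 0 < ε) :
    ∃ y ∈ core Ωᶜ, ∃ r e, 0 < r ∧ ‖e‖ = 1 ∧ shiftHH u κ r y e ≤ ε := by
  obtain ⟨C₀, hC₀, hest⟩ := exists_estimates N
  obtain ⟨-, -, -, hE2⟩ := hest M Ω u hM hu
  obtain ⟨C, hC, hb⟩ := exists_mker_bounds N
  set δ := ε / (2 * C * (2 + L)) with hδ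
  have hδ0 : 0 < δ := by positivity
  have hδ1 : C * (2 + L) * δ = ε / 2 := by rw [hδ]; field_simp
  clear_value δ
  obtain ⟨y, hy, h, hh, hQ⟩ := hdeg (δ ^ 2) (by positivity)
  have hcl : closure (core Ωᶜ) ⊆ Ωᶜ :=
    closure_minimal (fun z hz => hz.1) hu.1.isClosed_compl
  have hyΩ := hcl hy
  set l := ‖h‖ with hl
  have hl0 : 0 < l := norm_pos_iff.2 hh
  set e := l⁻¹ • h with he_def
  have he : ‖e‖ = 1 := by
    rw [he_def, norm_smul, norm_inv, hl, norm_norm, inv_mul_cancel₀ (hl ▸ hl0.ne')]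
  have hle : l • e = h := by rw [he_def, smul_smul, mul_inv_cancel₀ hl0.ne', one_smul]
  set k : Eu N → ℝ := fun z => u z + κ * ‖z - y‖ ^ 2 with hk
  have hq : Differentiable ℝ fun z : Eu N => ‖z + -y‖ ^ 2 := by
    have : ContDiff ℝ (⊤ : ℕ∞) fun z : Eu N => ‖z + -y‖ ^ 2 :=
      contDiff_normSq.comp (contDiff_id.add contDiff_const)
    exact this.two_of_top.differentiable (by norm_num)
  have hkd : Differentiable ℝ k := by
    simp only [hk, sub_eq_add_neg]
    exact hu.differentiable.add (hq.const_mul κ)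
  have hks : ∀ h x, secDiff k h x = shiftDiff u κ h x := by
    intro h x
    have := secDiff_normSq h (x - y)
    simp only [secDiff, shiftDiff, hk] at this ⊢
    rw [add_sub_right_comm x h y, sub_right_comm x h y]
    linear_combination κ * this
  have hk00 : k y = 0 := by simp [hk, (hu.2.2.2.1 y hyΩ).1]
  have hdk : ∀ v, dd k v y = 0 := by
    intro v
    simp only [hk, sub_eq_add_neg]
    rw [dd_add hu.differentiable (hq.const_mul κ), dd_const_mul hq,
      dd_comp_add (fun z => ‖z‖ ^ 2), dd_normSq]
    simp [hu.dd_eq_zero hyΩ]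
  have hk0 : ∀ x, 0 ≤ k x := by
    intro x
    have := gradient_ineq hkd (fun h x => by rw [hks]; exact h0 h x) y (x - y)
    rw [hk00, hdk, add_sub_cancel] at this
    linarith
  have hs : k (y + l • e) + k (y - l • e) ≤ δ ^ 2 * l ^ 2 := by
    rw [← hks, secDiff, hk00] at hQ
    rw [hle]; linarith
  have hbd := fun x (hx : ‖x - y‖ ≤ δ * l) =>
    abs_dd_le_of_shiftDiff_le hkd (fun h x => by rw [hks]; exact h0 h x)
      (fun h x => by rw [hks]; exact hL h x) hk0 he hl0 (η := δ ^ 2)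
      (by linarith [hk0 (y - l • e)]) (by linarith [hk0 (y + l • e)]) hx
  have hρ : 0 < δ * l := by positivity
  have h3 := ((hb _ _ _ y hρ hbd).2.1 e)
  rw [← shiftHH_eq_cv_dd hu κ hρ, he] at h3
  have h4 : shiftHH u κ (δ * l) y e ≤ ε / 2 := by
    refine (le_abs_self _).trans (h3.trans (le_of_eq ?_))
    rw [← hδ1]; field_simp
  set η := ε / 2 / C₀ * (δ * l) with hη
  have hη0 : 0 < η := by positivity
  obtain ⟨z, hz, hyz⟩ := Metric.mem_closure_iff.1 hy η hη0
  refine ⟨z, hz, δ * l, e, hρ, he, ?_⟩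
  have h5 := hE2 (δ * l) z y e e hρ
  rw [he, mul_one, mul_one, ← dist_eq_norm, dist_comm] at h5
  have h6 : C₀ * (dist y z / (δ * l)) ≤ ε / 2 := by
    have : dist y z / (δ * l) ≤ ε / 2 / C₀ := by rw [div_le_iff₀ hρ]; exact hyz.le
    calc _ ≤ C₀ * (ε / 2 / C₀) := by gcongr
      _ = _ := mul_div_cancel₀ _ hC₀.ne'
  have h7 := (le_abs_self _).trans (h5.trans h6)
  unfold shiftHH at h4 ⊢
  linarith

/-! ### A mean value inequality for truncated supersolutions -/

theorem hasDerivAt_posPart_pow (n : ℕ) (s : ℝ) :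
    HasDerivAt (fun s : ℝ => max s 0 ^ (n + 2)) ((n + 2) * max s 0 ^ (n + 1)) s := by
  have key : ∀ y : ℝ, y ≠ 0 →
      HasDerivAt (fun s : ℝ => max s 0 ^ (n + 2)) ((n + 2) * max y 0 ^ (n + 1)) y := by
    intro y hy
    rcases lt_or_gt_of_ne hy with h | h
    · have h1 : (fun s : ℝ => max s 0 ^ (n + 2)) =ᶠ[nhds y] fun _ => 0 := by
        filter_upwards [gt_mem_nhds h] with s hs
        rw [max_eq_right hs.le, zero_pow (by omega)]
      rw [max_eq_right h.le, zero_pow (by omega), mul_zero]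
      exact (hasDerivAt_const y (0 : ℝ)).congr_of_eventuallyEq h1
    · have h1 : (fun s : ℝ => max s 0 ^ (n + 2)) =ᶠ[nhds y] fun s => s ^ (n + 2) := by
        filter_upwards [lt_mem_nhds h] with s hs
        rw [max_eq_left hs.le]
      rw [max_eq_left h.le]
      have h2 := hasDerivAt_pow (n + 2) y
      push_cast at h2
      exact h2.congr_of_eventuallyEq h1
  rcases eq_or_ne s 0 with rfl | hs
  · exact hasDerivAt_of_hasDerivAt_of_ne (f := fun s : ℝ => max s 0 ^ (n + 2))
      (g := fun s : ℝ => (n + 2) * max s 0 ^ (n + 1)) key (by fun_prop) (by fun_prop)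
  · exact key s hs

theorem contDiff_posPart_pow (n : ℕ) : ContDiff ℝ 1 fun s : ℝ => max s 0 ^ (n + 2) := by
  rw [contDiff_one_iff_deriv]
  refine ⟨fun s => (hasDerivAt_posPart_pow n s).differentiableAt, ?_⟩
  rw [funext fun s => (hasDerivAt_posPart_pow n s).deriv]
  fun_prop

theorem dd_posPart_pow {F : Eu N → ℝ} (hF : Differentiable ℝ F) (n : ℕ) (a : Eu N) :
    dd (fun x => max (1 - F x) 0 ^ (n + 2)) a
      = fun x => -((n + 2) * max (1 - F x) 0 ^ (n + 1) * dd F a x) := by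
  funext x
  have h1 : HasFDerivAt (fun x => 1 - F x) (-(fderiv ℝ F x)) x :=
    (hF x).hasFDerivAt.const_sub 1
  have h2 := (hasDerivAt_posPart_pow n (1 - F x)).comp_hasFDerivAt x h1
  have h3 : (fun x => max (1 - F x) 0 ^ (n + 2))
      = (fun s : ℝ => max s 0 ^ (n + 2)) ∘ fun x => 1 - F x := rfl
  rw [dd, h3, h2.fderiv]
  simp [dd]

theorem cv_lap_nonneg_of_truncated {F : Eu N → ℝ} (hF : ContDiff ℝ (⊤ : ℕ∞) F) {g : Eu N → ℝ}
    (hg : Tst g) (hg0 : ∀ z, 0 ≤ g z) {x : Eu N}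
    (h : ∀ z, g (x - z) ≠ 0 → 1 ≤ F z ∨ lap N F z ≤ 0) :
    0 ≤ cv (fun z => max (1 - F z) 0 ^ 3) (lap N g) x := by
  have one : (1 : WithTop ℕ∞) ≤ ((⊤ : ℕ∞) : WithTop ℕ∞) := by exact_mod_cast le_top
  have hF1 : ContDiff ℝ 1 F := hF.of_le one
  have hFd : Differentiable ℝ F := hF1.differentiable (by norm_num)
  have hc : ∀ n : ℕ, ContDiff ℝ 1 fun z => max (1 - F z) 0 ^ (n + 2) := fun n =>
    (contDiff_posPart_pow n).comp (contDiff_const.sub hF1)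
  have hd : ∀ a, ContDiff ℝ 1 (dd F a) := fun a => (contDiff_dd hF a).of_le one
  have h1 : ∀ a, dd (fun z => max (1 - F z) 0 ^ 3) a
      = fun z => (-3 * max (1 - F z) 0 ^ 2) * dd F a z := fun a => by
    rw [dd_posPart_pow hFd 1]
    funext z; push_cast; ring
  have hc3 : ContDiff ℝ 1 fun z => -3 * max (1 - F z) 0 ^ 2 := contDiff_const.mul (hc 0)
  have hdd : ∀ a, ContDiff ℝ 1 fun z => (-3 * max (1 - F z) 0 ^ 2) * dd F a z := fun a =>
    hc3.mul (hd a)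
  have h2 : ∀ a z, dd (fun z => (-3 * max (1 - F z) 0 ^ 2) * dd F a z) a z
      = 6 * max (1 - F z) 0 * dd F a z ^ 2 - 3 * max (1 - F z) 0 ^ 2 * dd (dd F a) a z := by
    intro a z
    rw [dd_mul (hc3.differentiable (by norm_num)) ((hd a).differentiable (by norm_num)),
      dd_const_mul ((hc 0).differentiable (by norm_num)), dd_posPart_pow hFd 0]
    push_cast; ring
  have hv : LocallyIntegrable fun z => max (1 - F z) 0 ^ 3 := (hc 1).continuous.locallyIntegrable
  have h3 : cv (fun z => max (1 - F z) 0 ^ 3) (lap N g) x = ∑ i : Fin N,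
      cv (fun z => 6 * max (1 - F z) 0 * dd F (EuclideanSpace.single i 1) z ^ 2
        - 3 * max (1 - F z) 0 ^ 2 *
          dd (dd F (EuclideanSpace.single i 1)) (EuclideanSpace.single i 1) z) g x := by
    rw [show lap N g = fun z => ∑ i : Fin N,
      dd (dd g (EuclideanSpace.single i 1)) (EuclideanSpace.single i 1) z from
      funext fun z => lap_eq g z, cv_sum_right _ hv _ fun i _ => (hg.dd _).dd _]
    refine Finset.sum_congr rfl fun i _ => ?_
    rw [cv_by_parts (hc 1) (hg.dd _), h1, cv_by_parts (hdd _) hg]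
    congr 1
    funext z
    exact h2 _ z
  have hcont : ∀ i : Fin N, Continuous fun z =>
      6 * max (1 - F z) 0 * dd F (EuclideanSpace.single i 1) z ^ 2
        - 3 * max (1 - F z) 0 ^ 2 *
          dd (dd F (EuclideanSpace.single i 1)) (EuclideanSpace.single i 1) z := by
    intro i
    have c1 := hF.continuous
    have c2 := (hd (EuclideanSpace.single i 1)).continuous
    have c3 := (contDiff_dd (contDiff_dd hF (EuclideanSpace.single i 1))
      (EuclideanSpace.single i 1)).continuous
    fun_prop
  rw [h3]
  unfold cv
  rw [← integral_finsetSum _ fun i _ => cv_integrable (hcont i).locallyIntegrable hg x]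
  refine integral_nonneg fun z => ?_
  rw [← Finset.sum_mul]
  rcases eq_or_ne (g (x - z)) 0 with hz | hz
  · simp [hz]
  refine mul_nonneg ?_ (hg0 _)
  rw [Finset.sum_sub_distrib, ← Finset.mul_sum, ← Finset.mul_sum, ← lap_eq]
  have hp : 0 ≤ max (1 - F z) 0 := le_max_right _ _
  have hs : 0 ≤ 6 * max (1 - F z) 0 * ∑ i : Fin N, dd F (EuclideanSpace.single i 1) z ^ 2 := by
    positivity
  rcases h z hz with h4 | h4
  · rw [max_eq_right (by linarith)]; simp
  · have : 0 ≤ 3 * max (1 - F z) 0 ^ 2 * -lap N F z := by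
      have : 0 ≤ -lap N F z := by linarith
      positivity
    linarith

theorem cv_mker_le_of_truncated {F : Eu N → ℝ} (hF : ContDiff ℝ (⊤ : ℕ∞) F) {R Λ : ℝ} (hR : 0 < R)
    (hΛ : 1 ≤ Λ) (h0 : ∀ z, 0 ≤ F z) (hFΛ : ∀ z, F z ≤ Λ) {x : Eu N}
    (h : ∀ z, ‖z - x‖ ≤ R → 1 ≤ F z ∨ lap N F z ≤ 0) :
    cv F (mker N R) x ≤ 3 * Λ * mass N * F x := by
  set v : Eu N → ℝ := fun z => max (1 - F z) 0 ^ 3 with hv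
  have hFc := hF.continuous
  have hvc : Continuous v := by fun_prop
  have h1 : ∀ r ∈ Ioo 0 R, cv v (mker N r) x ≤ cv v (mker N R) x := by
    intro r hr
    have h2 := cv_lap_nonneg_of_truncated hF (tst_phi (N := N) hr.1 hr.2.le)
      (phi_nonneg hr.1 hr.2.le) (x := x) (fun z hz => h z (by
        by_contra! hlt
        refine hz (phi_of_ge hr.1 hr.2.le ?_)
        rw [norm_sub_rev]; exact hlt.le))
    rw [lap_phi hr.1 hr.2.le, cv_sub_right hvc.locallyIntegrable (tst_mker hR)
      (tst_mker hr.1)] at h2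
    linarith
  have h2 : mass N * v x ≤ cv v (mker N R) x :=
    le_of_tendsto (tendsto_cv_mker hvc x)
      (eventually_of_mem (Ioo_mem_nhdsGT hR) h1)
  have h3 : cv F (mker N R) x ≤ cv (fun z => Λ - Λ * v z) (mker N R) x := by
    refine cv_mono_left hFc.locallyIntegrable
      (by fun_prop : Continuous fun z => Λ - Λ * v z).locallyIntegrable (tst_mker hR) x fun z => ?_
    refine mul_le_mul_of_nonneg_right ?_ (mker_nonneg hR _)
    simp only [hv]
    rcases le_or_gt 1 (F z) with h4 | h4
    · rw [max_eq_right (by linarith)]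
      simpa using hFΛ z
    · rw [max_eq_left (by linarith)]
      have h5 : F z ≤ 1 - (1 - F z) ^ 3 := by
        have := mul_nonneg (mul_nonneg (h0 z) (by linarith : 0 ≤ 1 - F z))
          (by linarith : 0 ≤ 2 - F z)
        nlinarith
      have h6 := h0 z
      nlinarith
  rw [cv_sub_left continuous_const.locallyIntegrable
    (by fun_prop : Continuous fun z => Λ * v z).locallyIntegrable (tst_mker hR), cv_const_left,
    cv_const_mul_left, integral_mker hR] at h3
  have hm : 0 ≤ mass N := by
    rw [← integral_mker hR]; exact integral_nonneg (mker_nonneg hR)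
  have h4 : 1 - v x ≤ 3 * F x := by
    simp only [hv]
    have h6 := h0 x
    rcases le_or_gt 1 (F x) with h5 | h5
    · rw [max_eq_right (by linarith)]; linarith
    · rw [max_eq_left (by linarith)]
      nlinarith [mul_nonneg h6 h6]
  calc _ ≤ Λ * mass N - Λ * (mass N * v x) := by
        have := mul_le_mul_of_nonneg_left h2 (by linarith : 0 ≤ Λ)
        linarith
    _ = Λ * mass N * (1 - v x) := by ring
    _ ≤ Λ * mass N * (3 * F x) := by gcongr
    _ = _ := by ring

/-! ### A Harnack inequality for the shifted second differences -/

theorem lap_cv {f g : Eu N → ℝ} (hf : LocallyIntegrable f) (hg : Tst g) (x : Eu N) :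
    lap N (cv f g) x = cv f (lap N g) x := by
  have h1 : lap N g = fun z => ∑ i : Fin N,
      dd (dd g (EuclideanSpace.single i 1)) (EuclideanSpace.single i 1) z :=
    funext fun z => lap_eq g z
  rw [lap_eq, h1, cv_sum_right _ hf _ fun i _ => (hg.dd _).dd _]
  refine Finset.sum_congr rfl fun i _ => ?_
  rw [dd_cv hf hg, dd_cv hf (hg.dd _)]

theorem lap_const_mul {f : Eu N → ℝ} (hf : ContDiff ℝ (⊤ : ℕ∞) f) (c : ℝ) (x : Eu N) :
    lap N (fun z => c * f z) x = c * lap N f x := by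
  rw [lap_eq, lap_eq, Finset.mul_sum]
  refine Finset.sum_congr rfl fun i _ => ?_
  rw [dd_const_mul (hf.differentiable (by simp)),
    dd_const_mul ((contDiff_dd hf _).differentiable (by simp))]

theorem cv_one_lap {g : Eu N → ℝ} (hg : Tst g) (x : Eu N) : cv (fun _ => 1) (lap N g) x = 0 := by
  have h1 : lap N g = fun z => ∑ i : Fin N,
      dd (dd g (EuclideanSpace.single i 1)) (EuclideanSpace.single i 1) z :=
    funext fun z => lap_eq g z
  rw [h1, cv_sum_right _ locallyIntegrable_one _ fun i _ => (hg.dd _).dd _]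
  exact Finset.sum_eq_zero fun i _ => cv_one_dd (hg.dd _) _ _

theorem lap_cv_shiftDiff {M : ℝ} {Ω : Set (Eu N)} {u : Eu N → ℝ} (hu : MemPinf N M Ω u)
    (κ : ℝ) {r : ℝ} (hr : 0 < r) (h x : Eu N) :
    lap N (cv (shiftDiff u κ h) (mker N r)) x = secDiff (cv (chi Ω) (mker N r)) h x := by
  have hQ := continuous_shiftDiff hu.2.1.continuous κ h
  have hg := tst_mker (N := N) hr
  have h1 : shiftDiff u κ h = fun z => secDiff u h z + 2 * κ * ‖h‖ ^ 2 * (fun _ => (1 : ℝ)) z := by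
    funext z; simp [shiftDiff]
  rw [lap_cv hQ.locallyIntegrable hg, h1, cv_add_left
    (continuous_secDiff hu.2.1.continuous h).locallyIntegrable
    (by fun_prop : Continuous _).locallyIntegrable hg.lap, cv_const_mul_left, cv_one_lap hg,
    ← secDiff_cv hu.2.1.continuous hg.lap]
  simp only [secDiff, hu.cv_lap hg, mul_zero, add_zero]

theorem abs_cv_shiftDiff_sub_le {M C : ℝ} {Ω : Set (Eu N)} {u : Eu N → ℝ} (hu : MemPinf N M Ω u)
    (hE : ∀ r x, 0 < r → |cv u (mker N r) x - mass N * u x| ≤ C * r ^ 2) (κ : ℝ) {r : ℝ}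
    (hr : 0 < r) (h x : Eu N) :
    |cv (shiftDiff u κ h) (mker N r) x - mass N * shiftDiff u κ h x| ≤ 4 * C * r ^ 2 := by
  rw [cv_shiftDiff hu.2.1.continuous κ hr]
  have h1 := abs_le.1 (hE r (x + h) hr)
  have h2 := abs_le.1 (hE r (x - h) hr)
  have h3 := abs_le.1 (hE r x hr)
  simp only [secDiff, shiftDiff]
  rw [abs_le]
  constructor <;> linarith [h1.1, h1.2, h2.1, h2.2, h3.1, h3.2]

theorem cv_shiftDiff_le_of_nondegenerate (hN : 2 ≤ N) {M κ L c : ℝ} {Ω : Set (Eu N)} {u : Eu N → ℝ}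
    (hM : 0 < M) (hu : MemPinf N M Ω u) (hne : (core Ωᶜ).Nonempty) {h : Eu N}
    (h0 : ∀ x, 0 ≤ shiftDiff u κ h x) (hL : ∀ x, shiftDiff u κ h x ≤ L) (hc : 0 < c)
    (hnd : ∀ y ∈ core Ωᶜ, 2 * c ≤ shiftDiff u κ h y) {R : ℝ} (hR : 0 < R) (x₀ : Eu N) :
    cv (shiftDiff u κ h) (mker N R) x₀ ≤ 3 * (L / c) * mass N * shiftDiff u κ h x₀ := by
  obtain ⟨C, hC, hest⟩ := exists_estimates N
  have hE := (hest M Ω u hM hu).1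
  have hm : 0 < mass N := mass_pos hN
  set Q := shiftDiff u κ h with hQdef
  have hQ : Continuous Q := continuous_shiftDiff hu.2.1.continuous κ h
  have hA : ∀ τ x, 0 < τ → |cv Q (mker N τ) x - mass N * Q x| ≤ 4 * C * τ ^ 2 := fun τ x hτ =>
    abs_cv_shiftDiff_sub_le hu hE κ hτ h x
  have hLc : 2 * c ≤ L := by
    obtain ⟨y, hy⟩ := hne
    exact (hnd y hy).trans (hL y)
  -- uniform continuity near the closed ball of radius `R`
  obtain ⟨δ, hδ, hδQ⟩ : ∃ δ > 0, ∀ x y, ‖x - x₀‖ ≤ R → ‖y - x‖ < δ → |Q y - Q x| < c / 2 := by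
    have huc := (isCompact_closedBall x₀ (R + 1)).uniformContinuousOn_of_continuous hQ.continuousOn
    obtain ⟨δ, hδ, H⟩ := Metric.uniformContinuousOn_iff.1 huc (c / 2) (by positivity)
    refine ⟨min δ 1, by positivity, fun x y hx hy => ?_⟩
    have := H y ?_ x ?_ ?_
    · rwa [Real.dist_eq] at this
    · rw [mem_closedBall, dist_eq_norm]
      have h1 := norm_add_le (y - x) (x - x₀)
      rw [sub_add_sub_cancel] at h1
      have := hy.trans_le (min_le_right _ _)
      linarith
    · rw [mem_closedBall, dist_eq_norm]; linarith
    · rw [dist_eq_norm]; exact hy.trans_le (min_le_left _ _)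
  have main : ∀ τ, 0 < τ → 2 * τ < δ → 4 * C * τ ^ 2 ≤ mass N * (c / 2) →
      cv (cv Q (mker N τ)) (mker N R) x₀ ≤ 3 * (L / c) * mass N * cv Q (mker N τ) x₀ := by
    intro τ hτ hτδ hτc
    have hG : ContDiff ℝ (⊤ : ℕ∞) (cv Q (mker N τ)) :=
      contDiff_cv hQ.locallyIntegrable (tst_mker hτ)
    set a := (c * mass N)⁻¹ with ha
    have ha0 : 0 < a := by positivity
    have hac : a * (mass N * c) = 1 := by rw [ha]; field_simp
    have hF : ContDiff ℝ (⊤ : ℕ∞) fun z => a * cv Q (mker N τ) z := contDiff_const.mul hG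
    have key := cv_mker_le_of_truncated (Λ := L / c) hF hR ?_ ?_ ?_ (x := x₀) ?_
    · rw [cv_const_mul_left] at key
      have : a * cv (cv Q (mker N τ)) (mker N R) x₀
          ≤ a * (3 * (L / c) * mass N * cv Q (mker N τ) x₀) := by linarith
      exact le_of_mul_le_mul_left this ha0
    · rw [le_div_iff₀ hc]; linarith
    · exact fun z => mul_nonneg ha0.le (cv_mker_nonneg h0 hτ z)
    · intro z
      have h1 := cv_mono_left hQ.locallyIntegrable
        (continuous_const (y := L)).locallyIntegrable (tst_mker hτ) z
        fun w => mul_le_mul_of_nonneg_right (hL w) (mker_nonneg hτ _)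
      rw [cv_const_left, integral_mker hτ] at h1
      calc _ ≤ a * (L * mass N) := by gcongr
        _ = a * (mass N * c) * (L / c) := by field_simp
        _ = _ := by rw [hac, one_mul]
    · intro z hz
      rcases lt_or_ge (infDist z (core Ωᶜ)) (2 * τ) with hd | hd
      · left
        obtain ⟨y, hy, hyz⟩ := (infDist_lt_iff hne).1 hd
        rw [dist_comm, dist_eq_norm] at hyz
        have h1 := (abs_lt.1 (hδQ z y hz (hyz.trans hτδ))).2
        have h2 := hnd y hy
        have h3 := (abs_le.1 (hA τ z hτ)).1
        have h4 : mass N * (3 / 2 * c) ≤ mass N * Q z := by gcongr; linarith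
        rw [← hac]
        gcongr
        linarith
      · right
        rw [lap_const_mul hG, lap_cv_shiftDiff hu κ hτ]
        refine mul_nonpos_of_nonneg_of_nonpos ha0.le ?_
        have h1 : cv (chi Ω) (mker N τ) z = mass N := by
          rw [hu.cv_chi_eq (R := τ) (fun w hw => mker_of_gt hτ hw) (by linarith), cv_const_left,
            integral_mker hτ, one_mul]
        have h2 := hu.cv_chi_le hτ (z + h)
        have h3 := hu.cv_chi_le hτ (z - h)
        simp only [secDiff]
        linarith
  have hlim : ∀ᶠ τ in nhdsWithin (0 : ℝ) (Ioi 0), mass N * cv Q (mker N R) x₀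
      - 3 * (L / c) * mass N * (mass N * Q x₀)
      ≤ (mass N + 3 * (L / c) * mass N) * (4 * C * τ ^ 2) := by
    have e1 : ∀ᶠ τ in nhdsWithin (0 : ℝ) (Ioi 0), 2 * τ < δ := by
      have : Tendsto (fun τ : ℝ => 2 * τ) (nhdsWithin 0 (Ioi 0)) (nhds (2 * 0)) :=
        (by fun_prop : Continuous fun τ : ℝ => 2 * τ).continuousAt.tendsto.mono_left
          nhdsWithin_le_nhds
      exact this.eventually_lt_const (by simpa using hδ)
    have e2 : ∀ᶠ τ in nhdsWithin (0 : ℝ) (Ioi 0), 4 * C * τ ^ 2 < mass N * (c / 2) := by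
      have : Tendsto (fun τ : ℝ => 4 * C * τ ^ 2) (nhdsWithin 0 (Ioi 0))
          (nhds (4 * C * 0 ^ 2)) :=
        (by fun_prop : Continuous fun τ : ℝ => 4 * C * τ ^ 2).continuousAt.tendsto.mono_left
          nhdsWithin_le_nhds
      exact this.eventually_lt_const (by simp; positivity)
    filter_upwards [e1, e2, eventually_mem_nhdsWithin] with τ h1 h2 hτ
    have h3 := main τ hτ h1 h2.le
    have hG : Continuous (cv Q (mker N τ)) :=
      (contDiff_cv hQ.locallyIntegrable (tst_mker hτ)).continuous
    have h4 := cv_mono_left (f := fun z => mass N * Q z - 4 * C * τ ^ 2)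
      (by fun_prop : Continuous _).locallyIntegrable hG.locallyIntegrable (tst_mker hR) x₀
      fun z => mul_le_mul_of_nonneg_right
        (by have := (abs_le.1 (hA τ z hτ)).1; linarith) (mker_nonneg hR _)
    rw [cv_sub_left (by fun_prop : Continuous _).locallyIntegrable
      continuous_const.locallyIntegrable (tst_mker hR), cv_const_mul_left, cv_const_left,
      integral_mker hR] at h4
    have h5 : 3 * (L / c) * mass N * cv Q (mker N τ) x₀
        ≤ 3 * (L / c) * mass N * (mass N * Q x₀ + 4 * C * τ ^ 2) := by
      have := (abs_le.1 (hA τ x₀ hτ)).2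
      have : 0 < L := by linarith
      gcongr
      linarith
    linarith
  have hten : Tendsto (fun τ : ℝ => (mass N + 3 * (L / c) * mass N) * (4 * C * τ ^ 2))
      (nhdsWithin 0 (Ioi 0)) (nhds ((mass N + 3 * (L / c) * mass N) * (4 * C * 0 ^ 2))) :=
    (by fun_prop : Continuous fun τ : ℝ => (mass N + 3 * (L / c) * mass N) * (4 * C * τ ^ 2)
      ).continuousAt.tendsto.mono_left nhdsWithin_le_nhds
  have h6 := ge_of_tendsto hten hlim
  refine le_of_mul_le_mul_left (?_ : mass N * _ ≤ mass N * _) hm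
  norm_num at h6
  linarith

/-! ### Convexity and nonnegativity -/

theorem exists_small_shiftHH_of_nondegenerate (hN : 2 ≤ N) {M κ L η : ℝ} {Ω : Set (Eu N)}
    {u : Eu N → ℝ} (hM : 0 < M) (hu : MemPinf N M Ω u) (hne : (core Ωᶜ).Nonempty) (hL0 : 0 < L)
    (h0 : ∀ h x, 0 ≤ shiftDiff u κ h x) (hL : ∀ h x, shiftDiff u κ h x ≤ L * ‖h‖ ^ 2) (hη : 0 < η)
    (hnd : ∀ y ∈ core Ωᶜ, ∀ h, η * ‖h‖ ^ 2 ≤ shiftDiff u κ h y)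
    (hmin : ∀ ε, 0 < ε → ∃ h x, h ≠ 0 ∧ shiftDiff u κ h x ≤ ε * ‖h‖ ^ 2) {ε : ℝ} (hε : 0 < ε) :
    ∃ y ∈ core Ωᶜ, ∃ r e, 0 < r ∧ ‖e‖ = 1 ∧ shiftHH u κ r y e ≤ ε := by
  obtain ⟨C, hC, hcmp⟩ := exists_shiftHH_comparison hN
  have hm : 0 < mass N := mass_pos hN
  obtain ⟨y, hy⟩ := id hne
  have hC0 : 0 < C := by linarith
  set K := C * 4 ^ N * (6 * (L / η) * mass N) with hK
  have hK0 : 0 < K := by positivity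
  obtain ⟨h, x, hh, hx⟩ := hmin (ε / K) (by positivity)
  have hh0 : 0 < ‖h‖ := norm_pos_iff.2 hh
  set R := 4 * (‖x - y‖ + ‖h‖ + 1) with hRdef
  have hR : 0 < R := by positivity
  have h1 : ∀ s ∈ Icc (-1 : ℝ) 1,
      shiftHH u κ (R / 4) y h / (C * 4 ^ N) ≤ shiftHH u κ R (x + s • h) h := by
    intro s hs
    have e1 : ‖x + s • h - y‖ ≤ ‖x - y‖ + ‖h‖ := by
      rw [add_sub_right_comm]
      refine (norm_add_le _ _).trans ?_
      gcongr
      rw [norm_smul, Real.norm_eq_abs]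
      exact mul_le_of_le_one_left hh0.le (abs_le.2 hs)
    have e2 := hcmp M Ω u κ hu h0 (R / 4) R y (x + s • h) h (by positivity) hR (by linarith)
    have e3 : R / (R / 4) = 4 := by field_simp
    rw [e3] at e2
    rw [div_le_iff₀ (by positivity)]
    linarith
  have h2 : shiftHH u κ (R / 4) y h / (C * 4 ^ N) - 2 * κ * mass N * ‖h‖ ^ 2
      ≤ secDiff (cv u (mker N R)) h x := by
    refine secDiff_ge (contDiff_U hu hR) fun s hs => ?_
    rw [HH_eq_dd hu hR]
    exact sub_le_iff_le_add.2 (h1 s hs)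
  have h3 := cv_shiftDiff_le_of_nondegenerate hN hM hu hne (h0 h) (hL h)
    (c := η * ‖h‖ ^ 2 / 2) (by positivity) (fun z hz => by linarith [hnd z hz h]) hR x
  rw [cv_shiftDiff hu.2.1.continuous κ hR] at h3
  have h4 : shiftHH u κ (R / 4) y h / (C * 4 ^ N)
      ≤ 6 * (L / η) * mass N * (ε / K * ‖h‖ ^ 2) := by
    have e1 : L * ‖h‖ ^ 2 / (η * ‖h‖ ^ 2 / 2) = 2 * (L / η) := by field_simp
    rw [e1] at h3
    calc _ ≤ 6 * (L / η) * mass N * shiftDiff u κ h x := by linarith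
      _ ≤ _ := by gcongr
  have h5 : shiftHH u κ (R / 4) y h ≤ ε * ‖h‖ ^ 2 := by
    rw [div_le_iff₀ (by positivity)] at h4
    refine h4.trans_eq ?_
    rw [hK]; field_simp
  refine ⟨y, hy, R / 4, ‖h‖⁻¹ • h, by positivity, ?_, ?_⟩
  · rw [norm_smul, norm_inv, norm_norm, inv_mul_cancel₀ hh0.ne']
  · rw [shiftHH_smul hu κ (by positivity), inv_pow, inv_mul_le_iff₀ (by positivity)]
    linarith

theorem secDiff_nonneg (hN : 2 ≤ N) {M : ℝ} {Ω : Set (Eu N)} {u : Eu N → ℝ} (hM : 0 < M)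
    (hu : MemPinf N M Ω u) (hne : (core Ωᶜ).Nonempty) (h x : Eu N) : 0 ≤ secDiff u h x := by
  obtain ⟨L, hL0, hL⟩ := exists_secDiff_bound hN hM hu hne
  set S : Set ℝ := {κ | 0 ≤ κ ∧ ∀ h x, 0 ≤ shiftDiff u κ h x} with hS
  have hSbdd : BddBelow S := ⟨0, fun κ hκ => hκ.1⟩
  have hSne : S.Nonempty := ⟨L, hL0.le, fun h x => by
    have := (abs_le.1 (hL h x)).1
    have : 0 ≤ L * ‖h‖ ^ 2 := by positivity
    simp only [shiftDiff]
    linarith⟩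
  have hScl : IsClosed S := by
    have : S = Ici 0 ∩ ⋂ h : Eu N, ⋂ x : Eu N, {κ | 0 ≤ shiftDiff u κ h x} := by
      ext κ; simp [hS, Set.mem_ofPred_eq]
    rw [this]
    refine isClosed_Ici.inter (isClosed_iInter fun h => isClosed_iInter fun x => ?_)
    exact isClosed_le continuous_const (by unfold shiftDiff; fun_prop)
  set κ := sInf S with hκdef
  obtain ⟨hκ0, h0⟩ : κ ∈ S := hScl.csInf_mem hSne hSbdd
  rcases hκ0.eq_or_lt with hκ | hκ
  · have := h0 h x
    simpa [shiftDiff, ← hκ] using this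
  exfalso
  have hL' : ∀ h x, shiftDiff u κ h x ≤ (L + 2 * κ) * ‖h‖ ^ 2 := fun h x => by
    have := (abs_le.1 (hL h x)).2
    simp only [shiftDiff]
    linarith
  have hmin : ∀ ε, 0 < ε → ∃ h x, h ≠ 0 ∧ shiftDiff u κ h x ≤ ε * ‖h‖ ^ 2 := by
    intro ε hε
    by_contra! hcon
    set δ := min κ (ε / 2) with hδ
    have hδ0 : 0 < δ := by positivity
    have hmem : κ - δ ∈ S := by
      refine ⟨sub_nonneg.2 (min_le_left _ _), fun h x => ?_⟩
      rcases eq_or_ne h 0 with rfl | hh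
      · simp [shiftDiff, secDiff, two_mul]
      · have h1 := hcon h x hh
        have h2 : δ * ‖h‖ ^ 2 ≤ ε / 2 * ‖h‖ ^ 2 := by gcongr; exact min_le_right _ _
        simp only [shiftDiff] at h1 ⊢
        linarith
    have := csInf_le hSbdd hmem
    linarith
  refine not_forall_exists_shiftHH_le hN hM hu hκ h0 fun ε hε => ?_
  by_cases hdeg : ∀ η : ℝ, 0 < η →
      ∃ y ∈ closure (core Ωᶜ), ∃ h, h ≠ 0 ∧ shiftDiff u κ h y ≤ η * ‖h‖ ^ 2
  · exact exists_small_shiftHH_of_degenerate hM hu (by positivity) h0 hL' hdeg hε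
  · push Not at hdeg
    obtain ⟨η, hη, hnd⟩ := hdeg
    refine exists_small_shiftHH_of_nondegenerate hN hM hu hne (by positivity) h0 hL' hη
      (fun y hy h => ?_) hmin hε
    rcases eq_or_ne h 0 with rfl | hh
    · simpa using h0 0 y
    · exact (hnd y (subset_closure hy) h hh).le

end

/-- a global solution whose complement has nonempty interior is nonnegative. -/
theorem global_solution_nonneg (N : ℕ) (hN : 2 ≤ N) (M : ℝ) (hM : 0 < M)
    (Ω : Set (EuclideanSpace ℝ (Fin N))) (u : EuclideanSpace ℝ (Fin N) → ℝ)
    (hu : MemPinf N M Ω u) (hint : (interior Ωᶜ).Nonempty) :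
    ∀ x, 0 ≤ u x := by
  intro x
  obtain ⟨z, hz⟩ := hint
  have hzc := interior_subset hz
  have h1 := gradient_ineq hu.differentiable
    (secDiff_nonneg hN hM hu ⟨z, interior_subset_core _ hz⟩) z (x - z)
  rwa [hu.eq_zero hzc, hu.dd_eq_zero hzc, add_zero, add_sub_cancel] at h1
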